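/- arXiv:1911.04515 — 2 statements merged into one kernel-verified Lean document; each statement's English description precedes it below -/
import Mathlib

section
/- Let d ≥ 1, ν > 0, T > 0, β ∈ (0,1). Let φ : ℝ^d → ℝ^d be of class C^{2+β}_b(ℝ^d). Let f, g : [0,T] × ℝ^d × ℝ^d → ℝ^d be continuous with continuous partial derivatives ∂_t f, ∂_x f, ∂_y f, ∂_t g, ∂_x g, ∂_y g, and suppose there exist a constant C ≥ 0 and nondecreasing positive functions Λ₁, Λ₂ : ℝ_{≥0} → ℝ_{>0} such that for all (t,x,y) and t' ∈ [0,T]: ⟨f(t,x,y), y⟩ ≤ C(1+|y|²); |g(t,x,y)| + |∂_x g(t,x,y)| + |∂_y g(t,x,y)| ≤ Λ₁(|y|) and |g(t,x,y) − g(t',x,y)| ≤ Λ₁(|y|) |t−t'|^{β/2}; and |f(t,x,y)| + |∂_x f(t,x,y)| + |∂_y f(t,x,y)| ≤ Λ₂(|y|) and |f(t,x,y) − f(t',x,y)| ≤ Λ₂(|y|) |t−t'|^{β/2}. Then there exists y ∈ C^{1,2}_b([0,T] × ℝ^d; ℝ^d) such that ∂_t y(t,x) = ν Δy(t,x) − (g(t,x,y(t,x)),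 ∂_x) y(t,x) + f(t,x,y(t,x)) for all (t,x) ∈ [0,T] × ℝ^d and y(0,x) = φ(x) for all x ∈ ℝ^d. -/
open MeasureTheory Set Filter
open scoped Topology

noncomputable section

/-- `ℝ^d` with the Euclidean norm. -/
abbrev Ed (d : ℕ) := EuclideanSpace ℝ (Fin d)

/-- Componentwise spatial Laplacian of a map `u : ℝ^d → ℝ^d`. -/
noncomputable def lapl {d : ℕ} (u : Ed d → Ed d) (x : Ed d) : Ed d :=
  ∑ j : Fin d, fderiv ℝ (fun z => fderiv ℝ u z (EuclideanSpace.single j (1:ℝ))) x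
    (EuclideanSpace.single j (1:ℝ))

/-- `φ ∈ C^{2+β}_b(ℝ^d; ℝ^d)`: bounded, twice continuously differentiable with bounded
first and second derivatives, and the second derivative is `β`-Hölder continuous. -/
structure IsC2BetaB {d : ℕ} (β : ℝ) (φ : Ed d → Ed d) : Prop where
  contDiff : ContDiff ℝ 2 φ
  bdd : ∃ M : ℝ, ∀ x, ‖φ x‖ ≤ M ∧ ‖fderiv ℝ φ x‖ ≤ M ∧ ‖fderiv ℝ (fderiv ℝ φ) x‖ ≤ M
  holder : ∃ L : ℝ, 0 ≤ L ∧ ∀ x x',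
    ‖fderiv ℝ (fderiv ℝ φ) x - fderiv ℝ (fderiv ℝ φ) x'‖ ≤ L * ‖x - x'‖ ^ β

/-- `y ∈ C^{1,2}_b([0,T] × ℝ^d; ℝ^d)`, with `yt` its time derivative: `y` is continuously
differentiable in `t` and twice continuously differentiable in `x`, and is bounded
together with these derivatives. -/
structure IsC12b {d : ℕ} (T : ℝ) (y yt : ℝ → Ed d → Ed d) : Prop where
  hasDerivT : ∀ x, ∀ t ∈ Icc (0:ℝ) T, HasDerivWithinAt (fun s => y s x) (yt t x) (Icc (0:ℝ) T) t
  contT : ContinuousOn (fun p : ℝ × Ed d => yt p.1 p.2) (Icc (0:ℝ) T ×ˢ (univ : Set (Ed d)))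
  contDiffX : ∀ t ∈ Icc (0:ℝ) T, ContDiff ℝ 2 (y t)
  cont : ContinuousOn (fun p : ℝ × Ed d => y p.1 p.2) (Icc (0:ℝ) T ×ˢ (univ : Set (Ed d)))
  bdd : ∃ M : ℝ, ∀ t ∈ Icc (0:ℝ) T, ∀ x, ‖y t x‖ ≤ M ∧ ‖yt t x‖ ≤ M ∧
    ‖fderiv ℝ (y t) x‖ ≤ M ∧ ‖fderiv ℝ (fderiv ℝ (y t)) x‖ ≤ M

/-- `f : [0,T] × ℝ^d × ℝ^d → ℝ^d` is continuous with continuous partial derivatives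
`∂_t f` (here the given function `ft`), `∂_x f` and `∂_y f`. -/
structure ContPartials {d : ℕ} (T : ℝ) (f ft : ℝ → Ed d → Ed d → Ed d) : Prop where
  cont : ContinuousOn (fun p : ℝ × Ed d × Ed d => f p.1 p.2.1 p.2.2)
    (Icc (0:ℝ) T ×ˢ (univ : Set (Ed d × Ed d)))
  hasDerivT : ∀ x v, ∀ t ∈ Icc (0:ℝ) T,
    HasDerivWithinAt (fun s => f s x v) (ft t x v) (Icc (0:ℝ) T) t
  contT : ContinuousOn (fun p : ℝ × Ed d × Ed d => ft p.1 p.2.1 p.2.2)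
    (Icc (0:ℝ) T ×ˢ (univ : Set (Ed d × Ed d)))
  diffX : ∀ t ∈ Icc (0:ℝ) T, ∀ x v, DifferentiableAt ℝ (fun x' => f t x' v) x
  diffY : ∀ t ∈ Icc (0:ℝ) T, ∀ x v, DifferentiableAt ℝ (fun v' => f t x v') v
  contX : ContinuousOn (fun p : ℝ × Ed d × Ed d => fderiv ℝ (fun x' => f p.1 x' p.2.2) p.2.1)
    (Icc (0:ℝ) T ×ˢ (univ : Set (Ed d × Ed d)))
  contY : ContinuousOn (fun p : ℝ × Ed d × Ed d => fderiv ℝ (fun v' => f p.1 p.2.1 v') p.2.2)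
    (Icc (0:ℝ) T ×ˢ (univ : Set (Ed d × Ed d)))


-- part 1
noncomputable section
set_option maxSynthPendingDepth 3
variable {E : Type*} [NormedAddCommGroup E] [InnerProductSpace ℝ E] [FiniteDimensional ℝ E]
  [MeasurableSpace E] [BorelSpace E]

def gz (E : Type*) [NormedAddCommGroup E] [InnerProductSpace ℝ E] [FiniteDimensional ℝ E]
    [MeasurableSpace E] [BorelSpace E] : ℝ := ∫ w : E, Real.exp (-(1/2) * ‖w‖^2)

def gs (z : E) : ℝ := (gz E)⁻¹ * Real.exp (-(1/2) * ‖z‖^2)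

lemma exp_int {b : ℝ} (hb : 0 < b) : Integrable (fun z : E => Real.exp (-b * ‖z‖^2)) := by
  have h := GaussianFourier.integrable_cexp_neg_mul_sq_norm_add (V := E) (b := (b:ℂ))
    (by simpa using hb) 0 0
  have h2 := h.re
  refine h2.congr (ae_of_all _ fun z => ?_)
  simp only [zero_mul, add_zero]
  have : (-(b:ℂ) * (‖z‖:ℂ)^2) = ((-b * ‖z‖^2 : ℝ) : ℂ) := by push_cast; ring
  rw [this, ← Complex.ofReal_exp]
  exact Complex.ofReal_re _

lemma gz_pos (E : Type*) [NormedAddCommGroup E] [InnerProductSpace ℝ E] [FiniteDimensional ℝ E]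
    [MeasurableSpace E] [BorelSpace E] : 0 < gz E := by
  unfold gz
  rw [GaussianFourier.integral_rexp_neg_mul_sq_norm (by norm_num)]
  positivity

lemma gs_nonneg (z : E) : 0 ≤ gs z := by
  have := gz_pos E
  unfold gs; positivity

lemma gs_cont : Continuous (gs (E := E)) := by
  unfold gs; fun_prop

lemma gs_integrable : Integrable (gs (E := E)) := (exp_int (by norm_num)).const_mul _

lemma gs_integral : ∫ z : E, gs z = 1 := by
  unfold gs
  rw [integral_const_mul]
  exact inv_mul_cancel₀ (gz_pos E).ne'

lemma gs_hasFDerivAt (z : E) : HasFDerivAt (gs (E := E)) (-(gs z) • innerSL ℝ z) z := by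
  have h1 : HasFDerivAt (fun z : E => ‖z‖^2) (2 • (innerSL ℝ z)) z := by
    simpa using (hasStrictFDerivAt_norm_sq z).hasFDerivAt
  have h2 := ((h1.const_mul (-(1/2):ℝ)).exp).const_mul (gz E)⁻¹
  refine h2.congr_fderiv ?_
  ext w
  simp [gs]
  ring

/-- Gaussian-bounded kernels. -/
structure GK {X : Type*} [NormedAddCommGroup X] (K : E → X) : Prop where
  cont : Continuous K
  bound : ∃ C, 0 ≤ C ∧ ∀ z, ‖K z‖ ≤ C * Real.exp (-(1/4) * ‖z‖^2)

lemma poly_exp (r : ℝ) : (1 + r)^2 * Real.exp (-(1/2) * r^2) ≤ 16 * Real.exp (-(1/4) * r^2) := by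
  have h1 : (1+r)^2 ≤ 16 * Real.exp (r^2/4) := by
    have := Real.add_one_le_exp (r^2/4)
    nlinarith [sq_nonneg (r-1)]
  have h2 : Real.exp (-(1/4) * r^2) = Real.exp (r^2/4) * Real.exp (-(1/2) * r^2) := by
    rw [← Real.exp_add]; ring_nf
  rw [h2]
  nlinarith [Real.exp_pos (-(1/2) * r^2)]

lemma GK.of_bound {X : Type*} [NormedAddCommGroup X] {K : E → X} (hc : Continuous K)
    (h : ∀ z, ‖K z‖ ≤ (1 + ‖z‖)^2 * gs z) : GK K := by
  have hz := gz_pos E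
  refine ⟨hc, (gz E)⁻¹ * 16, by positivity, fun z => (h z).trans ?_⟩
  have := poly_exp ‖z‖
  unfold gs
  calc _ = (gz E)⁻¹ * ((1 + ‖z‖)^2 * Real.exp (-(1/2) * ‖z‖^2)) := by ring
    _ ≤ (gz E)⁻¹ * (16 * Real.exp (-(1/4) * ‖z‖^2)) := by gcongr
    _ = _ := by ring

section
variable {X : Type*} [NormedAddCommGroup X]

lemma GK.integrable {K : E → X} (hK : GK K) : Integrable K := by
  obtain ⟨C, hC, h⟩ := hK.bound
  exact ((exp_int (by norm_num : (0:ℝ) < 1/4)).const_mul C).mono' hK.cont.aestronglyMeasurable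
    (ae_of_all _ h)

lemma GK.integrable_weight {K : E → X} (hK : GK K) : Integrable (fun z => ‖K z‖ * √‖z‖) := by
  obtain ⟨C, hC, h⟩ := hK.bound
  have hc := hK.cont
  refine ((exp_int (by norm_num : (0:ℝ) < 1/8)).const_mul (C * 8)).mono'
    (by fun_prop) (ae_of_all _ fun z => ?_)
  rw [Real.norm_of_nonneg (by positivity)]
  have h1 : √‖z‖ ≤ 8 * Real.exp (1/8 * ‖z‖^2) := by
    have := Real.add_one_le_exp (1/8 * ‖z‖^2)
    have h3 : √‖z‖ ≤ 1 + ‖z‖ := by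
      rw [Real.sqrt_le_left (by positivity)]
      nlinarith [norm_nonneg z]
    nlinarith [sq_nonneg (‖z‖ - 1)]
  have h2 : Real.exp (-(1/8) * ‖z‖^2) = Real.exp (1/8 * ‖z‖^2) * Real.exp (-(1/4) * ‖z‖^2) := by
    rw [← Real.exp_add]; ring_nf
  calc ‖K z‖ * √‖z‖ ≤ (C * Real.exp (-(1/4) * ‖z‖^2)) * (8 * Real.exp (1/8 * ‖z‖^2)) := by
        gcongr; exact h z
    _ = _ := by rw [h2]; ring

lemma GK.shift_bound {K : E → X} (hK : GK K) : ∃ b : E → ℝ, Integrable b ∧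
    ∀ a z, ‖a‖ ≤ 1 → ‖K (z - a)‖ ≤ b z := by
  obtain ⟨C, hC, h⟩ := hK.bound
  refine ⟨fun z => C * (Real.exp (1/4) * Real.exp (-(1/8) * ‖z‖^2)),
    ((exp_int (by norm_num : (0:ℝ) < 1/8)).const_mul _).const_mul C, fun a z ha => (h _).trans ?_⟩
  simp only []
  rw [← Real.exp_add]
  gcongr
  have h1 : ‖z‖ ≤ ‖z - a‖ + 1 := by
    calc ‖z‖ = ‖(z - a) + a‖ := by simp
      _ ≤ _ := (norm_add_le _ _).trans (by gcongr)
  nlinarith [norm_nonneg z, norm_nonneg (z-a), sq_nonneg (‖z-a‖ - 1)]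
end

section
variable {F W : Type*} [NormedAddCommGroup F] [NormedSpace ℝ F]
  [NormedAddCommGroup W] [NormedSpace ℝ W]

def cv (K : E → F →L[ℝ] W) (c : ℝ) (h : E → F) (x : E) : W := ∫ z, K z (h (x + c • z))

lemma cv_integrable {K : E → F →L[ℝ] W} (hK : GK K) {h : E → F} (hc : Continuous h) {M : ℝ}
    (hM : ∀ x, ‖h x‖ ≤ M) (c : ℝ) (x : E) : Integrable (fun z => K z (h (x + c • z))) := by
  have := hK.cont
  refine (hK.integrable.norm.mul_const M).mono' (Continuous.aestronglyMeasurable (by fun_prop))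
    (ae_of_all _ fun z => ?_)
  exact ((K z).le_opNorm _).trans (by gcongr; exact hM _)

lemma cv_norm_le {K : E → F →L[ℝ] W} (hK : GK K) {h : E → F} {M : ℝ}
    (hM : ∀ x, ‖h x‖ ≤ M) (c : ℝ) (x : E) : ‖cv K c h x‖ ≤ M * ∫ z, ‖K z‖ := by
  rw [← integral_const_mul]
  refine norm_integral_le_of_norm_le (hK.integrable.norm.const_mul M) (ae_of_all _ fun z => ?_)
  exact ((K z).le_opNorm _).trans (by rw [mul_comm]; gcongr; exact hM _)

lemma cv_hasFDerivAt [CompleteSpace W] {K : E → F →L[ℝ] W} {K' : E → E →L[ℝ] F →L[ℝ] W} (hK : GK K)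
    (hK' : GK K') (hd : ∀ z, HasFDerivAt K (K' z) z) {h : E → F} (hc : Continuous h) {M : ℝ}
    (hM : ∀ x, ‖h x‖ ≤ M) {c : ℝ} (hc0 : 0 < c) (x : E) :
    HasFDerivAt (cv K c h) (c⁻¹ • cv (fun z => -(K' z).flip) c h x) x := by
  obtain ⟨b, hb, hb'⟩ := hK'.shift_bound
  have hM0 : 0 ≤ M := (norm_nonneg _).trans (hM 0)
  have hKc := hK.cont
  have hKc' := hK'.cont
  have e1 : cv K c h = fun y => ∫ z, K (z - c⁻¹ • (y - x)) (h (x + c • z)) := by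
    ext1 y
    unfold cv
    rw [← integral_sub_right_eq_self _ (c⁻¹ • (y - x))]
    congr 1; ext1 z
    congr 2
    rw [smul_sub, smul_smul, mul_inv_cancel₀ hc0.ne', one_smul]
    abel
  rw [e1]
  have key := hasFDerivAt_integral_of_dominated_of_fderiv_le (𝕜 := ℝ) (μ := (volume : Measure (E)))
    (F := fun y z => K (z - c⁻¹ • (y - x)) (h (x + c • z)))
    (F' := fun y z => c⁻¹ • (-(K' (z - c⁻¹ • (y - x))).flip) (h (x + c • z)))
    (x₀ := x) (bound := fun z => c⁻¹ * (b z * M)) (Metric.ball_mem_nhds x hc0)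
    (Eventually.of_forall fun y => Continuous.aestronglyMeasurable (by fun_prop))
    (by simpa using cv_integrable hK hc hM c x)
    (Continuous.aestronglyMeasurable (by
      have : Continuous fun z => (K' z).flip :=
        (ContinuousLinearMap.flipₗᵢ ℝ (E) F W).continuous.comp hKc'
      have h3 : Continuous fun z => (-(K' (z - c⁻¹ • (x - x))).flip) := by
        simp only [sub_self, smul_zero, sub_zero]
        exact this.neg
      have h4 : Continuous fun z => h (x + c • z) := by fun_prop
      exact (h3.clm_apply h4).const_smul c⁻¹))
    (ae_of_all _ fun z y hy => by
      rw [norm_smul, Real.norm_of_nonneg (by positivity)]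
      gcongr
      refine (ContinuousLinearMap.le_opNorm _ _).trans ?_
      rw [norm_neg, ContinuousLinearMap.opNorm_flip]
      have : ‖K' (z - c⁻¹ • (y - x))‖ ≤ b z := by
        apply hb'
        rw [norm_smul, Real.norm_of_nonneg (by positivity)]
        rw [inv_mul_le_iff₀ hc0, mul_one]
        exact (mem_ball_iff_norm.1 hy).le
      exact mul_le_mul this (hM _) (norm_nonneg _) ((norm_nonneg (K' _)).trans this))
    ((hb.mul_const M).const_mul _)
    (ae_of_all _ fun z y hy => by
      have g1 : HasFDerivAt (fun y => z - c⁻¹ • (y - x)) (-(c⁻¹ • ContinuousLinearMap.id ℝ (E))) y :=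
        (((hasFDerivAt_id y).sub_const x).const_smul c⁻¹).const_sub z
      have g2 := (hd (z - c⁻¹ • (y - x))).comp y g1
      have g3 := g2.clm_apply (hasFDerivAt_const (h (x + c • z)) y)
      refine g3.congr_fderiv ?_
      ext w
      simp)
  refine key.congr_fderiv ?_
  unfold cv
  rw [← integral_smul]
  simp

lemma cv_const {K : E → F →L[ℝ] W} [CompleteSpace W] [CompleteSpace F] (hK : GK K) (c : ℝ) (f : F) (x : E) :
    cv K c (fun _ => f) x = (∫ z, K z) f := by
  unfold cv
  rw [ContinuousLinearMap.integral_apply hK.integrable]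

/-- derivative kernels have integral zero -/
lemma integral_deriv_kernel [CompleteSpace W] [CompleteSpace F] {K : E → F →L[ℝ] W} {K' : E → E →L[ℝ] F →L[ℝ] W} (hK : GK K)
    (hK' : GK K') (hd : ∀ z, HasFDerivAt K (K' z) z) (f : F) :
    ∫ z, (-(K' z).flip) f = 0 := by
  have h1 := cv_hasFDerivAt hK hK' hd (h := fun _ => f) continuous_const (M := ‖f‖) (fun _ => le_rfl)
    one_pos 0
  have h2 : cv K 1 (fun _ => f) = fun _ => (∫ z, K z) f := by
    ext1 x; exact cv_const hK _ _ _
  rw [h2] at h1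
  have h3 := h1.unique (hasFDerivAt_const _ _)
  simpa [cv] using h3
end
end

-- part 2
noncomputable section
set_option maxSynthPendingDepth 3
variable {E : Type*} [NormedAddCommGroup E] [InnerProductSpace ℝ E] [FiniteDimensional ℝ E]
  [MeasurableSpace E] [BorelSpace E]
section

def kL (E : Type*) [NormedAddCommGroup E] [InnerProductSpace ℝ E]  : E →L[ℝ] E →L[ℝ] E →L[ℝ] E :=
  (ContinuousLinearMap.smulRightL ℝ (E) (E)) ∘L (innerSL ℝ)

lemma kL_apply (z f v : E) : kL E z f v = (inner ℝ z v : ℝ) • f := by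
  rfl

lemma kL_norm (z : E) : ‖kL E z‖ ≤ ‖z‖ := by
  refine ContinuousLinearMap.opNorm_le_bound _ (norm_nonneg _) fun f => ?_
  refine ContinuousLinearMap.opNorm_le_bound _ (by positivity) fun v => ?_
  rw [kL_apply, norm_smul]
  have := abs_real_inner_le_norm z v
  rw [Real.norm_eq_abs]
  nlinarith [norm_nonneg f]

def k0 (F : Type*) [NormedAddCommGroup F] [NormedSpace ℝ F] (z : E) : F →L[ℝ] F :=
  gs z • ContinuousLinearMap.id ℝ F

def k1 (z : E) : E →L[ℝ] E →L[ℝ] E := gs z • kL E z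

def k0' (z : E) : E →L[ℝ] E →L[ℝ] E :=
  (-(gs z) • innerSL ℝ z).smulRight (ContinuousLinearMap.id ℝ (E))

def k1' (z : E) : E →L[ℝ] E →L[ℝ] E →L[ℝ] E :=
  gs z • kL E + (-(gs z) • innerSL ℝ z).smulRight (kL E z)

def k2 (z : E) : E →L[ℝ] E →L[ℝ] E →L[ℝ] E := -(k1' z).flip

lemma k0'_flip (z : E) : -(k0' z).flip = k1 z := by
  ext f v
  simp [k0', k1, kL_apply, smul_smul]

lemma k0_deriv (z : E) : HasFDerivAt (k0 (E := E) (E)) (k0' z) z :=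
  (gs_hasFDerivAt z).smul_const _

lemma k1_deriv (z : E) : HasFDerivAt (k1 (E := E)) (k1' z) z := by
  have := (gs_hasFDerivAt z).smul (kL E).hasFDerivAt
  exact this

lemma gk0 (F : Type*) [NormedAddCommGroup F] [NormedSpace ℝ F] : GK (k0 (E := E) F) := by
  refine GK.of_bound (by have := gs_cont (E := E); unfold k0; fun_prop) fun z => ?_
  have h1 := gs_nonneg z
  unfold k0
  rw [norm_smul, Real.norm_of_nonneg h1, mul_comm]
  gcongr
  refine (ContinuousLinearMap.norm_id_le).trans ?_
  nlinarith [norm_nonneg z]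

lemma gk1 : GK (k1 (E := E)) := by
  refine GK.of_bound (by have := gs_cont (E := E); unfold k1; fun_prop) fun z => ?_
  have h1 := gs_nonneg z
  unfold k1
  rw [norm_smul, Real.norm_of_nonneg h1, mul_comm]
  gcongr
  refine (kL_norm z).trans ?_
  nlinarith [norm_nonneg z]

lemma gk0' : GK (k0' (E := E)) := by
  refine GK.of_bound ?_ fun z => ?_
  · have h := gs_cont (E := E)
    have h2 : Continuous fun z : E => (-(gs z) • innerSL ℝ z) := by fun_prop
    exact ((ContinuousLinearMap.smulRightL ℝ (E) (E →L[ℝ] E)).continuous.comp h2).clm_apply continuous_const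
  have h1 := gs_nonneg z
  unfold k0'
  rw [ContinuousLinearMap.norm_smulRight_apply, norm_smul, norm_neg, Real.norm_of_nonneg h1,
    innerSL_apply_norm]
  have h3 : ‖ContinuousLinearMap.id ℝ (E)‖ ≤ 1 := ContinuousLinearMap.norm_id_le
  calc gs z * ‖z‖ * ‖ContinuousLinearMap.id ℝ (E)‖ ≤ gs z * ‖z‖ * 1 := by gcongr
    _ ≤ _ := by nlinarith [norm_nonneg z, mul_nonneg h1 (norm_nonneg z), mul_nonneg h1 (sq_nonneg ‖z‖)]

lemma gk1' : GK (k1' (E := E)) := by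
  refine GK.of_bound ?_ fun z => ?_
  · have h := gs_cont (E := E)
    have h2 : Continuous fun z : E => (-(gs z) • innerSL ℝ z) := by fun_prop
    have h3 := ((ContinuousLinearMap.smulRightL ℝ (E) (E →L[ℝ] E →L[ℝ] E)).continuous.comp h2).clm_apply (kL E).continuous
    exact (h.smul continuous_const).add h3
  have h1 := gs_nonneg z
  have h4 : ‖kL E‖ ≤ 1 := ContinuousLinearMap.opNorm_le_bound _ zero_le_one fun z => by
    rw [one_mul]; exact kL_norm z
  unfold k1'
  refine (norm_add_le _ _).trans ?_
  rw [ContinuousLinearMap.norm_smulRight_apply, norm_smul, norm_smul, norm_neg, Real.norm_of_nonneg h1,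
    innerSL_apply_norm]
  have := kL_norm z
  calc gs z * ‖kL E‖ + gs z * ‖z‖ * ‖kL E z‖ ≤ gs z * 1 + gs z * ‖z‖ * ‖z‖ := by gcongr
    _ ≤ _ := by nlinarith [norm_nonneg z, mul_nonneg h1 (norm_nonneg z), mul_nonneg h1 (sq_nonneg ‖z‖)]

lemma gk2 : GK (k2 (E := E)) := by
  obtain ⟨hc, C, hC, hb⟩ := gk1' (E := E)
  refine ⟨?_, C, hC, fun z => ?_⟩
  · exact ((ContinuousLinearMap.flipₗᵢ ℝ (E) (E) (E →L[ℝ] E)).continuous.comp hc).neg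
  · unfold k2
    rw [norm_neg, ContinuousLinearMap.opNorm_flip]
    exact hb z

lemma k2_apply (z f w v : E) : k2 z f w v = (gs z * (inner ℝ z w * inner ℝ z v - inner ℝ w v)) • f := by
  simp only [k2, k1', _root_.neg_apply, ContinuousLinearMap.flip_apply,
    _root_.add_apply, _root_.smul_apply, kL_apply,
    ContinuousLinearMap.smulRight_apply, innerSL_apply_apply, smul_smul, smul_eq_mul]
  module

lemma k1_integral (f : E) : ∫ z : E, k1 z f = 0 := by
  have := integral_deriv_kernel (gk0 (E := E) (E)) gk0' k0_deriv f
  simpa only [k0'_flip] using this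

lemma k2_integral (f : E) : ∫ z : E, k2 z f = 0 :=
  integral_deriv_kernel (gk1 (E := E)) gk1' k1_deriv f

lemma cv_k0_deriv {h : E → E} (hc : Continuous h) {M : ℝ}
    (hM : ∀ x, ‖h x‖ ≤ M) {c : ℝ} (hc0 : 0 < c) (x : E) :
    HasFDerivAt (cv (k0 (E)) c h) (c⁻¹ • cv k1 c h x) x := by
  have := cv_hasFDerivAt (gk0 (E := E) (E)) gk0' k0_deriv hc hM hc0 x
  simpa only [k0'_flip] using this

lemma cv_k1_deriv {h : E → E} (hc : Continuous h) {M : ℝ}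
    (hM : ∀ x, ‖h x‖ ≤ M) {c : ℝ} (hc0 : 0 < c) (x : E) :
    HasFDerivAt (cv k1 c h) (c⁻¹ • cv k2 c h x) x :=
  cv_hasFDerivAt (gk1 (E := E)) gk1' k1_deriv hc hM hc0 x

lemma gs_pow_integrable : Integrable (fun z : E => gs z * (1 + ‖z‖)^2) := by
  refine (GK.of_bound (K := fun z : E => gs z * (1 + ‖z‖)^2)
    (by have := gs_cont (E := E); fun_prop) fun z => ?_).integrable
  rw [Real.norm_of_nonneg (by have := gs_nonneg z; positivity), mul_comm]

lemma moment_two (v w : E) : ∫ z : E, gs z * (inner ℝ z v * inner ℝ z w) = (inner ℝ v w : ℝ) := by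
  have hint : Integrable (fun z : E => gs z * (inner ℝ z v * inner ℝ z w)) := by
    have := gs_cont (E := E)
    refine (gs_pow_integrable.mul_const (‖v‖ * ‖w‖)).mono' (Continuous.aestronglyMeasurable (by fun_prop))
      (ae_of_all _ fun z => ?_)
    have h1 := gs_nonneg z
    have h2 := norm_inner_le_norm (𝕜 := ℝ) z v
    have h3 := norm_inner_le_norm (𝕜 := ℝ) z w
    rw [norm_mul, norm_mul, Real.norm_of_nonneg h1]
    calc _ ≤ gs z * ((‖z‖ * ‖v‖) * (‖z‖ * ‖w‖)) := by gcongr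
      _ = gs z * ‖z‖^2 * (‖v‖ * ‖w‖) := by ring
      _ ≤ _ := by gcongr; linarith
  rcases subsingleton_or_nontrivial (E) with hs | hn
  · simp [Subsingleton.elim v 0]
  obtain ⟨f, hf⟩ := exists_ne (0 : E)
  have h := k2_integral f
  have h2 : (∫ z : E, k2 z f) v w = ∫ z : E, k2 z f v w := by
    have i1 : Integrable (fun z : E => k2 z f) := by
      simpa using cv_integrable gk2 (continuous_const (y := f)) (M := ‖f‖) (fun _ => le_rfl) 0 0
    rw [ContinuousLinearMap.integral_apply i1, ContinuousLinearMap.integral_apply]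
    exact i1.apply_continuousLinearMap v
  rw [h] at h2
  simp only [k2_apply, integral_smul_const] at h2
  have h3 : ∫ z : E, gs z * (inner ℝ z v * inner ℝ z w - inner ℝ v w) = (0:ℝ) := by
    by_contra hne
    exact (smul_ne_zero hne hf) (by simpa using h2.symm)
  simp only [mul_sub] at h3
  rw [integral_sub hint (gs_integrable.mul_const _), integral_mul_const, gs_integral] at h3
  linarith

lemma moment_one : ∫ z : E, gs z • z = 0 := by
  have h := integral_neg_eq_self (fun z : E => gs z • z) volume
  have h2 : ∀ z : E, gs (-z) • (-z) = - (gs z • z) := fun z => by simp [gs]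
  simp only [h2, integral_neg] at h
  have h5 : (2:ℝ) • (∫ z : E, gs z • z) = 0 := by
    rw [two_smul]; nth_rewrite 1 [← h]; simp
  simpa using h5
end

section
variable {F W : Type*} [NormedAddCommGroup F] [NormedSpace ℝ F]
  [NormedAddCommGroup W] [NormedSpace ℝ W]

lemma cv_continuous {Y : Type*} [TopologicalSpace Y] [FirstCountableTopology Y]
    {K : E → F →L[ℝ] W} (hK : GK K) {h : Y → E → F}
    (hc : Continuous fun p : Y × E => h p.1 p.2) {M : ℝ} (hM : ∀ y x, ‖h y x‖ ≤ M) {c : Y → ℝ}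
    (hcc : Continuous c) {x : Y → E} (hx : Continuous x) :
    Continuous fun y => cv K (c y) (h y) (x y) := by
  have hKc := hK.cont
  refine continuous_of_dominated (bound := fun z => ‖K z‖ * M) (fun y => ?_) (fun y => ?_)
    (hK.integrable.norm.mul_const M) (ae_of_all _ fun z => ?_)
  · have : Continuous fun z => h y (x y + c y • z) :=
      hc.comp (f := fun z => (y, x y + c y • z)) (by fun_prop)
    exact (hKc.clm_apply this).aestronglyMeasurable
  · exact ae_of_all _ fun z => ((K z).le_opNorm _).trans (by gcongr; exact hM _ _)
  · have : Continuous fun y => h y (x y + c y • z) :=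
      hc.comp (f := fun y => (y, x y + c y • z)) (by fun_prop)
    exact (K z).continuous.comp this

lemma cv_k0_eq (c : ℝ) (h : E → F) (x : E) : cv (k0 F) c h x = ∫ z, gs z • h (x + c • z) := by
  simp [cv, k0]

lemma cv_k0_zero [CompleteSpace F] (h : E → F) (x : E) : cv (k0 F) 0 h x = h x := by
  rw [cv_k0_eq]; simp [integral_smul_const, gs_integral]

lemma cv_k0_norm_le {h : E → F} {M : ℝ} (hM : ∀ x, ‖h x‖ ≤ M) (c : ℝ) (x : E) :
    ‖cv (k0 F) c h x‖ ≤ M := by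
  rw [cv_k0_eq]
  have := norm_integral_le_of_norm_le (f := fun z => gs z • h (x + c • z)) (gs_integrable.mul_const M) (ae_of_all _ fun z => by
    rw [norm_smul, Real.norm_of_nonneg (gs_nonneg z)]
    have := gs_nonneg z
    gcongr; exact hM _)
  rwa [integral_mul_const, gs_integral, one_mul] at this

lemma av_hasFDerivAt [CompleteSpace F] {ψ : E → F} {ψ' : E → E →L[ℝ] F} (hψ : ∀ x, HasFDerivAt ψ (ψ' x) x)
    (hc : Continuous ψ') {M : ℝ} (hM : ∀ x, ‖ψ x‖ ≤ M) (hM' : ∀ x, ‖ψ' x‖ ≤ M) (c : ℝ) (x : E) :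
    HasFDerivAt (cv (k0 F) c ψ) (cv (k0 (E →L[ℝ] F)) c ψ' x) x := by
  have hψc : Continuous ψ := continuous_iff_continuousAt.2 fun x => (hψ x).continuousAt
  have e : cv (k0 F) c ψ = fun x => ∫ z, gs z • ψ (x + c • z) := funext fun x => cv_k0_eq _ _ _
  rw [e, cv_k0_eq]
  have hg := gs_cont (E := E)
  refine hasFDerivAt_integral_of_dominated_of_fderiv_le (𝕜 := ℝ) (bound := fun z => gs z * M)
    (F' := fun x z => gs z • ψ' (x + c • z)) univ_mem
    (Eventually.of_forall fun y => Continuous.aestronglyMeasurable (by fun_prop)) ?_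
    (Continuous.aestronglyMeasurable (by fun_prop)) (ae_of_all _ fun z y _ => ?_)
    (gs_integrable.mul_const M) (ae_of_all _ fun z y _ => ?_)
  · simpa [k0] using cv_integrable (gk0 F) hψc hM c x
  · rw [norm_smul, Real.norm_of_nonneg (gs_nonneg z)]
    have := gs_nonneg z
    gcongr; exact hM' _
  · have := (hψ (y + c • z)).comp y ((hasFDerivAt_id y).add_const (c • z))
    exact this.const_smul (gs z)
end
end

-- part 3
noncomputable section
set_option maxSynthPendingDepth 3
variable {E : Type*} [NormedAddCommGroup E] [InnerProductSpace ℝ E] [FiniteDimensional ℝ E]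
  [MeasurableSpace E] [BorelSpace E]

def gam (E : Type*) [NormedAddCommGroup E] [InnerProductSpace ℝ E] [FiniteDimensional ℝ E]
  [MeasurableSpace E] [BorelSpace E] : Measure E := volume.withDensity (fun z => ENNReal.ofReal (gs z))

instance : IsProbabilityMeasure (gam E) := by
  constructor
  unfold gam
  rw [withDensity_apply _ MeasurableSet.univ, Measure.restrict_univ,
    ← ofReal_integral_eq_lintegral_ofReal gs_integrable (ae_of_all _ gs_nonneg), gs_integral]
  simp

lemma gam_integral {F : Type*} [NormedAddCommGroup F] [NormedSpace ℝ F] (ψ : E → F) :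
    ∫ z, ψ z ∂(gam E) = ∫ z, gs z • ψ z := by
  unfold gam
  rw [integral_withDensity_eq_integral_toReal_smul (gs_cont.measurable.ennreal_ofReal)
    (ae_of_all _ fun z => ENNReal.ofReal_lt_top)]
  congr 1; ext1 z
  rw [ENNReal.toReal_ofReal (gs_nonneg z)]

lemma gam_charFun (t : E) : charFun (gam E) t = Complex.exp (-(‖t‖^2 / 2 : ℝ)) := by
  have key : ∀ t : E, charFun (gam E) t = ((gz E)⁻¹ : ℝ) * ((Real.pi / (1/2 : ℂ)) ^ (Module.finrank ℝ E / 2 : ℂ)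
      * Complex.exp (-(‖t‖^2 / 2 : ℝ))) := by
    intro t
    rw [charFun_apply, gam_integral]
    have := GaussianFourier.integral_cexp_neg_mul_sq_norm_add (V := E) (b := (1/2 : ℂ)) (by norm_num) Complex.I t
    have e : ∀ z : E, gs z • Complex.exp ((inner ℝ z t : ℝ) * Complex.I) =
        ((gz E)⁻¹ : ℝ) * Complex.exp (-(1/2 : ℂ) * ‖z‖^2 + Complex.I * (inner ℝ t z : ℝ)) := by
      intro z
      rw [Complex.exp_add, gs, Complex.real_smul, real_inner_comm, mul_comm Complex.I]
      push_cast
      ring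
    simp only [e]
    rw [integral_const_mul, this]
    congr 3
    rw [Complex.I_sq]; push_cast; ring
  have h0 := key 0
  rw [charFun_zero] at h0
  simp only [Measure.real, measure_univ] at h0
  rw [key t, ← mul_assoc]
  have : ((gz E)⁻¹ : ℝ) * (Real.pi / (1/2 : ℂ)) ^ (Module.finrank ℝ E / 2 : ℂ) = 1 := by
    simpa using h0.symm
  rw [this, one_mul]

lemma gam_conv (a b : ℝ) : (gam E).map (fun z => a • z) ∗ (gam E).map (fun z => b • z) =
    (gam E).map (fun z => √(a^2+b^2) • z) := by
  have : IsProbabilityMeasure ((gam E).map (fun z => a • z)) :=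
    Measure.isProbabilityMeasure_map (by fun_prop)
  have : IsProbabilityMeasure ((gam E).map (fun z => b • z)) :=
    Measure.isProbabilityMeasure_map (by fun_prop)
  have : IsProbabilityMeasure ((gam E).map (fun z => √(a^2+b^2) • z)) :=
    Measure.isProbabilityMeasure_map (by fun_prop)
  refine Measure.ext_of_charFun ?_
  ext1 t
  rw [charFun_conv, charFun_map_smul, charFun_map_smul, charFun_map_smul]
  simp only [gam_charFun, ← Complex.exp_add, norm_smul, Real.norm_eq_abs, mul_pow, sq_abs]
  rw [Real.sq_sqrt (by positivity)]
  congr 1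
  push_cast; ring

lemma semigroup {F : Type*} [NormedAddCommGroup F] [NormedSpace ℝ F] [CompleteSpace F] {ψ : E → F}
    (hc : Continuous ψ) {M : ℝ} (hM : ∀ x, ‖ψ x‖ ≤ M) (a b : ℝ) (x : E) :
    cv (k0 F) a (cv (k0 F) b ψ) x = cv (k0 F) (√(a^2+b^2)) ψ x := by
  simp only [cv_k0_eq, ← gam_integral]
  have h1 : ∫ z, ψ (x + √(a^2+b^2) • z) ∂(gam E) = ∫ z, ψ (x + z) ∂((gam E).map (fun z => √(a^2+b^2) • z)) := by
    rw [integral_map (by fun_prop) (Continuous.aestronglyMeasurable (by fun_prop))]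
  rw [h1, ← gam_conv, Measure.conv, integral_map (by fun_prop) (Continuous.aestronglyMeasurable (by fun_prop)),
    Measure.map_prod_map _ _ (by fun_prop) (by fun_prop), integral_map (by fun_prop) (Continuous.aestronglyMeasurable (by fun_prop)),
    integral_prod]
  · simp [add_assoc]
  · refine Integrable.mono' (integrable_const M) (Continuous.aestronglyMeasurable ?_) (ae_of_all _ fun z => hM _)
    simp only [Prod.map]
    fun_prop

section
variable {F : Type*} [NormedAddCommGroup F] [NormedSpace ℝ F] [CompleteSpace F]

lemma quad_integral {ι : Type*} [Fintype ι] (b : OrthonormalBasis ι ℝ E) (Q : E →L[ℝ] E →L[ℝ] F) :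
    ∫ z : E, gs z • Q z z = ∑ j, Q (b j) (b j) := by
  classical
  have e : ∀ z : E, gs z • Q z z = ∑ i, ∑ j, (gs z * (inner ℝ z (b i) * inner ℝ z (b j))) • Q (b i) (b j) := by
    intro z
    conv_lhs => rw [← b.sum_repr' z]
    simp only [map_sum, map_smul, _root_.sum_apply, _root_.smul_apply, Finset.smul_sum, smul_smul]
    rw [Finset.sum_comm]
    refine Finset.sum_congr rfl fun i _ => Finset.sum_congr rfl fun j _ => ?_
    rw [b.sum_repr' z]
    congr 1
    rw [real_inner_comm z, real_inner_comm z]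
    ring
  have hint : ∀ v w : E, Integrable (fun z : E => gs z * (inner ℝ z v * inner ℝ z w)) := fun v w => by
    have := gs_cont (E := E)
    refine (gs_pow_integrable.mul_const (‖v‖ * ‖w‖)).mono' (Continuous.aestronglyMeasurable (by fun_prop))
      (ae_of_all _ fun z => ?_)
    have h1 := gs_nonneg z
    have h2 := norm_inner_le_norm (𝕜 := ℝ) z v
    have h3 := norm_inner_le_norm (𝕜 := ℝ) z w
    rw [norm_mul, norm_mul, Real.norm_of_nonneg h1]
    calc _ ≤ gs z * ((‖z‖ * ‖v‖) * (‖z‖ * ‖w‖)) := by gcongr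
      _ = gs z * ‖z‖^2 * (‖v‖ * ‖w‖) := by ring
      _ ≤ _ := by gcongr; linarith
  simp only [e]
  rw [integral_finsetSum _ (fun i _ => integrable_finsetSum _ fun j _ => (hint _ _).smul_const _)]
  refine Finset.sum_congr rfl fun i _ => ?_
  rw [integral_finsetSum _ (fun j _ => (hint _ _).smul_const _)]
  simp only [integral_smul_const, moment_two, b.inner_eq_ite]
  simp

/-- right derivative of the heat semigroup at time zero -/
lemma heat_right_deriv {ι : Type*} [Fintype ι] (b : OrthonormalBasis ι ℝ E) {ν : ℝ} (hν : 0 < ν)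
    {ψ : E → F} {ψ1 : E → E →L[ℝ] F} {ψ2 : E → E →L[ℝ] E →L[ℝ] F}
    (h1 : ∀ x, HasFDerivAt ψ (ψ1 x) x) (h2 : ∀ x, HasFDerivAt ψ1 (ψ2 x) x)
    {M : ℝ} (hM : ∀ x, ‖ψ x‖ ≤ M) (hM1 : ∀ x, ‖ψ1 x‖ ≤ M) (hM2 : ∀ x, ‖ψ2 x‖ ≤ M) (x : E) :
    HasDerivWithinAt (fun δ => cv (k0 F) √(2*ν*δ) ψ x) (ν • ∑ j, ψ2 x (b j) (b j)) (Ici 0) 0 := by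
  have hψc : Continuous ψ := continuous_iff_continuousAt.2 fun x => (h1 x).continuousAt
  have hψ1c : Continuous ψ1 := continuous_iff_continuousAt.2 fun x => (h2 x).continuousAt
  have hg := gs_cont (E := E)
  have hM0 : 0 ≤ M := (norm_nonneg _).trans (hM 0)
  have hlin : Integrable (fun z : E => gs z • ψ1 x z) := by
    refine (gs_pow_integrable.mul_const M).mono' (Continuous.aestronglyMeasurable (by fun_prop))
      (ae_of_all _ fun z => ?_)
    have h1 := gs_nonneg z
    rw [norm_smul, Real.norm_of_nonneg h1]
    calc _ ≤ gs z * (M * ‖z‖) := by gcongr; exact (ContinuousLinearMap.le_opNorm _ _).trans (by gcongr; exact hM1 _)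
      _ = gs z * ‖z‖ * M := by ring
      _ ≤ _ := by gcongr; nlinarith [norm_nonneg z]
  have hlin0 : ∫ z : E, gs z • ψ1 x z = 0 := by
    have : ∫ z : E, ψ1 x (gs z • z) = ψ1 x (∫ z : E, gs z • z) := by
      refine ContinuousLinearMap.integral_comp_comm _ ?_
      refine gs_pow_integrable.mono' (Continuous.aestronglyMeasurable (by fun_prop)) (ae_of_all _ fun z => ?_)
      have h1 := gs_nonneg z
      rw [norm_smul, Real.norm_of_nonneg h1]
      gcongr; nlinarith [norm_nonneg z]
    simpa [moment_one] using this
  -- derivative in c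
  have hD : ∀ c : ℝ, HasDerivAt (fun c => cv (k0 F) c ψ x) (∫ z, gs z • (ψ1 (x + c • z) - ψ1 x) z) c := by
    intro c
    have key := hasDerivAt_integral_of_dominated_loc_of_deriv_le (𝕜 := ℝ) (μ := (volume : Measure E))
      (F := fun c z => gs z • ψ (x + c • z)) (F' := fun c z => gs z • (ψ1 (x + c • z)) z)
      (x₀ := c) (s := univ) (bound := fun z => gs z * (1 + ‖z‖)^2 * M) univ_mem
      (Eventually.of_forall fun y => Continuous.aestronglyMeasurable (by fun_prop))
      (by simpa [k0] using cv_integrable (gk0 F) hψc hM c x)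
      (Continuous.aestronglyMeasurable (by fun_prop))
      (ae_of_all _ fun z c _ => by
        have h1 := gs_nonneg z
        rw [norm_smul, Real.norm_of_nonneg h1]
        calc _ ≤ gs z * (M * ‖z‖) := by gcongr; exact (ContinuousLinearMap.le_opNorm _ _).trans (by gcongr; exact hM1 _)
          _ = gs z * ‖z‖ * M := by ring
          _ ≤ _ := by gcongr; nlinarith [norm_nonneg z])
      (gs_pow_integrable.mul_const M)
      (ae_of_all _ fun z c _ => by
        have g1 : HasDerivAt (fun c : ℝ => x + c • z) z c := by
          simpa using ((hasDerivAt_id c).smul_const z).const_add x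
        exact ((h1 _).comp_hasDerivAt c g1).const_smul (gs z))
    have k2 := key.2
    simp only [← cv_k0_eq] at k2
    convert k2 using 1
    simp only [_root_.sub_apply, smul_sub]
    rw [integral_sub key.1 hlin, hlin0, sub_zero]
  have hcpos : ∀ δ : ℝ, 0 < δ → 0 < √(2*ν*δ) := fun δ hδ => Real.sqrt_pos.2 (by positivity)
  have hN : ∀ δ : ℝ, 0 < δ → HasDerivAt (fun δ => cv (k0 F) √(2*ν*δ) ψ x)
      (ν • ∫ z, gs z • ((√(2*ν*δ))⁻¹ • (ψ1 (x + √(2*ν*δ) • z) - ψ1 x)) z) δ := by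
    intro δ hδ
    have hc := hcpos δ hδ
    have g1 : HasDerivAt (fun δ => √(2*ν*δ)) (ν * (√(2*ν*δ))⁻¹) δ := by
      have := ((hasDerivAt_id' δ).const_mul (2*ν)).sqrt (by positivity)
      refine this.congr_deriv ?_
      field_simp
    have g2 := (hD √(2*ν*δ)).scomp δ g1
    refine HasDerivAt.congr_deriv g2 ?_
    rw [mul_smul, ← integral_smul]
    congr 2
    ext1 z
    rw [_root_.smul_apply, smul_comm]
  have hcont0 : Continuous fun c : ℝ => cv (k0 F) c ψ x :=
    cv_continuous (gk0 F) (h := fun (_:ℝ) => ψ) (by fun_prop) (fun _ => hM) continuous_id continuous_const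
  refine hasDerivWithinAt_Ici_of_tendsto_deriv (s := Ioi 0)
    (fun δ hδ => (hN δ hδ).differentiableAt.differentiableWithinAt) ?_ self_mem_nhdsWithin ?_
  · exact (hcont0.comp (by fun_prop : Continuous fun δ : ℝ => √(2*ν*δ))).continuousWithinAt
  · have hlim : Tendsto (fun δ : ℝ => ν • ∫ z, gs z • ((√(2*ν*δ))⁻¹ • (ψ1 (x + √(2*ν*δ) • z) - ψ1 x)) z)
        (𝓝[>] 0) (𝓝 (ν • ∫ z, gs z • ψ2 x z z)) := by
      refine Tendsto.const_smul ?_ ν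
      refine tendsto_integral_filter_of_dominated_convergence (fun z => gs z * (1+‖z‖)^2 * M)
        (Eventually.of_forall fun y => Continuous.aestronglyMeasurable (by fun_prop)) ?_
        (gs_pow_integrable.mul_const M) (ae_of_all _ fun z => ?_)
      · filter_upwards [self_mem_nhdsWithin] with δ hδ
        refine ae_of_all _ fun z => ?_
        have h1 := gs_nonneg z
        have hc := hcpos δ hδ
        have hL : ‖ψ1 (x + √(2*ν*δ) • z) - ψ1 x‖ ≤ M * (√(2*ν*δ) * ‖z‖) := by
          have := Convex.norm_image_sub_le_of_norm_hasFDerivWithin_le (𝕜 := ℝ) (s := univ) (C := M)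
            (fun x _ => (h2 x).hasFDerivWithinAt) (fun x _ => hM2 x) convex_univ (mem_univ x)
            (mem_univ (x + √(2*ν*δ) • z))
          simpa [norm_smul, abs_of_pos hc] using this
        rw [norm_smul, Real.norm_of_nonneg h1]
        calc _ ≤ gs z * (((√(2*ν*δ))⁻¹ * (M * (√(2*ν*δ) * ‖z‖))) * ‖z‖) := by
              gcongr
              refine (ContinuousLinearMap.le_opNorm _ _).trans ?_
              gcongr
              rw [norm_smul, Real.norm_of_nonneg (by positivity)]
              gcongr
          _ = gs z * ‖z‖^2 * M := by field_simp
          _ ≤ _ := by gcongr; linarith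
      · have hinv : Tendsto (fun δ : ℝ => ‖(√(2*ν*δ))⁻¹‖) (𝓝[>] 0) atTop := by
          have t1 : Tendsto (fun δ : ℝ => √(2*ν*δ)) (𝓝[>] 0) (𝓝[>] 0) := by
            refine tendsto_nhdsWithin_iff.2 ⟨?_, ?_⟩
            · have : Continuous fun δ : ℝ => √(2*ν*δ) := by fun_prop
              simpa using (this.tendsto 0).mono_left nhdsWithin_le_nhds
            · filter_upwards [self_mem_nhdsWithin] with δ hδ using hcpos δ hδ
          exact tendsto_norm_atTop_atTop.comp (tendsto_inv_nhdsGT_zero.comp t1)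
        have := (h2 x).lim z hinv
        simp only [inv_inv] at this
        have ev := (ContinuousLinearMap.apply ℝ F z).continuous.tendsto (ψ2 x z)
        exact (ev.comp this).const_smul (gs z)
    rw [quad_integral b] at hlim
    refine hlim.congr' ?_
    filter_upwards [self_mem_nhdsWithin] with δ hδ using (hN δ hδ).deriv.symm
end
end

-- part 4
noncomputable section
set_option maxSynthPendingDepth 3
variable {E : Type*} [NormedAddCommGroup E] [InnerProductSpace ℝ E] [FiniteDimensional ℝ E]
  [MeasurableSpace E] [BorelSpace E]

def cc (ν t : ℝ) : ℝ := √(2*ν*t)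

lemma cc_cont (ν : ℝ) : Continuous (cc ν) := by unfold cc; fun_prop

lemma int_inv_sqrt : IntegrableOn (fun θ : ℝ => (√θ)⁻¹) (Ioc 0 1) := by
  have := intervalIntegral.intervalIntegrable_rpow' (a := 0) (b := 1) (r := -(1/2)) (by norm_num)
  rw [intervalIntegrable_iff_integrableOn_Ioc_of_le (by norm_num)] at this
  refine this.congr_fun (fun θ hθ => ?_) measurableSet_Ioc
  simp only
  rw [Real.rpow_neg hθ.1.le, Real.sqrt_eq_rpow]

lemma cv_k2_holder {h : E → E} (hc : Continuous h) {M : ℝ} (hM : ∀ x, ‖h x‖ ≤ M) {L : ℝ}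
    (hL : ∀ x x', ‖h x - h x'‖ ≤ L * √‖x - x'‖) {c : ℝ} (hc0 : 0 ≤ c) (x : E) :
    ‖cv k2 c h x‖ ≤ L * √c * ∫ z : E, ‖k2 z‖ * √‖z‖ := by
  have e : cv k2 c h x = ∫ z, k2 z (h (x + c • z) - h x) := by
    simp only [map_sub]
    rw [integral_sub (cv_integrable gk2 hc hM c x)
      (by simpa using cv_integrable gk2 hc hM 0 x), k2_integral, sub_zero]
    rfl
  rw [e, ← integral_const_mul]
  refine norm_integral_le_of_norm_le (gk2.integrable_weight.const_mul _) (ae_of_all _ fun z => ?_)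
  refine ((k2 z).le_opNorm _).trans ?_
  have := hL (x + c • z) x
  rw [add_sub_cancel_left, norm_smul, Real.norm_of_nonneg hc0, Real.sqrt_mul hc0] at this
  calc _ ≤ ‖k2 z‖ * (L * (√c * √‖z‖)) := by gcongr
    _ = _ := by ring

section
variable {F W : Type*} [NormedAddCommGroup F] [NormedSpace ℝ F] [NormedAddCommGroup W] [NormedSpace ℝ W]

def DI (K : E → F →L[ℝ] W) (w : ℝ → ℝ) (ν : ℝ) (h : ℝ → E → F) (t : ℝ) (x : E) : W :=
  ∫ θ in Ioc (0:ℝ) 1, w θ • cv K (cc ν t * θ) (h (t*(1-θ^2))) x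

variable {K : E → F →L[ℝ] W} (hK : GK K) {w : ℝ → ℝ} (hw : Measurable w) {ν : ℝ}
  {h : ℝ → E → F} (hc : Continuous fun p : ℝ × E => h p.1 p.2) {B : ℝ} (hB : ∀ s x, ‖h s x‖ ≤ B)

include hK hc hB in
lemma cv_cont3 : Continuous fun q : (ℝ × E) × ℝ => cv K (cc ν q.1.1 * q.2) (h (q.1.1*(1-q.2^2))) q.1.2 := by
  have := cc_cont ν
  refine cv_continuous hK (h := fun q : (ℝ × E) × ℝ => h (q.1.1*(1-q.2^2))) ?_ (fun q x => hB _ _) (by fun_prop) (by fun_prop)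
  exact hc.comp (f := fun p : ((ℝ × E) × ℝ) × E => (p.1.1.1*(1-p.1.2^2), p.2)) (by fun_prop)

include hK hc hB hw in
lemma DI_meas (t : ℝ) (x : E) : AEStronglyMeasurable (fun θ => w θ • cv K (cc ν t * θ) (h (t*(1-θ^2))) x)
    (volume.restrict (Ioc (0:ℝ) 1)) := by
  have := (cv_cont3 (ν := ν) hK hc hB).comp (f := fun θ : ℝ => ((t,x),θ)) (by fun_prop)
  exact hw.aestronglyMeasurable.smul this.aestronglyMeasurable

include hK hc hB hw in
lemma DI_cont (hb : ∀ R : ℝ, ∃ b : ℝ → ℝ, IntegrableOn b (Ioc 0 1) ∧ ∀ t < R, ∀ x, ∀ θ ∈ Ioc (0:ℝ) 1,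
      ‖w θ • cv K (cc ν t * θ) (h (t*(1-θ^2))) x‖ ≤ b θ) :
    Continuous fun p : ℝ × E => DI K w ν h p.1 p.2 := by
  rw [continuous_iff_continuousAt]
  intro p
  obtain ⟨b, hb, hb'⟩ := hb (p.1+1)
  have ev : ∀ᶠ q : ℝ × E in 𝓝 p, q.1 < p.1 + 1 :=
    (continuous_fst.tendsto p).eventually (gt_mem_nhds (by linarith))
  refine continuousAt_of_dominated (bound := b) (Eventually.of_forall fun q => DI_meas hK hw hc hB q.1 q.2) ?_ hb ?_
  · filter_upwards [ev] with q hq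
    filter_upwards [ae_restrict_mem measurableSet_Ioc] with θ hθ using hb' _ hq _ _ hθ
  · refine ae_of_all _ fun θ => Continuous.continuousAt ?_
    have := (cv_cont3 (ν := ν) hK hc hB).comp (f := fun p : ℝ × E => (p,θ)) (by fun_prop)
    exact continuous_const.smul this

include hK hc hB hw in
lemma DI_int (hw1 : ∀ θ ∈ Ioc (0:ℝ) 1, |w θ| ≤ 1) (t : ℝ) (x : E) :
    IntegrableOn (fun θ => w θ • cv K (cc ν t * θ) (h (t*(1-θ^2))) x) (Ioc (0:ℝ) 1) := by
  refine Integrable.mono' (integrable_const (B * ∫ z, ‖K z‖)) (DI_meas hK hw hc hB t x) ?_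
  filter_upwards [ae_restrict_mem measurableSet_Ioc] with θ hθ
  have h1 := cv_norm_le hK (hB (t*(1-θ^2))) (cc ν t * θ) x
  have h2 := hw1 θ hθ
  rw [norm_smul, Real.norm_eq_abs]
  calc _ ≤ 1 * ‖cv K (cc ν t * θ) (h (t*(1-θ^2))) x‖ := by gcongr
    _ ≤ _ := by linarith

include hK hc hB hw in
lemma DI_deriv (hw1 : ∀ θ ∈ Ioc (0:ℝ) 1, |w θ| ≤ 1) {K2 : E → F →L[ℝ] (E →L[ℝ] W)} (hK2 : GK K2)
    (hd : ∀ g : E → F, Continuous g → (∀ x, ‖g x‖ ≤ B) → ∀ c : ℝ, 0 < c → ∀ x,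
      HasFDerivAt (cv K c g) (c⁻¹ • cv K2 c g x) x) {t : ℝ} (hcc : 0 < cc ν t)
    {w2 : ℝ → ℝ} (hw2m : Measurable w2) (hw2 : ∀ θ ∈ Ioc (0:ℝ) 1, w2 θ = θ⁻¹ * w θ)
    {b : ℝ → ℝ} (hb : IntegrableOn b (Ioc 0 1)) (hb2 : ∀ θ ∈ Ioc (0:ℝ) 1, ∀ x,
      ‖w2 θ • cv K2 (cc ν t * θ) (h (t*(1-θ^2))) x‖ ≤ b θ) (x : E) :
    HasFDerivAt (DI K w ν h t) ((cc ν t)⁻¹ • DI K2 w2 ν h t x) x := by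
  have key := hasFDerivAt_integral_of_dominated_of_fderiv_le (𝕜 := ℝ) (μ := volume.restrict (Ioc (0:ℝ) 1))
    (F := fun x θ => w θ • cv K (cc ν t * θ) (h (t*(1-θ^2))) x)
    (F' := fun x θ => (cc ν t)⁻¹ • w2 θ • cv K2 (cc ν t * θ) (h (t*(1-θ^2))) x)
    (x₀ := x) (s := univ) (bound := fun θ => (cc ν t)⁻¹ * b θ) univ_mem
    (Eventually.of_forall fun y => DI_meas hK hw hc hB t y)
    (DI_int hK hw hc hB hw1 t x)
    (by have := (DI_meas (ν := ν) hK2 hw2m hc hB t x).const_smul (cc ν t)⁻¹; exact this)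
    (by
      filter_upwards [ae_restrict_mem measurableSet_Ioc] with θ hθ
      intro y _
      rw [norm_smul, Real.norm_of_nonneg (by positivity)]
      gcongr
      exact hb2 θ hθ y)
    (hb.const_mul _)
    (by
      filter_upwards [ae_restrict_mem measurableSet_Ioc] with θ hθ
      intro y _
      have h0 := hθ.1
      have := ((hd _ (hc.comp (f := fun x => (t*(1-θ^2),x)) (by fun_prop)) (hB (t*(1-θ^2)))) _
        (mul_pos hcc h0) y).const_smul (w θ)
      refine this.congr_fderiv ?_
      rw [hw2 θ hθ, smul_smul, smul_smul]
      congr 1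
      field_simp)
  rw [integral_smul] at key
  exact key

include hK hc hB in
lemma DI_holder {K2 : E → F →L[ℝ] (E →L[ℝ] W)} (hK2 : GK K2)
    (hd : ∀ g : E → F, Continuous g → (∀ x, ‖g x‖ ≤ B) → ∀ c : ℝ, 0 < c → ∀ x,
      HasFDerivAt (cv K c g) (c⁻¹ • cv K2 c g x) x) {t : ℝ} (hcc : 0 < cc ν t) (x x' : E) :
    ‖DI K (fun _ => 1) ν h t x - DI K (fun _ => 1) ν h t x'‖ ≤
      (√(2*B*(∫ z, ‖K z‖)*(B* ∫ z, ‖K2 z‖)) * √(cc ν t)⁻¹ * √‖x-x'‖) * ∫ θ in Ioc (0:ℝ) 1, (√θ)⁻¹ := by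
  set C1 := ∫ z : E, ‖K z‖ with hC1
  set C2 := ∫ z : E, ‖K2 z‖ with hC2
  have hC10 : 0 ≤ C1 := integral_nonneg fun z => by positivity
  have hC20 : 0 ≤ C2 := integral_nonneg fun z => by positivity
  have hB0 : 0 ≤ B := (norm_nonneg _).trans (hB 0 0)
  rw [← integral_const_mul]
  unfold DI
  rw [← integral_sub (DI_int hK measurable_const hc hB (by simp) t x)
    (DI_int hK measurable_const hc hB (by simp) t x')]
  refine norm_integral_le_of_norm_le (int_inv_sqrt.const_mul _) ?_
  filter_upwards [ae_restrict_mem measurableSet_Ioc] with θ hθ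
  have hθ0 := hθ.1
  simp only [one_smul]
  set D := ‖cv K (cc ν t * θ) (h (t*(1-θ^2))) x - cv K (cc ν t * θ) (h (t*(1-θ^2))) x'‖ with hD
  have b1 : D ≤ 2*B*C1 := by
    have i1 := cv_norm_le hK (hB (t*(1-θ^2))) (cc ν t * θ) x
    have i2 := cv_norm_le hK (hB (t*(1-θ^2))) (cc ν t * θ) x'
    have := norm_sub_le (cv K (cc ν t * θ) (h (t*(1-θ^2))) x) (cv K (cc ν t * θ) (h (t*(1-θ^2))) x')
    linarith
  have b2 : D ≤ (cc ν t * θ)⁻¹ * (B*C2) * ‖x - x'‖ := by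
    refine Convex.norm_image_sub_le_of_norm_hasFDerivWithin_le (𝕜 := ℝ) (s := univ)
          (fun y _ => (hd _ (hc.comp (f := fun x => (t*(1-θ^2),x)) (by fun_prop)) (hB (t*(1-θ^2))) _ (mul_pos hcc hθ0) y).hasFDerivWithinAt)
          (fun y _ => ?_) convex_univ (mem_univ x') (mem_univ x)
    rw [norm_smul, Real.norm_of_nonneg (by positivity)]
    gcongr
    exact cv_norm_le hK2 (hB (t*(1-θ^2))) (cc ν t * θ) y
  have hD0 : 0 ≤ D := norm_nonneg _
  have : D ≤ √((2*B*C1) * ((cc ν t * θ)⁻¹ * (B*C2) * ‖x - x'‖)) := by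
    refine Real.le_sqrt_of_sq_le ?_
    rw [sq]
    gcongr
  refine this.trans (le_of_eq ?_)
  have e : (2*B*C1) * ((cc ν t * θ)⁻¹ * (B*C2) * ‖x - x'‖) =
    (2*B*C1*(B*C2)) * ((cc ν t)⁻¹ * (‖x-x'‖ * θ⁻¹)) := by rw [mul_inv]; ring
  rw [e, Real.sqrt_mul (x := 2*B*C1*(B*C2)) (by positivity), Real.sqrt_mul (x := (cc ν t)⁻¹) (by positivity),
    Real.sqrt_mul (x := ‖x-x'‖) (by positivity), Real.sqrt_inv θ]
  ring

include hK hc hB hw in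
lemma DI_sub {h' : ℝ → E → F} (hc' : Continuous fun p : ℝ × E => h' p.1 p.2) (hB' : ∀ s x, ‖h' s x‖ ≤ B)
    (hw1 : ∀ θ ∈ Ioc (0:ℝ) 1, |w θ| ≤ 1) (t : ℝ) (x : E) :
    DI K w ν h t x - DI K w ν h' t x = DI K w ν (fun s x => h s x - h' s x) t x := by
  unfold DI
  rw [← integral_sub (DI_int hK hw hc hB hw1 t x) (DI_int hK hw hc' hB' hw1 t x)]
  congr 1
  ext1 θ
  rw [← smul_sub]
  congr 1
  unfold cv
  rw [← integral_sub]
  · simp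
  · exact cv_integrable hK (hc.comp (f := fun x => (t*(1-θ^2),x)) (by fun_prop)) (hB _) _ _
  · exact cv_integrable hK (hc'.comp (f := fun x => (t*(1-θ^2),x)) (by fun_prop)) (hB' _) _ _

lemma gauss_half {lam t : ℝ} (hl : 0 < lam) (ht : 0 ≤ t) :
    √t * ∫ θ in Ioc (0:ℝ) 1, Real.exp (-(lam*t)*θ^2) ≤ √(Real.pi / lam) := by
  rcases ht.eq_or_lt with rfl | ht
  · simp
  have h1 : ∫ θ in Ioc (0:ℝ) 1, Real.exp (-(lam*t)*θ^2) ≤ ∫ θ, Real.exp (-(lam*t)*θ^2) :=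
    setIntegral_le_integral (integrable_exp_neg_mul_sq (by positivity)) (ae_of_all _ fun θ => (Real.exp_pos _).le)
  rw [integral_gaussian] at h1
  calc _ ≤ √t * √(Real.pi / (lam * t)) := by gcongr
    _ = √(t * (Real.pi / (lam * t))) := by rw [Real.sqrt_mul ht.le]
    _ = _ := by congr 1; field_simp

include hK in
/-- weighted bound -/
lemma DI_weight {a lam t : ℝ} (hl : 0 < lam) (ht : 0 ≤ t) (ha : ∀ s ∈ Icc 0 t, ∀ x, ‖h s x‖ ≤ a * Real.exp (lam * s))
    (hw1 : ∀ θ ∈ Ioc (0:ℝ) 1, |w θ| ≤ 1) (x : E) :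
    √t * ‖DI K w ν h t x‖ ≤ a * Real.exp (lam*t) * (∫ z, ‖K z‖) * √(Real.pi / lam) := by
  have ha0 : 0 ≤ a := by
    have := (norm_nonneg _).trans (ha 0 ⟨le_rfl, ht⟩ 0)
    simpa using this
  have hb : ‖DI K w ν h t x‖ ≤ ∫ θ in Ioc (0:ℝ) 1, (a * Real.exp (lam*t) * (∫ z, ‖K z‖)) * Real.exp (-(lam*t)*θ^2) := by
    unfold DI
    refine norm_integral_le_of_norm_le ?_ ?_
    · exact Continuous.integrableOn_Ioc (by fun_prop)
    filter_upwards [ae_restrict_mem measurableSet_Ioc] with θ hθ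
    have hθ2 : θ^2 ≤ 1 := by nlinarith [hθ.1, hθ.2]
    have h1 := cv_norm_le hK (ha (t*(1-θ^2)) ⟨mul_nonneg ht (by linarith), by nlinarith [sq_nonneg θ]⟩) (cc ν t * θ) x
    have h2 := hw1 θ hθ
    rw [norm_smul, Real.norm_eq_abs]
    calc _ ≤ 1 * ‖cv K (cc ν t * θ) (h (t*(1-θ^2))) x‖ := by gcongr
      _ ≤ a * Real.exp (lam * (t*(1-θ^2))) * ∫ z, ‖K z‖ := by linarith
      _ = _ := by
        have : lam * (t*(1-θ^2)) = lam * t + (-(lam*t)*θ^2) := by ring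
        rw [this, Real.exp_add]; ring
  rw [integral_const_mul] at hb
  have hKn : 0 ≤ ∫ z, ‖K z‖ := integral_nonneg fun z => norm_nonneg _
  calc _ ≤ √t * (a * Real.exp (lam*t) * (∫ z, ‖K z‖) * ∫ θ in Ioc (0:ℝ) 1, Real.exp (-(lam*t)*θ^2)) := by gcongr
    _ = a * Real.exp (lam*t) * (∫ z, ‖K z‖) * (√t * ∫ θ in Ioc (0:ℝ) 1, Real.exp (-(lam*t)*θ^2)) := by ring
    _ ≤ _ := by gcongr; exact gauss_half hl ht

end

/-- Duhamel potential and its derivatives -/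
def UU (ν : ℝ) (h : ℝ → E → E) (t : ℝ) (x : E) : E := (2*t) • DI (k0 E) (fun θ => θ) ν h t x
def VV (ν : ℝ) (h : ℝ → E → E) (t : ℝ) (x : E) : E →L[ℝ] E := √(2*t/ν) • DI k1 (fun _ => 1) ν h t x
def WW (ν : ℝ) (h : ℝ → E → E) (t : ℝ) (x : E) : E →L[ℝ] E →L[ℝ] E :=
  ν⁻¹ • DI k2 (fun θ => θ⁻¹) ν h t x

section
variable {ν : ℝ} (hν : 0 < ν) {h : ℝ → E → E} (hc : Continuous fun p : ℝ × E => h p.1 p.2)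
  {B : ℝ} (hB : ∀ s x, ‖h s x‖ ≤ B)

include hc in
lemma hslice (s : ℝ) : Continuous (h s) := hc.comp (f := fun x => (s,x)) (by fun_prop)

include hc hB in
lemma UU_cont : Continuous fun p : ℝ × E => UU ν h p.1 p.2 := by
  have h1 := DI_cont (ν := ν) (gk0 (E := E) E) (w := fun θ => θ) measurable_id hc hB (fun R => ⟨fun _ => B, by simp, fun t _ x θ hθ => by
    rw [norm_smul, Real.norm_of_nonneg (by exact hθ.1.le)]
    have := cv_k0_norm_le (hB (t*(1-θ^2))) (cc ν t * θ) x
    have hB0 := (norm_nonneg _).trans this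
    nlinarith [hθ.1, hθ.2, norm_nonneg (cv (k0 E) (cc ν t * θ) (h (t*(1-θ^2))) x)]⟩)
  have h2 : Continuous fun p : ℝ × E => 2 * p.1 := by fun_prop
  exact h2.smul h1

include hc hB in
lemma VV_cont : Continuous fun p : ℝ × E => VV ν h p.1 p.2 := by
  have h1 := DI_cont (ν := ν) (gk1 (E := E)) measurable_const hc hB
    (fun R => ⟨fun _ => B * ∫ z : E, ‖k1 z‖, integrable_const _, fun t _ x θ hθ => by
    rw [one_smul]
    exact cv_norm_le gk1 (hB (t*(1-θ^2))) (cc ν t * θ) x⟩)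
  have h2 : Continuous fun p : ℝ × E => √(2 * p.1 / ν) := by fun_prop
  exact h2.smul h1

include hν hc hB in
lemma WW_integrand {L : ℝ} (hL : ∀ s x x', ‖h s x - h s x'‖ ≤ L * √‖x - x'‖) {R t : ℝ} (htR : t ≤ R) (x : E)
    {θ : ℝ} (hθ : θ ∈ Ioc (0:ℝ) 1) :
    ‖θ⁻¹ • cv k2 (cc ν t * θ) (h (t*(1-θ^2))) x‖ ≤ (L * √(cc ν R) * ∫ z : E, ‖k2 z‖ * √‖z‖) * (√θ)⁻¹ := by
  have hθ0 := hθ.1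
  have h1 := cv_k2_holder (hslice hc (t*(1-θ^2))) (hB _) (hL _) (c := cc ν t * θ)
    (by unfold cc; positivity) x
  have hL0 : 0 ≤ L ∨ ∀ x : E, x = 0 := by
    by_cases hE : ∀ x : E, x = 0
    · exact Or.inr hE
    · left
      push Not at hE
      obtain ⟨x, hx⟩ := hE
      have := (norm_nonneg _).trans (hL 0 x 0)
      rw [sub_zero] at this
      have hp : 0 < √‖x‖ := by positivity
      by_contra hneg
      push Not at hneg
      nlinarith
  rcases hL0 with hL0 | hE
  · rw [norm_smul, Real.norm_of_nonneg (by positivity)]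
    have hs : √(cc ν t * θ) = √(cc ν t) * √θ := by rw [Real.sqrt_mul (by unfold cc; positivity)]
    have hm : √(cc ν t) ≤ √(cc ν R) := by unfold cc; gcongr
    have hI : 0 ≤ ∫ z : E, ‖k2 z‖ * √‖z‖ := integral_nonneg fun z => by positivity
    calc _ ≤ θ⁻¹ * (L * √(cc ν t * θ) * ∫ z : E, ‖k2 z‖ * √‖z‖) := by gcongr
      _ ≤ θ⁻¹ * (L * (√(cc ν R) * √θ) * ∫ z : E, ‖k2 z‖ * √‖z‖) := by rw [hs]; gcongr
      _ = (L * √(cc ν R) * ∫ z : E, ‖k2 z‖ * √‖z‖) * (θ⁻¹ * √θ) := by ring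
      _ = _ := by
        congr 1
        have := Real.mul_self_sqrt hθ0.le
        have hp : 0 < √θ := Real.sqrt_pos.2 hθ0
        nth_rewrite 1 [← this]
        field_simp
  · have e : θ⁻¹ • cv k2 (cc ν t * θ) (h (t*(1-θ^2))) x = 0 := by
      ext v; exact hE _
    have e2 : ∀ z : E, ‖k2 z‖ = 0 := fun z => by
      rw [norm_eq_zero]; ext v; exact hE _
    rw [e]; simp [e2]

include hν hc hB in
lemma WW_cont {L : ℝ} (hL : ∀ s x x', ‖h s x - h s x'‖ ≤ L * √‖x - x'‖) :
    Continuous fun p : ℝ × E => WW ν h p.1 p.2 := by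
  have h1 := DI_cont (ν := ν) (gk2 (E := E)) (w := fun θ => θ⁻¹) measurable_id.inv hc hB
    (fun R => ⟨_, int_inv_sqrt.const_mul _, fun t ht x θ hθ => WW_integrand hν hc hB hL ht.le x hθ⟩)
  exact h1.const_smul ν⁻¹

include hν hc hB in
lemma WW_bound {L : ℝ} (hL : ∀ s x x', ‖h s x - h s x'‖ ≤ L * √‖x - x'‖) (T : ℝ) :
    ∃ M, ∀ t ≤ T, ∀ x, ‖WW ν h t x‖ ≤ M := by
  refine ⟨ν⁻¹ * ∫ θ in Ioc (0:ℝ) 1, (L * √(cc ν T) * ∫ z : E, ‖k2 z‖ * √‖z‖) * (√θ)⁻¹, fun t ht x => ?_⟩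
  unfold WW
  rw [norm_smul, Real.norm_of_nonneg (by positivity)]
  gcongr
  refine norm_integral_le_of_norm_le (int_inv_sqrt.const_mul _) ?_
  filter_upwards [ae_restrict_mem measurableSet_Ioc] with θ hθ using WW_integrand hν hc hB hL ht x hθ

include hν hc hB in
lemma UU_deriv {t : ℝ} (ht : 0 ≤ t) (x : E) : HasFDerivAt (UU ν h t) (VV ν h t x) x := by
  rcases ht.eq_or_lt with rfl | ht
  · have e : UU ν h 0 = fun _ => 0 := by ext1 x; simp [UU]
    rw [e]; simpa [VV] using hasFDerivAt_const (0:E) x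
  have hcc : 0 < cc ν t := Real.sqrt_pos.2 (by positivity)
  have key := DI_deriv (gk0 (E := E) E) (w := fun θ => θ) measurable_id hc hB
    (fun θ hθ => by rw [abs_of_pos hθ.1]; exact hθ.2) gk1
    (fun g hg hgB c hc x => cv_k0_deriv hg hgB hc x) hcc (w2 := fun _ => 1) measurable_const
    (fun θ hθ => (inv_mul_cancel₀ hθ.1.ne').symm) (b := fun _ => B * ∫ z : E, ‖k1 z‖) (integrable_const _)
    (fun θ _ y => by
      rw [one_smul]
      exact cv_norm_le gk1 (hB (t*(1-θ^2))) (cc ν t * θ) y) x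
  refine (key.const_smul (2*t)).congr_fderiv ?_
  unfold VV
  rw [smul_smul]
  congr 1
  unfold cc
  have e1 : 2*t/ν = (2*t)^2/(2*ν*t) := by field_simp
  rw [e1, Real.sqrt_div (by positivity), Real.sqrt_sq (by positivity)]
  rfl

include hν hc hB in
lemma VV_deriv {L : ℝ} (hL : ∀ s x x', ‖h s x - h s x'‖ ≤ L * √‖x - x'‖) {t : ℝ} (ht : 0 ≤ t) (x : E) :
    HasFDerivAt (VV ν h t) (WW ν h t x) x := by
  rcases ht.eq_or_lt with rfl | ht
  · have e : VV ν h 0 = fun _ => 0 := by ext1 x; simp [VV]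
    have e2 : WW ν h 0 x = 0 := by
      have : cc ν 0 = 0 := by simp [cc]
      unfold WW DI cv
      simp [this, k2_integral]
    rw [e, e2]; exact hasFDerivAt_const _ x
  have hcc : 0 < cc ν t := Real.sqrt_pos.2 (by positivity)
  have key := DI_deriv (gk1 (E := E)) (w := fun _ => 1) measurable_const hc hB
    (fun θ hθ => by simp) gk2
    (fun g hg hgB c hc x => cv_k1_deriv hg hgB hc x) hcc (w2 := fun θ => θ⁻¹) measurable_id.inv
    (fun θ hθ => (mul_one _).symm) (int_inv_sqrt.const_mul _)
    (fun θ hθ y => WW_integrand hν hc hB hL le_rfl y hθ) x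
  refine (key.const_smul (√(2*t/ν))).congr_fderiv ?_
  unfold WW
  rw [smul_smul]
  congr 1
  unfold cc
  have e1 : 2*t/ν = (2*ν*t)/ν^2 := by field_simp
  rw [e1, Real.sqrt_div (by positivity), Real.sqrt_sq (by positivity)]
  have : √(2*ν*t) ≠ 0 := hcc.ne'
  field_simp

include hν hc hB in
lemma VV_holder (T : ℝ) : ∃ L, 0 ≤ L ∧ ∀ t ∈ Icc 0 T, ∀ x x', ‖VV ν h t x - VV ν h t x'‖ ≤ L * √‖x - x'‖ := by
  set C1 := ∫ z : E, ‖k1 z‖ with hC1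
  set C2 := ∫ z : E, ‖k2 z‖ with hC2
  have hC10 : 0 ≤ C1 := integral_nonneg fun z => by positivity
  have hC20 : 0 ≤ C2 := integral_nonneg fun z => by positivity
  have hB0 : 0 ≤ B := (norm_nonneg _).trans (hB 0 0)
  set J := ∫ θ in Ioc (0:ℝ) 1, (√θ)⁻¹
  have hJ : 0 ≤ J := integral_nonneg fun θ => by positivity
  set S := √(2*B*C1*(B*C2)) with hS
  refine ⟨√(√(2*T/ν)/ν) * S * J, by positivity, fun t ht x x' => ?_⟩
  rcases ht.1.eq_or_lt with h0 | ht0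
  · subst h0; simp [VV]; positivity
  have hcc : 0 < cc ν t := Real.sqrt_pos.2 (by positivity)
  unfold VV
  rw [← smul_sub, norm_smul, Real.norm_of_nonneg (by positivity)]
  have main := DI_holder (gk1 (E := E)) hc hB gk2
    (fun g hg hgB c hc x => cv_k1_deriv hg hgB hc x) hcc x x'
  calc _ ≤ √(2*t/ν) * (S * √(cc ν t)⁻¹ * √‖x-x'‖ * J) := by gcongr
    _ = (√(2*t/ν) * √(cc ν t)⁻¹) * S * J * √‖x-x'‖ := by ring
    _ ≤ _ := by
      gcongr
      have e1 : √(2*t/ν) = √((2*t/ν)) := rfl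
      rw [← Real.sqrt_mul (by positivity)]
      gcongr
      have e2 : 2*t/ν*(cc ν t)⁻¹ = √(2*t/ν)/ν := by
        unfold cc at hcc ⊢
        have e3 : √(2*t/ν) = √(2*ν*t)/ν := by
          have e1 : 2*t/ν = (2*ν*t)/ν^2 := by field_simp
          rw [e1, Real.sqrt_div (by positivity), Real.sqrt_sq (by positivity)]
        rw [e3]
        have := Real.mul_self_sqrt (show 0 ≤ 2*ν*t by positivity)
        generalize √(2*ν*t) = c at *
        have hc2 : 2 * t = c * c / ν := by rw [this]; field_simp
        rw [hc2]
        field_simp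
      rw [e2]
      gcongr
      exact ht.2
end
end

-- part 5
noncomputable section
set_option maxSynthPendingDepth 3
variable {E : Type*} [NormedAddCommGroup E] [InnerProductSpace ℝ E] [FiniteDimensional ℝ E]
  [MeasurableSpace E] [BorelSpace E]

section
variable {ν : ℝ} (hν : 0 < ν) {h : ℝ → E → E} (hc : Continuous fun p : ℝ × E => h p.1 p.2)
  {B : ℝ} (hB : ∀ s x, ‖h s x‖ ≤ B)

include hc hB in
lemma cv_time_cont {τ c : ℝ → ℝ} (hτ : Continuous τ) (hcc : Continuous c) :
    Continuous fun q : ℝ × E => cv (k0 E) (c q.1) (h (τ q.1)) q.2 := by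
  refine cv_continuous (gk0 E) (h := fun q : ℝ × E => h (τ q.1)) ?_ (fun q x => hB _ _) (by fun_prop) (by fun_prop)
  exact hc.comp (f := fun p : (ℝ × E) × E => (τ p.1.1, p.2)) (by fun_prop)

include hc hB in
lemma cv_time_cont' {τ c : ℝ → ℝ} (hτ : Continuous τ) (hcc : Continuous c) (x : E) :
    Continuous fun r : ℝ => cv (k0 E) (c r) (h (τ r)) x :=
  (cv_time_cont hc hB hτ hcc).comp (f := fun r : ℝ => (r, x)) (by fun_prop)

include hc hB in
lemma UU_eq {t : ℝ} (ht : 0 ≤ t) (x : E) :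
    UU ν h t x = ∫ r in (0:ℝ)..t, cv (k0 E) (cc ν r) (h (t - r)) x := by
  have key := intervalIntegral.integral_deriv_smul_comp (a := 0) (b := 1) (f := fun θ : ℝ => t * θ^2)
    (f' := fun θ => 2*t*θ) (g := fun r => cv (k0 E) (cc ν r) (h (t - r)) x)
    (fun θ _ => by
      have := (hasDerivAt_pow 2 θ).const_mul t
      refine this.congr_deriv ?_
      simp; ring) (by fun_prop) (cv_time_cont' hc hB (by fun_prop) (cc_cont ν) x)
  simp only [ne_eq, OfNat.ofNat_ne_zero, not_false_eq_true, zero_pow, mul_zero, one_pow, mul_one] at key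
  rw [← key, intervalIntegral.integral_of_le zero_le_one]
  unfold UU DI
  rw [← integral_smul]
  refine setIntegral_congr_fun measurableSet_Ioc fun θ hθ => ?_
  simp only [Function.comp]
  rw [smul_smul]
  have e : cc ν (t*θ^2) = cc ν t * θ := by
    unfold cc
    rw [← mul_assoc, Real.sqrt_mul' _ (by positivity), Real.sqrt_sq hθ.1.le]
  rw [e]
  congr 4
  ring

lemma cc_sq {t : ℝ} (hν : 0 < ν) (ht : 0 ≤ t) : cc ν t ^ 2 = 2*ν*t := Real.sq_sqrt (by positivity)

include hν hc hB in
lemma UU_restart {t δ : ℝ} (ht : 0 ≤ t) (hδ : 0 ≤ δ) (x : E) :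
    UU ν h (t + δ) x = cv (k0 E) (cc ν δ) (UU ν h t) x + UU ν (fun s => h (t + s)) δ x := by
  have hcont : Continuous fun r : ℝ => cv (k0 E) (cc ν r) (h (t + δ - r)) x :=
    cv_time_cont' hc hB (by fun_prop) (cc_cont ν) x
  have hc2 : Continuous fun p : ℝ × E => h (t + p.1) p.2 := hc.comp (f := fun p : ℝ × E => (t+p.1,p.2)) (by fun_prop)
  rw [UU_eq hc hB (by positivity), UU_eq (h := fun s => h (t+s)) hc2 (fun s => hB (t+s)) hδ,
    ← intervalIntegral.integral_add_adjacent_intervals (hcont.intervalIntegrable 0 δ) (hcont.intervalIntegrable δ (t+δ)),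
    add_comm]
  congr 1
  · have e1 : UU ν h t = fun y => ∫ r in Ioc (0:ℝ) t, cv (k0 E) (cc ν r) (h (t - r)) y := by
      ext1 y; rw [UU_eq hc hB ht, intervalIntegral.integral_of_le ht]
    have s1 := intervalIntegral.integral_comp_add_right (a := 0) (b := t)
      (fun r => cv (k0 E) (cc ν r) (h (t + δ - r)) x) δ
    rw [zero_add] at s1
    rw [← s1, e1, cv_k0_eq, ← gam_integral, intervalIntegral.integral_of_le ht]
    rw [integral_integral_swap]
    · refine setIntegral_congr_fun measurableSet_Ioc fun r hr => ?_
      have sg := semigroup (hslice hc (t-r)) (hB (t-r)) (cc ν δ) (cc ν r) x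
      rw [cv_k0_eq, ← gam_integral, cc_sq hν hδ, cc_sq hν hr.1.le] at sg
      rw [sg]
      congr 2
      · unfold cc; congr 1; ring
      · ring
    · refine Integrable.mono' (integrable_const B) (Continuous.aestronglyMeasurable ?_) (ae_of_all _ fun z => ?_)
      · exact (cv_time_cont hc hB (τ := fun r => t - r) (by fun_prop) (cc_cont ν)).comp
          (f := fun q : E × ℝ => (q.2, x + cc ν δ • q.1)) (by fun_prop)
      · exact cv_k0_norm_le (hB _) _ _
  · refine intervalIntegral.integral_congr fun r _ => ?_
    congr 2
    ring

include hc hB in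
lemma UU_right0 (x : E) : HasDerivWithinAt (fun δ => UU ν h δ x) (h 0 x) (Ici 0) 0 := by
  refine HasDerivAt.hasDerivWithinAt ?_
  rw [hasDerivAt_iff_tendsto_slope]
  have hD : Continuous fun p : ℝ × E => DI (k0 E) (fun θ => θ) ν h p.1 p.2 :=
    DI_cont (ν := ν) (gk0 (E := E) E) (w := fun θ => θ) measurable_id hc hB (fun R => ⟨fun _ => B, by simp, fun t _ x θ hθ => by
      rw [norm_smul, Real.norm_of_nonneg (by exact hθ.1.le)]
      have := cv_k0_norm_le (hB (t*(1-θ^2))) (cc ν t * θ) x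
      nlinarith [hθ.1, hθ.2, norm_nonneg (cv (k0 E) (cc ν t * θ) (h (t*(1-θ^2))) x)]⟩)
  have hD1 : Continuous fun δ : ℝ => (2:ℝ) • DI (k0 E) (fun θ => θ) ν h δ x :=
    (hD.comp (f := fun δ : ℝ => (δ,x)) (by fun_prop)).const_smul 2
  have e0 : (2:ℝ) • DI (k0 E) (fun θ => θ) ν h 0 x = h 0 x := by
    unfold DI
    have : cc ν 0 = 0 := by simp [cc]
    simp only [this, zero_mul, cv_k0_zero]
    rw [integral_smul_const, ← intervalIntegral.integral_of_le zero_le_one, integral_id, smul_smul]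
    norm_num
  have := (hD1.tendsto 0).mono_left (nhdsWithin_le_nhds (s := {0}ᶜ))
  rw [e0] at this
  refine this.congr' ?_
  filter_upwards [self_mem_nhdsWithin] with δ hδ
  have hδ : δ ≠ 0 := hδ
  simp only [slope, UU, sub_zero, mul_zero, zero_smul, vsub_eq_sub, smul_smul]
  congr 1
  field_simp

variable {φ : E → E} {φ1 : E → E →L[ℝ] E} {φ2 : E → E →L[ℝ] E →L[ℝ] E}

def yy (ν : ℝ) (φ : E → E) (h : ℝ → E → E) (t : ℝ) (x : E) : E := cv (k0 E) (cc ν t) φ x + UU ν h t x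
def pp (ν : ℝ) (φ1 : E → E →L[ℝ] E) (h : ℝ → E → E) (t : ℝ) (x : E) : E →L[ℝ] E :=
  cv (k0 (E →L[ℝ] E)) (cc ν t) φ1 x + VV ν h t x
def qq (ν : ℝ) (φ2 : E → E →L[ℝ] E →L[ℝ] E) (h : ℝ → E → E) (t : ℝ) (x : E) : E →L[ℝ] E →L[ℝ] E :=
  cv (k0 (E →L[ℝ] E →L[ℝ] E)) (cc ν t) φ2 x + WW ν h t x

lemma av_cont {F : Type*} [NormedAddCommGroup F] [NormedSpace ℝ F] {ψ : E → F} (hψ : Continuous ψ) {M : ℝ}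
    (hM : ∀ x, ‖ψ x‖ ≤ M) : Continuous fun p : ℝ × E => cv (k0 F) (cc ν p.1) ψ p.2 := by
  have := cc_cont ν
  exact cv_continuous (gk0 F) (h := fun (_ : ℝ × E) => ψ) (by fun_prop) (fun _ => hM) (by fun_prop) (by fun_prop)

lemma yy_zero (x : E) : yy ν φ h 0 x = φ x := by
  have : cc ν 0 = 0 := by simp [cc]
  simp [yy, this, cv_k0_zero, UU]

variable (h1 : ∀ x, HasFDerivAt φ (φ1 x) x) (h2 : ∀ x, HasFDerivAt φ1 (φ2 x) x) (h2c : Continuous φ2)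
  {M : ℝ} (hM : ∀ x, ‖φ x‖ ≤ M) (hM1 : ∀ x, ‖φ1 x‖ ≤ M) (hM2 : ∀ x, ‖φ2 x‖ ≤ M)
  {L : ℝ} (hL : ∀ s x x', ‖h s x - h s x'‖ ≤ L * √‖x - x'‖)

lemma cont_of_deriv {F : Type*} [NormedAddCommGroup F] [NormedSpace ℝ F] {ψ : E → F} {ψ1 : E → E →L[ℝ] F}
    (h1 : ∀ x, HasFDerivAt ψ (ψ1 x) x) : Continuous ψ :=
  continuous_iff_continuousAt.2 fun x => (h1 x).continuousAt

include hc hB h1 hM in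
lemma yy_cont : Continuous fun p : ℝ × E => yy ν φ h p.1 p.2 :=
  (av_cont (cont_of_deriv h1) hM).add (UU_cont hc hB)

include hc hB h2 hM1 in
lemma pp_cont : Continuous fun p : ℝ × E => pp ν φ1 h p.1 p.2 :=
  (av_cont (cont_of_deriv h2) hM1).add (VV_cont hc hB)

include hν hc hB h2c hM2 hL in
lemma qq_cont : Continuous fun p : ℝ × E => qq ν φ2 h p.1 p.2 :=
  (av_cont h2c hM2).add (WW_cont hν hc hB hL)

include hν hc hB h1 h2 hM hM1 in
lemma yy_deriv {t : ℝ} (ht : 0 ≤ t) (x : E) : HasFDerivAt (yy ν φ h t) (pp ν φ1 h t x) x :=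
  (av_hasFDerivAt h1 (cont_of_deriv h2) hM hM1 (cc ν t) x).add (UU_deriv hν hc hB ht x)

include hν hc hB h2 hM1 hM2 hL h2c in
lemma pp_deriv {t : ℝ} (ht : 0 ≤ t) (x : E) : HasFDerivAt (pp ν φ1 h t) (qq ν φ2 h t x) x :=
  (av_hasFDerivAt h2 h2c hM1 hM2 (cc ν t) x).add (VV_deriv hν hc hB hL ht x)

include hM hB in
lemma yy_bound {t T : ℝ} (ht : t ∈ Icc 0 T) (x : E) : ‖yy ν φ h t x‖ ≤ M + 2 * T * B := by
  have hB0 : 0 ≤ B := (norm_nonneg _).trans (hB 0 0)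
  refine (norm_add_le _ _).trans (add_le_add (cv_k0_norm_le hM _ _) ?_)
  unfold UU
  rw [norm_smul, Real.norm_of_nonneg (by linarith [ht.1])]
  have : ‖DI (k0 E) (fun θ => θ) ν h t x‖ ≤ B * volume.real (Ioc (0:ℝ) 1) := by
    refine norm_setIntegral_le_of_norm_le_const (by simp) fun θ hθ => ?_
    rw [norm_smul, Real.norm_of_nonneg (by exact hθ.1.le)]
    have := cv_k0_norm_le (hB (t*(1-θ^2))) (cc ν t * θ) x
    nlinarith [hθ.1, hθ.2, norm_nonneg (cv (k0 E) (cc ν t * θ) (h (t*(1-θ^2))) x)]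
  simp at this
  have := ht.2
  have := ht.1
  have : 0 ≤ 2 * T := by linarith
  gcongr

include hM1 hB hν in
lemma pp_bound {t T : ℝ} (ht : t ∈ Icc 0 T) (x : E) :
    ‖pp ν φ1 h t x‖ ≤ M + √(2*T/ν) * (B * ∫ z : E, ‖k1 z‖) := by
  have hB0 : 0 ≤ B := (norm_nonneg _).trans (hB 0 0)
  refine (norm_add_le _ _).trans (add_le_add (cv_k0_norm_le hM1 _ _) ?_)
  unfold VV
  rw [norm_smul, Real.norm_of_nonneg (by positivity)]
  have : ‖DI k1 (fun θ => 1) ν h t x‖ ≤ (B * ∫ z : E, ‖k1 z‖) * volume.real (Ioc (0:ℝ) 1) := by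
    refine norm_setIntegral_le_of_norm_le_const (by simp) fun θ hθ => ?_
    rw [one_smul]
    exact cv_norm_le gk1 (hB (t*(1-θ^2))) (cc ν t * θ) x
  simp only [Real.volume_real_Ioc, sub_zero, zero_le_one, sup_of_le_left, mul_one] at this
  have := ht.2
  have := ht.1
  gcongr

include hν hc hB hM2 hL in
lemma qq_bound (T : ℝ) : ∃ C, ∀ t ≤ T, ∀ x, ‖qq ν φ2 h t x‖ ≤ C := by
  obtain ⟨C, hC⟩ := WW_bound hν hc hB hL T
  exact ⟨M + C, fun t ht x => (norm_add_le _ _).trans (add_le_add (cv_k0_norm_le hM2 _ _) (hC t ht x))⟩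

include hν hc hB h1 hM in
lemma yy_restart {t δ : ℝ} (ht : 0 ≤ t) (hδ : 0 ≤ δ) (x : E) :
    yy ν φ h (t + δ) x = cv (k0 E) (cc ν δ) (yy ν φ h t) x + UU ν (fun s => h (t + s)) δ x := by
  have hφc := cont_of_deriv h1
  unfold yy
  rw [UU_restart hν hc hB ht hδ, ← add_assoc]
  congr 1
  have sg := semigroup hφc hM (cc ν δ) (cc ν t) x
  rw [cc_sq hν hδ, cc_sq hν ht] at sg
  have e : cc ν (t + δ) = √(2*ν*δ + 2*ν*t) := by unfold cc; congr 1; ring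
  rw [e, ← sg]
  have c1 : Continuous (cv (k0 E) (cc ν t) φ) :=
    (av_cont (ν := ν) hφc hM).comp (f := fun x : E => (t,x)) (by fun_prop)
  have c2 : Continuous (UU ν h t) := (UU_cont hc hB).comp (f := fun x : E => (t,x)) (by fun_prop)
  unfold cv
  rw [← integral_add]
  · simp [cv]
  · exact cv_integrable (gk0 E) c1 (cv_k0_norm_le hM _) _ _
  · refine cv_integrable (gk0 E) c2 (M := 2*t*B) (fun x => ?_) _ _
    have := yy_bound (ν := ν) (φ := fun _ => (0:E)) (M := 0) hB (by simp) (t := t) (T := t) ⟨ht, le_rfl⟩ x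
    simpa [yy, cv] using this

include hν hc hB h1 h2 h2c hM hM1 hM2 hL in
lemma yy_right_deriv {ι : Type*} [Fintype ι] (b : OrthonormalBasis ι ℝ E) {t : ℝ} (ht : 0 ≤ t) (x : E) :
    HasDerivWithinAt (fun s => yy ν φ h s x) (ν • (∑ j, qq ν φ2 h t x (b j) (b j)) + h t x) (Ici t) t := by
  obtain ⟨C, hC⟩ := qq_bound hν hc hB hM2 hL t
  have b1 := fun x => yy_bound (ν := ν) (φ := φ) hB hM (t := t) (T := t) ⟨ht, le_rfl⟩ x
  have b2 := fun x => pp_bound (ν := ν) (φ1 := φ1) hν hB hM1 (t := t) (T := t) ⟨ht, le_rfl⟩ x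
  set M' := max (M + 2 * t * B) (max (M + √(2*t/ν) * (B * ∫ z : E, ‖k1 z‖)) C) with hM'
  have d1 := heat_right_deriv b hν (yy_deriv hν hc hB h1 h2 hM hM1 ht) (pp_deriv hν hc hB h2 h2c hM1 hM2 hL ht)
    (M := M') (fun x => (b1 x).trans (le_max_left _ _)) (fun x => (b2 x).trans ((le_max_left _ _).trans (le_max_right _ _)))
    (fun x => (hC t le_rfl x).trans ((le_max_right _ _).trans (le_max_right _ _))) x
  have hc2 : Continuous fun p : ℝ × E => h (t + p.1) p.2 := hc.comp (f := fun p : ℝ × E => (t+p.1,p.2)) (by fun_prop)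
  have d2 := UU_right0 (ν := ν) (h := fun s => h (t+s)) hc2 (fun s => hB (t+s)) x
  have d3 := d1.add d2
  rw [add_zero] at d3
  have d4 : HasDerivWithinAt (fun δ => yy ν φ h (t + δ) x) (ν • (∑ j, qq ν φ2 h t x (b j) (b j)) + h t x) (Ici 0) 0 := by
    refine d3.congr (fun δ hδ => yy_restart hν hc hB h1 hM ht hδ x) (yy_restart hν hc hB h1 hM ht le_rfl x)
  have d5 : HasDerivWithinAt (fun s : ℝ => s - t) 1 (Ici t) t := ((hasDerivAt_id t).sub_const t).hasDerivWithinAt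
  have d6 := HasDerivWithinAt.scomp_of_eq (h := fun s : ℝ => s - t) t d4 d5 (fun s hs => by simpa using hs) (by simp)
  simpa [Function.comp_def] using d6

include hν hc hB h1 h2 h2c hM hM1 hM2 hL in
lemma yy_time_deriv {ι : Type*} [Fintype ι] (b : OrthonormalBasis ι ℝ E) {t T : ℝ} (ht : t ∈ Icc 0 T) (x : E) :
    HasDerivWithinAt (fun s => yy ν φ h s x) (ν • (∑ j, qq ν φ2 h t x (b j) (b j)) + h t x) (Icc 0 T) t := by
  have hq := (qq_cont hν hc hB h2c hM2 hL).comp (f := fun s : ℝ => (s,x)) (by fun_prop)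
  have hh := hc.comp (f := fun s : ℝ => (s,x)) (by fun_prop)
  simp only [Function.comp_def] at hq hh
  set N : ℝ → E := fun t => ν • (∑ j, qq ν φ2 h t x (b j) (b j)) + h t x with hN
  have hNc : Continuous N := by
    refine (Continuous.const_smul ?_ ν).add hh
    refine continuous_finsetSum _ fun j _ => ?_
    exact (hq.clm_apply continuous_const).clm_apply continuous_const
  have hG : ∀ t, HasDerivAt (fun s => yy ν φ h 0 x + ∫ r in (0:ℝ)..s, N r) (N t) t := fun t =>
    (intervalIntegral.integral_hasDerivAt_right (hNc.intervalIntegrable _ _) (hNc.stronglyMeasurableAtFilter _ _)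
      hNc.continuousAt).const_add _
  have hyc : Continuous fun s => yy ν φ h s x := (yy_cont hc hB h1 hM).comp (f := fun s : ℝ => (s,x)) (by fun_prop)
  have heq := eq_of_has_deriv_right_eq (a := 0) (b := T) (f := fun s => yy ν φ h s x)
    (g := fun s => yy ν φ h 0 x + ∫ r in (0:ℝ)..s, N r) (f' := N)
    (fun s hs => yy_right_deriv hν hc hB h1 h2 h2c hM hM1 hM2 hL b hs.1 x)
    (fun s hs => (hG s).hasDerivWithinAt) hyc.continuousOn
    (fun s _ => (hG s).continuousAt.continuousWithinAt) (by simp)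
  exact (hG t).hasDerivWithinAt.congr heq (heq t ht)
end
end

-- part 6
noncomputable section
set_option maxSynthPendingDepth 3
variable {E : Type*} [NormedAddCommGroup E] [InnerProductSpace ℝ E] [FiniteDimensional ℝ E]
  [MeasurableSpace E] [BorelSpace E]

variable (E) in
lemma UV_weight {ν : ℝ} (hν : 0 < ν) (T : ℝ) : ∃ k : ℝ, 0 ≤ k ∧ ∀ (h : ℝ → E → E) (a lam t : ℝ), 0 < lam →
    t ∈ Icc 0 T → (∀ s ∈ Icc 0 t, ∀ x, ‖h s x‖ ≤ a * Real.exp (lam * s)) → ∀ x,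
      ‖UU ν h t x‖ ≤ k * √(Real.pi / lam) * (a * Real.exp (lam * t)) ∧
      ‖VV ν h t x‖ ≤ k * √(Real.pi / lam) * (a * Real.exp (lam * t)) := by
  set C0 := ∫ z : E, ‖k0 E z‖
  set C1 := ∫ z : E, ‖k1 z‖
  have hC0 : 0 ≤ C0 := integral_nonneg fun z => by positivity
  have hC1 : 0 ≤ C1 := integral_nonneg fun z => by positivity
  refine ⟨2*√T*C0 + √(2/ν)*C1, by positivity, fun h a lam t hl ht ha x => ?_⟩
  have ha0 : 0 ≤ a * Real.exp (lam * t) := (norm_nonneg _).trans (ha t ⟨ht.1, le_rfl⟩ 0)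
  have w0 := DI_weight (ν := ν) (gk0 (E := E) E) (w := fun θ => θ) hl ht.1 ha
    (fun θ hθ => by rw [abs_of_pos hθ.1]; exact hθ.2) x
  have w1 := DI_weight (ν := ν) (gk1 (E := E)) (w := fun θ => 1) hl ht.1 ha (fun θ hθ => by simp) x
  have hp : 0 ≤ √(Real.pi / lam) := by positivity
  constructor
  · unfold UU
    rw [norm_smul, Real.norm_of_nonneg (by linarith [ht.1])]
    calc _ = 2 * √t * (√t * ‖DI (k0 E) (fun θ => θ) ν h t x‖) := by
          nth_rewrite 1 [← Real.mul_self_sqrt ht.1]; ring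
      _ ≤ 2 * √T * (a * Real.exp (lam * t) * C0 * √(Real.pi / lam)) := by
          gcongr
          exact ht.2
      _ = (2*√T*C0) * √(Real.pi / lam) * (a * Real.exp (lam * t)) := by ring
      _ ≤ _ := by
          gcongr
          have : 0 ≤ √(2/ν)*C1 := by positivity
          linarith
  · unfold VV
    rw [norm_smul, Real.norm_of_nonneg (by positivity)]
    have e : √(2*t/ν) = √(2/ν) * √t := by
      rw [← Real.sqrt_mul (by positivity)]; congr 1; ring
    calc _ = √(2/ν) * (√t * ‖DI k1 (fun θ => 1) ν h t x‖) := by rw [e]; ring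
      _ ≤ √(2/ν) * (a * Real.exp (lam * t) * C1 * √(Real.pi / lam)) := by gcongr
      _ = (√(2/ν)*C1) * √(Real.pi / lam) * (a * Real.exp (lam * t)) := by ring
      _ ≤ _ := by
          gcongr
          have : 0 ≤ 2*√T*C0 := by positivity
          linarith

def clamp (T t : ℝ) : ℝ := max 0 (min T t)
lemma clamp_cont (T : ℝ) : Continuous (clamp T) := by unfold clamp; fun_prop
lemma clamp_mem {T : ℝ} (hT : 0 < T) (t : ℝ) : clamp T t ∈ Icc 0 T := by
  unfold clamp; exact ⟨le_max_left _ _, max_le hT.le (min_le_left _ _)⟩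
lemma clamp_eq {T t : ℝ} (ht : t ∈ Icc 0 T) : clamp T t = t := by
  unfold clamp; rw [min_eq_right ht.2, max_eq_right ht.1]

section
variable {ν T : ℝ} (hν : 0 < ν) (hT : 0 < T) {G : ℝ → E → E × (E →L[ℝ] E) → E}
  (hG : Continuous fun q : ℝ × E × (E × (E →L[ℝ] E)) => G q.1 q.2.1 q.2.2) {B : ℝ} (hB : ∀ t x z, ‖G t x z‖ ≤ B)
  {L : ℝ} (hL : ∀ t x z z', ‖G t x z - G t x z'‖ ≤ L * ‖z - z'‖)
  {φ : E → E} {φ1 : E → E →L[ℝ] E} {φ2 : E → E →L[ℝ] E →L[ℝ] E}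
  (h1 : ∀ x, HasFDerivAt φ (φ1 x) x) (h2 : ∀ x, HasFDerivAt φ1 (φ2 x) x) (h2c : Continuous φ2)
  {M : ℝ} (hM : ∀ x, ‖φ x‖ ≤ M) (hM1 : ∀ x, ‖φ1 x‖ ≤ M) (hM2 : ∀ x, ‖φ2 x‖ ≤ M)

def hY (T lam : ℝ) (G : ℝ → E → E × (E →L[ℝ] E) → E) (Y : BoundedContinuousFunction (ℝ × E) (E × (E →L[ℝ] E)))
    (s : ℝ) (x : E) : E := G s x (Real.exp (lam * clamp T s) • Y (s, x))

include hG in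
lemma hY_cont (lam : ℝ) (Y) : Continuous fun p : ℝ × E => hY T lam G Y p.1 p.2 := by
  have := clamp_cont T
  have hy := Y.continuous
  exact hG.comp (f := fun p : ℝ × E => (p.1, p.2, Real.exp (lam * clamp T p.1) • Y (p.1, p.2))) (by fun_prop)

def raw (ν T lam : ℝ) (φ : E → E) (φ1 : E → E →L[ℝ] E) (h : ℝ → E → E) (q : ℝ × E) : E × (E →L[ℝ] E) :=
  Real.exp (-(lam * clamp T q.1)) • (yy ν φ h (clamp T q.1) q.2, pp ν φ1 h (clamp T q.1) q.2)

include hν hT hG hB h1 h2 hM hM1 in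
lemma raw_props {lam : ℝ} (hl : 0 < lam) (Y) : Continuous (raw ν T lam φ φ1 (hY T lam G Y)) ∧
    ∀ q, ‖raw ν T lam φ φ1 (hY T lam G Y) q‖ ≤ max (M + 2 * T * B) (M + √(2*T/ν) * (B * ∫ z : E, ‖k1 z‖)) := by
  have hcl := clamp_cont T
  have hc := hY_cont (T := T) hG lam Y
  have hb : ∀ s x, ‖hY T lam G Y s x‖ ≤ B := fun s x => hB _ _ _
  constructor
  · have c1 := (yy_cont (ν := ν) hc hb h1 hM).comp (f := fun q : ℝ × E => (clamp T q.1, q.2)) (by fun_prop)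
    have c2 := (pp_cont (ν := ν) hc hb h2 hM1).comp (f := fun q : ℝ × E => (clamp T q.1, q.2)) (by fun_prop)
    have c3 : Continuous fun q : ℝ × E => Real.exp (-(lam * clamp T q.1)) := by fun_prop
    exact c3.smul (c1.prodMk c2)
  · intro q
    unfold raw
    have hm := clamp_mem hT q.1
    rw [norm_smul, Real.norm_of_nonneg (Real.exp_pos _).le]
    have e1 : Real.exp (-(lam * clamp T q.1)) ≤ 1 := by
      rw [Real.exp_le_one_iff]
      have := mul_nonneg hl.le hm.1
      linarith
    calc _ ≤ 1 * ‖(yy ν φ (hY T lam G Y) (clamp T q.1) q.2, pp ν φ1 (hY T lam G Y) (clamp T q.1) q.2)‖ := by gcongr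
      _ ≤ _ := by
        rw [one_mul, Prod.norm_def]
        exact max_le_max (yy_bound hb hM hm _) (pp_bound hν hb hM1 hm _)

include hν hT hG hB h1 h2 hM hM1 hL in
lemma mild_exists : ∃ h : ℝ → E → E, Continuous (fun p : ℝ × E => h p.1 p.2) ∧ (∀ s x, ‖h s x‖ ≤ B) ∧
    ∀ s x, h s x = G s x (yy ν φ h (clamp T s) x, pp ν φ1 h (clamp T s) x) := by
  obtain ⟨k, hk0, hk⟩ := UV_weight E hν T
  set L' := max L 0 with hL'
  have hL0 : 0 ≤ L' := le_max_right _ _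
  have hL2 : ∀ t x z z', ‖G t x z - G t x z'‖ ≤ L' * ‖z - z'‖ := fun t x z z' =>
    (hL t x z z').trans (by gcongr; exact le_max_left _ _)
  set lam := Real.pi * (2*k*L'+1)^2 with hlam
  have hl : 0 < lam := by positivity
  have hsq : √(Real.pi / lam) = (2*k*L'+1)⁻¹ := by
    rw [hlam]
    have : Real.pi / (Real.pi * (2*k*L'+1)^2) = ((2*k*L'+1)⁻¹)^2 := by field_simp
    rw [this, Real.sqrt_sq (by positivity)]
  let Φ : BoundedContinuousFunction (ℝ × E) (E × (E →L[ℝ] E)) → BoundedContinuousFunction (ℝ × E) (E × (E →L[ℝ] E)) :=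
    fun Y => BoundedContinuousFunction.ofNormedAddCommGroup (raw ν T lam φ φ1 (hY T lam G Y))
      (raw_props hν hT hG hB h1 h2 hM hM1 hl Y).1 _ (raw_props hν hT hG hB h1 h2 hM hM1 hl Y).2
  have hΦ : ContractingWith (1/2) Φ := by
    refine ⟨by rw [← NNReal.coe_lt_coe]; norm_num, LipschitzWith.of_dist_le_mul fun Y Y' => ?_⟩
    refine (BoundedContinuousFunction.dist_le (by positivity)).2 fun q => ?_
    have hc := hY_cont (T := T) hG lam Y
    have hb : ∀ s x, ‖hY T lam G Y s x‖ ≤ B := fun s x => hB _ _ _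
    have hc' := hY_cont (T := T) hG lam Y'
    have hb' : ∀ s x, ‖hY T lam G Y' s x‖ ≤ B := fun s x => hB _ _ _
    have hm := clamp_mem hT q.1
    set τ := clamp T q.1 with hτ
    have hd : ∀ s ∈ Icc 0 τ, ∀ x, ‖hY T lam G Y s x - hY T lam G Y' s x‖ ≤ (L' * dist Y Y') * Real.exp (lam * s) := by
      intro s hs x
      refine (hL2 _ _ _ _).trans ?_
      rw [← smul_sub, norm_smul, Real.norm_of_nonneg (Real.exp_pos _).le, clamp_eq ⟨hs.1, hs.2.trans hm.2⟩,
        ← dist_eq_norm]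
      have := BoundedContinuousFunction.dist_coe_le_dist (f := Y) (g := Y') (s,x)
      calc _ ≤ L' * (Real.exp (lam * s) * dist Y Y') := by gcongr
        _ = _ := by ring
    have hw := hk (fun s x => hY T lam G Y s x - hY T lam G Y' s x) _ lam τ hl hm hd q.2
    have eU : yy ν φ (hY T lam G Y) τ q.2 - yy ν φ (hY T lam G Y') τ q.2 =
        UU ν (fun s x => hY T lam G Y s x - hY T lam G Y' s x) τ q.2 := by
      unfold yy UU
      rw [add_sub_add_left_eq_sub, ← smul_sub, DI_sub (gk0 E) (w := fun θ => θ) measurable_id hc hb hc' hb'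
        (fun θ hθ => by rw [abs_of_pos hθ.1]; exact hθ.2)]
    have eV : pp ν φ1 (hY T lam G Y) τ q.2 - pp ν φ1 (hY T lam G Y') τ q.2 =
        VV ν (fun s x => hY T lam G Y s x - hY T lam G Y' s x) τ q.2 := by
      unfold pp VV
      rw [add_sub_add_left_eq_sub, ← smul_sub, DI_sub gk1 measurable_const hc hb hc' hb'
        (fun θ hθ => by simp)]
    have eΦ : dist (Φ Y q) (Φ Y' q) = Real.exp (-(lam * τ)) *
        ‖(UU ν (fun s x => hY T lam G Y s x - hY T lam G Y' s x) τ q.2,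
          VV ν (fun s x => hY T lam G Y s x - hY T lam G Y' s x) τ q.2)‖ := by
      change dist (raw ν T lam φ φ1 (hY T lam G Y) q) (raw ν T lam φ φ1 (hY T lam G Y') q) = _
      unfold raw
      rw [dist_eq_norm, ← smul_sub, norm_smul, Real.norm_of_nonneg (Real.exp_pos _).le, Prod.mk_sub_mk, ← hτ, eU, eV]
    rw [eΦ, Prod.norm_def]
    calc _ ≤ Real.exp (-(lam * τ)) * (k * √(Real.pi / lam) * (L' * dist Y Y' * Real.exp (lam * τ))) := by
          gcongr
          exact max_le hw.1 hw.2
      _ = (k * L' * (2*k*L'+1)⁻¹) * dist Y Y' * (Real.exp (-(lam * τ)) * Real.exp (lam * τ)) := by rw [hsq]; ring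
      _ = (k * L' * (2*k*L'+1)⁻¹) * dist Y Y' := by rw [← Real.exp_add]; simp
      _ ≤ _ := by
          gcongr
          rw [← div_eq_mul_inv, div_le_iff₀ (by positivity)]
          norm_num
          nlinarith
  set Y := ContractingWith.fixedPoint Φ hΦ
  have hfix : Φ Y = Y := hΦ.fixedPoint_isFixedPt
  refine ⟨hY T lam G Y, hY_cont hG lam Y, fun s x => hB _ _ _, fun s x => ?_⟩
  have : Y (s,x) = raw ν T lam φ φ1 (hY T lam G Y) (s,x) := by
    conv_lhs => rw [← hfix]
    rfl
  conv_lhs => unfold hY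
  rw [this]
  unfold raw
  rw [smul_smul, ← Real.exp_add]
  simp

include hν hT hG hB h1 h2 hM hM1 hL h2c hM2 in
lemma semilinear (hLx : ∀ t x x' z, ‖G t x z - G t x' z‖ ≤ L * ‖x - x'‖) :
    ∃ h : ℝ → E → E, Continuous (fun p : ℝ × E => h p.1 p.2) ∧ (∀ s x, ‖h s x‖ ≤ B) ∧
    (∃ L', ∀ s x x', ‖h s x - h s x'‖ ≤ L' * √‖x - x'‖) ∧
    ∀ s ∈ Icc 0 T, ∀ x, h s x = G s x (yy ν φ h s x, pp ν φ1 h s x) := by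
  obtain ⟨h, hc, hb, he⟩ := mild_exists hν hT hG hB hL h1 h2 hM hM1
  refine ⟨h, hc, hb, ?_, fun s hs x => by conv_lhs => rw [he, clamp_eq hs]⟩
  obtain ⟨L3, hL30, hL3⟩ := VV_holder hν hc hb T
  have hB0 : 0 ≤ B := (norm_nonneg _).trans (hb 0 0)
  have hM0 : 0 ≤ M := (norm_nonneg _).trans (hM 0)
  set P := M + √(2*T/ν) * (B * ∫ z : E, ‖k1 z‖) with hP
  have hP0 : 0 ≤ P := (norm_nonneg _).trans (pp_bound hν hb hM1 (t := 0) ⟨le_rfl, hT.le⟩ 0)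
  set L' := max L 0 with hL'
  have hL0 : 0 ≤ L' := le_max_right _ _
  have hLL : L ≤ L' := le_max_left _ _
  refine ⟨2*B + L' * (1 + P + M + L3), fun s x x' => ?_⟩
  have hm := clamp_mem hT s
  set τ := clamp T s with hτ
  set r := ‖x - x'‖ with hr
  have hr0 : 0 ≤ r := norm_nonneg _
  have hs0 : 0 ≤ √r := Real.sqrt_nonneg _
  rcases le_or_gt 1 r with h1r | h1r
  · have : 1 ≤ √r := by rw [Real.one_le_sqrt]; exact h1r
    have i := norm_sub_le (h s x) (h s x')
    have i1 := hb s x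
    have i2 := hb s x'
    have : 0 ≤ L' * (1 + P + M + L3) * √r := by positivity
    nlinarith
  · have hrs : r ≤ √r := by
      refine Real.le_sqrt_of_sq_le ?_
      nlinarith
    have iy : ‖yy ν φ h τ x - yy ν φ h τ x'‖ ≤ P * r :=
      Convex.norm_image_sub_le_of_norm_hasFDerivWithin_le (𝕜 := ℝ) (s := univ)
        (fun y _ => (yy_deriv hν hc hb h1 h2 hM hM1 hm.1 y).hasFDerivWithinAt)
        (fun y _ => pp_bound hν hb hM1 hm y) convex_univ (mem_univ x') (mem_univ x)
    have ia : ‖cv (k0 (E →L[ℝ] E)) (cc ν τ) φ1 x - cv (k0 (E →L[ℝ] E)) (cc ν τ) φ1 x'‖ ≤ M * r :=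
      Convex.norm_image_sub_le_of_norm_hasFDerivWithin_le (𝕜 := ℝ) (s := univ)
        (fun y _ => (av_hasFDerivAt h2 h2c hM1 hM2 (cc ν τ) y).hasFDerivWithinAt)
        (fun y _ => cv_k0_norm_le hM2 _ y) convex_univ (mem_univ x') (mem_univ x)
    have ip : ‖pp ν φ1 h τ x - pp ν φ1 h τ x'‖ ≤ M * r + L3 * √r := by
      unfold pp
      rw [add_sub_add_comm]
      exact (norm_add_le _ _).trans (add_le_add ia (hL3 τ hm x x'))
    rw [he s x, he s x', ← hτ]
    have a1 := hLx s x x' (yy ν φ h τ x, pp ν φ1 h τ x)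
    have a2 := hL s x' (yy ν φ h τ x, pp ν φ1 h τ x) (yy ν φ h τ x', pp ν φ1 h τ x')
    have a3 : ‖(yy ν φ h τ x, pp ν φ1 h τ x) - (yy ν φ h τ x', pp ν φ1 h τ x')‖ ≤ (P + M + L3) * √r := by
      rw [Prod.mk_sub_mk, Prod.norm_def]
      refine max_le (iy.trans ?_) (ip.trans ?_)
      · have : 0 ≤ (M + L3) * √r := by positivity
        nlinarith
      · have : 0 ≤ P * √r := by positivity
        nlinarith
    calc _ ≤ ‖G s x (yy ν φ h τ x, pp ν φ1 h τ x) - G s x' (yy ν φ h τ x, pp ν φ1 h τ x)‖ +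
          ‖G s x' (yy ν φ h τ x, pp ν φ1 h τ x) - G s x' (yy ν φ h τ x', pp ν φ1 h τ x')‖ := norm_sub_le_norm_sub_add_norm_sub _ _ _
      _ ≤ L' * √r + L' * ((P + M + L3) * √r) := by
          refine add_le_add (a1.trans ?_) (a2.trans ?_)
          · gcongr
          · gcongr
      _ ≤ _ := by
          have : 0 ≤ 2*B*√r := by positivity
          nlinarith
end
end

-- part 7
noncomputable section
set_option maxSynthPendingDepth 3
variable {E : Type*} [NormedAddCommGroup E] [InnerProductSpace ℝ E] [FiniteDimensional ℝ E]
  [MeasurableSpace E] [BorelSpace E]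

lemma second_le {F F' : ℝ → ℝ} {c : ℝ} (h1 : ∀ r, HasDerivAt F (F' r) r) (h2 : HasDerivAt F' c 0)
    (hmax : ∀ r, F r ≤ F 0) : F' 0 = 0 ∧ c ≤ 0 := by
  have hm : IsLocalMax F 0 := Eventually.of_forall hmax
  have h0 : F' 0 = 0 := hm.hasDerivAt_eq_zero (h1 0)
  refine ⟨h0, ?_⟩
  by_contra! hc
  have e1 : deriv F = F' := funext fun r => (h1 r).deriv
  have hmin : IsLocalMin F 0 := isLocalMin_of_deriv_deriv_pos (by rw [e1, h2.deriv]; exact hc)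
    (by rw [e1, h0]) (h1 0).continuousAt
  have hev : F =ᶠ[𝓝 0] fun _ => F 0 := by
    filter_upwards [hmin] with r hr
    exact le_antisymm (hmax r) hr
  have := hev.deriv.deriv_eq
  rw [e1, h2.deriv] at this
  simp at this
  linarith

lemma time_ge {F : ℝ → ℝ} {c T t : ℝ} (ht : 0 < t) (htT : t ≤ T) (h : HasDerivWithinAt F c (Icc 0 T) t)
    (hmax : ∀ s ∈ Icc 0 T, F s ≤ F t) : 0 ≤ c := by
  have hm : IsLocalMaxOn F (Icc 0 T) t := by
    filter_upwards [self_mem_nhdsWithin] with s hs using hmax s hs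
  have := hm.hasFDerivWithinAt_nonpos h.hasFDerivWithinAt (y := 0 - t)
    (sub_mem_posTangentConeAt_of_segment_subset ((convex_Icc 0 T).segment_subset ⟨ht.le, htT⟩ ⟨le_rfl, ht.le.trans htT⟩))
  simp at this
  by_contra! hc
  nlinarith

lemma maxp {ι : Type*} [Fintype ι] (b : OrthonormalBasis ι ℝ E) {ν T A C M Y : ℝ} (hν : 0 < ν) (hC : 0 ≤ C)
    (hA0 : 0 ≤ A) {y w ff : ℝ → E → E} {p : ℝ → E → E →L[ℝ] E} {q : ℝ → E → E →L[ℝ] E →L[ℝ] E}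
    (hyc : Continuous fun p : ℝ × E => y p.1 p.2)
    (hp : ∀ t ∈ Icc 0 T, ∀ x, HasFDerivAt (y t) (p t x) x)
    (hq : ∀ t ∈ Icc 0 T, ∀ x, HasFDerivAt (p t) (q t x) x)
    (ht : ∀ t ∈ Icc 0 T, ∀ x, HasDerivWithinAt (fun s => y s x)
      (ν • (∑ j, q t x (b j) (b j)) + (- p t x (w t x) + ff t x)) (Icc 0 T) t)
    (hw : ∀ t ∈ Icc 0 T, ∀ x, ‖w t x‖ ≤ A)
    (hf : ∀ t ∈ Icc 0 T, ∀ x, inner ℝ (ff t x) (y t x) ≤ C * (1 + ‖y t x‖^2))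
    (h0 : ∀ x, ‖y 0 x‖ ≤ M) (hY : ∀ t ∈ Icc 0 T, ∀ x, ‖y t x‖ ≤ Y) :
    ∀ t ∈ Icc 0 T, ∀ x, Real.exp (-(2*C*t)) * (1 + ‖y t x‖^2) ≤ 1 + M^2 := by
  intro t1 ht1 x1
  by_contra! hcon
  have hT0 : 0 ≤ T := ht1.1.trans ht1.2
  set lam := 2*ν*Fintype.card ι + A + 1 with hlam
  have hl : 0 < lam := by positivity
  obtain ⟨ε, hε, hεc⟩ : ∃ ε > 0, 1 + M^2 + ε * (Real.exp (lam * t1) * (1 + ‖x1‖^2)) <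
      Real.exp (-(2*C*t1)) * (1 + ‖y t1 x1‖^2) := by
    set D := Real.exp (lam * t1) * (1 + ‖x1‖^2)
    have hD : 0 < D := by positivity
    set G := Real.exp (-(2*C*t1)) * (1 + ‖y t1 x1‖^2) - (1 + M^2)
    have hG : 0 < G := by linarith
    refine ⟨G / (2*D), by positivity, ?_⟩
    have : G / (2*D) * D = G/2 := by field_simp
    rw [this]
    linarith
  set Ψ : ℝ → E → ℝ := fun t x => Real.exp (-(2*C*t)) * (1 + ‖y t x‖^2) - ε * (Real.exp (lam * t) * (1 + ‖x‖^2)) with hΨ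
  have hΨc : Continuous fun p : ℝ × E => Ψ p.1 p.2 := by
    simp only [hΨ]
    fun_prop
  have hΨ1 : 1 + M^2 < Ψ t1 x1 := by simp only [hΨ]; linarith
  obtain ⟨ρ, hρ0, hρ⟩ : ∃ ρ : ℝ, ‖x1‖ ≤ ρ ∧ 1 + Y^2 ≤ ε * (1 + ρ^2) := by
    set S := (1+Y^2)/ε
    have hS : 0 ≤ S := by positivity
    refine ⟨‖x1‖ + S + 1, by linarith, ?_⟩
    have e : 1 + Y^2 = ε * S := by simp only [S]; field_simp
    rw [e]
    gcongr
    nlinarith [norm_nonneg x1]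
  have hout : ∀ t ∈ Icc 0 T, ∀ x, ρ < ‖x‖ → Ψ t x ≤ 0 := by
    intro t ht' x hx
    have e1 : Real.exp (-(2*C*t)) ≤ 1 := by
      rw [Real.exp_le_one_iff]
      have := mul_nonneg hC ht'.1
      linarith
    have e2 : 1 ≤ Real.exp (lam * t) := Real.one_le_exp (mul_nonneg hl.le ht'.1)
    have a1 : Real.exp (-(2*C*t)) * (1 + ‖y t x‖^2) ≤ 1 * (1 + Y^2) := by
      gcongr
      exact hY t ht' x
    have a2 : ε * (1 * (1 + ρ^2)) ≤ ε * (Real.exp (lam * t) * (1 + ‖x‖^2)) := by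
      have : 0 ≤ ρ := (norm_nonneg _).trans hρ0
      gcongr
    simp only [hΨ]
    linarith
  obtain ⟨⟨t0, x0⟩, hmem, hmx⟩ := (isCompact_Icc.prod (isCompact_closedBall (0:E) ρ)).exists_isMaxOn
    (s := Icc 0 T ×ˢ Metric.closedBall (0:E) ρ) ⟨(t1,x1), ht1, by simpa using hρ0⟩ hΨc.continuousOn
  have ht0 : t0 ∈ Icc 0 T := hmem.1
  have hval : Ψ t1 x1 ≤ Ψ t0 x0 := hmx (show (t1,x1) ∈ _ from ⟨ht1, by simpa using hρ0⟩)
  have hmax : ∀ t ∈ Icc 0 T, ∀ x, Ψ t x ≤ Ψ t0 x0 := by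
    intro t ht' x
    by_cases hx : ‖x‖ ≤ ρ
    · exact hmx (show (t,x) ∈ _ from ⟨ht', by simpa using hx⟩)
    · have := hout t ht' x (not_le.1 hx)
      nlinarith
  have ht0p : 0 < t0 := by
    rcases ht0.1.eq_or_lt with h | h
    · exfalso
      have : Ψ t0 x0 ≤ 1 + M^2 := by
        simp only [hΨ, ← h]
        have : 0 ≤ ε * (Real.exp (lam * 0) * (1 + ‖x0‖^2)) := by positivity
        have := pow_le_pow_left₀ (norm_nonneg _) (h0 x0) 2
        simp at *
        linarith
      linarith
    · exact h
  set a := Real.exp (-(2*C*t0)) with ha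
  have hapos : 0 < a := Real.exp_pos _
  set e := ε * Real.exp (lam * t0) with he
  have hepos : 0 < e := by positivity
  set yt := ν • (∑ j, q t0 x0 (b j) (b j)) + (- p t0 x0 (w t0 x0) + ff t0 x0) with hyt
  -- time
  have hD : 0 ≤ -(2*C) * a * (1 + ‖y t0 x0‖^2) + a * (2 * inner ℝ (y t0 x0) yt) - lam * e * (1 + ‖x0‖^2) := by
    refine time_ge (F := fun t => Ψ t x0) ht0p ht0.2 ?_ (fun s hs => hmax s hs x0)
    have d1 : HasDerivAt (fun t : ℝ => Real.exp (-(2*C*t))) (a * (-(2*C))) t0 := by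
      have := (((hasDerivAt_id t0).const_mul (2*C)).neg).exp
      simpa using this
    have d2 : HasDerivAt (fun t : ℝ => Real.exp (lam * t)) (Real.exp (lam * t0) * lam) t0 := by
      have := ((hasDerivAt_id t0).const_mul lam).exp
      simpa using this
    have d3 := (ht t0 ht0 x0).norm_sq
    have d4 := (d1.hasDerivWithinAt.mul (d3.const_add 1)).sub ((d2.hasDerivWithinAt (s := Icc 0 T)).mul_const (1 + ‖x0‖^2) |>.const_mul ε)
    refine d4.congr_deriv ?_
    simp only [he]
    ring
  -- space
  have hS : ∀ v : E, a * (2 * inner ℝ (y t0 x0) (p t0 x0 v)) - e * (2 * inner ℝ x0 v) = 0 ∧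
      a * (2 * (inner ℝ (p t0 x0 v) (p t0 x0 v) + inner ℝ (y t0 x0) (q t0 x0 v v))) - e * (2 * inner ℝ v v) ≤ 0 := by
    intro v
    have l : ∀ r : ℝ, HasDerivAt (fun r : ℝ => x0 + r • v) v r := fun r => by
      simpa using ((hasDerivAt_id r).smul_const v).const_add x0
    have d1 : ∀ r : ℝ, HasDerivAt (fun r : ℝ => y t0 (x0 + r • v)) (p t0 (x0 + r • v) v) r := fun r =>
      (hp t0 ht0 (x0 + r • v)).comp_hasDerivAt r (l r)
    have d2 : HasDerivAt (fun r : ℝ => p t0 (x0 + r • v) v) (q t0 x0 v v) 0 := by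
      have := (hq t0 ht0 (x0 + (0:ℝ) • v)).comp_hasDerivAt (0:ℝ) (l 0)
      have := this.clm_apply (hasDerivAt_const (0:ℝ) v)
      simpa using this
    have key := second_le (F := fun r : ℝ => Ψ t0 (x0 + r • v))
      (F' := fun r : ℝ => a * (2 * inner ℝ (y t0 (x0 + r • v)) (p t0 (x0 + r • v) v)) - e * (2 * inner ℝ (x0 + r • v) v))
      (c := a * (2 * (inner ℝ (p t0 x0 v) (p t0 x0 v) + inner ℝ (y t0 x0) (q t0 x0 v v))) - e * (2 * inner ℝ v v))
      (fun r => by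
        have := (((d1 r).norm_sq.const_add 1).const_mul a).sub ((((l r).norm_sq.const_add 1).const_mul (Real.exp (lam * t0))).const_mul ε)
        refine this.congr_deriv ?_
        simp only [he]
        ring)
      (by
        have := (((d1 0).inner ℝ d2).const_mul (2:ℝ) |>.const_mul a).sub ((((l 0).inner ℝ (hasDerivAt_const (0:ℝ) v)).const_mul (2:ℝ)).const_mul e)
        refine this.congr_deriv ?_
        simp
        left; ring)
      (fun r => by simpa using hmax t0 ht0 (x0 + r • v))
    simpa using key
  have hsum : ν * (a * (2 * inner ℝ (y t0 x0) (∑ j, q t0 x0 (b j) (b j)))) ≤ ν * (e * (2 * Fintype.card ι)) := by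
    gcongr ν * ?_
    rw [inner_sum, Finset.mul_sum, Finset.mul_sum]
    calc _ ≤ ∑ j : ι, e * 2 := by
          refine Finset.sum_le_sum fun j _ => ?_
          have := (hS (b j)).2
          have e1 : inner ℝ (b j) (b j) = (1:ℝ) := by simp
          rw [e1] at this
          have : 0 ≤ a * inner ℝ (p t0 x0 (b j)) (p t0 x0 (b j)) := mul_nonneg hapos.le real_inner_self_nonneg
          linarith
      _ = _ := by simp; ring
  have hgr := (hS (w t0 x0)).1
  have hff := hf t0 ht0 x0
  have hff' : a * inner ℝ (ff t0 x0) (y t0 x0) ≤ a * (C * (1 + ‖y t0 x0‖^2)) := by gcongr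
  have hxw : -(inner ℝ x0 (w t0 x0)) ≤ ‖x0‖ * A :=
    (neg_le_abs _).trans ((abs_real_inner_le_norm _ _).trans (by gcongr; exact hw t0 ht0 x0))
  have hxw' : e * -(inner ℝ x0 (w t0 x0)) ≤ e * (‖x0‖ * A) := by gcongr
  rw [hyt, inner_add_right, inner_add_right, inner_neg_right, real_inner_smul_right, real_inner_comm (ff t0 x0)] at hD
  have fin : 0 ≤ e * (2*ν*Fintype.card ι + 2*A*‖x0‖ - lam * (1 + ‖x0‖^2)) := by
    linarith
  have : 2*ν*Fintype.card ι + 2*A*‖x0‖ - lam * (1 + ‖x0‖^2) < 0 := by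
    rw [hlam]
    have h1 : 0 ≤ 2*ν*Fintype.card ι * ‖x0‖^2 := by positivity
    have h2 : 0 ≤ A * (‖x0‖ - 1)^2 := by positivity
    nlinarith [sq_nonneg ‖x0‖]
  nlinarith
end

-- part 8
noncomputable section
set_option maxSynthPendingDepth 3
variable {E : Type*} [NormedAddCommGroup E] [InnerProductSpace ℝ E] [FiniteDimensional ℝ E]
  [MeasurableSpace E] [BorelSpace E]

def rr {F : Type*} [NormedAddCommGroup F] [NormedSpace ℝ F] (K : ℝ) (p : F) : F := (K / max K ‖p‖) • p

section
variable {F : Type*} [NormedAddCommGroup F] [NormedSpace ℝ F] {K : ℝ} (hK : 0 < K)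
include hK
lemma rr_cont : Continuous (rr K : F → F) := by
  unfold rr
  refine (Continuous.div (by fun_prop) (by fun_prop) fun p => ?_).smul continuous_id
  have : K ≤ max K ‖p‖ := le_max_left _ _
  linarith

lemma rr_eq {p : F} (hp : ‖p‖ ≤ K) : rr K p = p := by
  unfold rr
  rw [max_eq_left hp, div_self hK.ne', one_smul]

lemma rr_norm (p : F) : ‖rr K p‖ ≤ K ∧ ‖rr K p‖ ≤ ‖p‖ := by
  unfold rr
  have h1 : K ≤ max K ‖p‖ := le_max_left _ _
  have h2 : ‖p‖ ≤ max K ‖p‖ := le_max_right _ _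
  have h3 : 0 < max K ‖p‖ := by linarith
  rw [norm_smul, Real.norm_of_nonneg (by positivity), div_mul_eq_mul_div, div_le_iff₀ h3, div_le_iff₀ h3]
  constructor
  · gcongr
  · rw [mul_comm]; gcongr

lemma rr_lip (p p' : F) : ‖rr K p - rr K p'‖ ≤ 2 * ‖p - p'‖ := by
  unfold rr
  set m := max K ‖p‖ with hm
  set m' := max K ‖p'‖ with hm'
  have h1 : K ≤ m := le_max_left _ _
  have h1' : K ≤ m' := le_max_left _ _
  have h3 : 0 < m := by linarith
  have h3' : 0 < m' := by linarith
  have h2 : ‖p'‖ ≤ m' := le_max_right _ _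
  have hmm : |m' - m| ≤ ‖p - p'‖ := by
    have := abs_max_sub_max_le_abs ‖p'‖ ‖p‖ K
    rw [max_comm _ K, max_comm _ K] at this
    rw [norm_sub_rev]
    exact this.trans (abs_norm_sub_norm_le _ _)
  have e : (K / m) • p - (K / m') • p' = (K/m) • (p - p') + (K/m - K/m') • p' := by
    rw [smul_sub, sub_smul]; abel
  have e2 : K/m - K/m' = (K/m) * ((m' - m)/m') := by field_simp
  have hKm : K / m ≤ 1 := by rw [div_le_one h3]; exact h1
  rw [e]
  refine (norm_add_le _ _).trans ?_
  rw [norm_smul, norm_smul, e2, norm_mul, Real.norm_of_nonneg (by positivity : 0 ≤ K/m), norm_div, Real.norm_eq_abs (m'-m), Real.norm_of_nonneg h3'.le]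
  calc _ ≤ 1 * ‖p - p'‖ + 1 * (‖p - p'‖ / m') * m' := by gcongr
    _ = _ := by field_simp; ring
end

section
variable {ν T : ℝ} (hν : 0 < ν) (hT : 0 < T) {f g : ℝ → E → E → E} {A : ℝ} (hA : 0 ≤ A)
  (hfc : Continuous fun q : ℝ × E × E => f q.1 q.2.1 q.2.2)
  (hgc : Continuous fun q : ℝ × E × E => g q.1 q.2.1 q.2.2)
  (hf0 : ∀ t x v, ‖f t x v‖ ≤ A) (hg0 : ∀ t x v, ‖g t x v‖ ≤ A)
  (hfx : ∀ t x x' v, ‖f t x v - f t x' v‖ ≤ A * ‖x - x'‖)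
  (hgx : ∀ t x x' v, ‖g t x v - g t x' v‖ ≤ A * ‖x - x'‖)
  (hfv : ∀ t x v v', ‖f t x v - f t x v'‖ ≤ A * ‖v - v'‖)
  (hgv : ∀ t x v v', ‖g t x v - g t x v'‖ ≤ A * ‖v - v'‖)
  {φ : E → E} {φ1 : E → E →L[ℝ] E} {φ2 : E → E →L[ℝ] E →L[ℝ] E}
  (h1 : ∀ x, HasFDerivAt φ (φ1 x) x) (h2 : ∀ x, HasFDerivAt φ1 (φ2 x) x) (h2c : Continuous φ2)
  {M : ℝ} (hM : ∀ x, ‖φ x‖ ≤ M) (hM1 : ∀ x, ‖φ1 x‖ ≤ M) (hM2 : ∀ x, ‖φ2 x‖ ≤ M)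

include hν hT hA hM1 in
lemma grad_bound : ∃ K > 0, ∀ h : ℝ → E → E, ∀ B, (∀ s x, ‖h s x‖ ≤ B) →
    (∀ s ∈ Icc 0 T, ∀ x, ‖h s x‖ ≤ A * ‖pp ν φ1 h s x‖ + A) → ∀ s ∈ Icc 0 T, ∀ x, ‖pp ν φ1 h s x‖ ≤ K := by
  obtain ⟨k, hk0, hk⟩ := UV_weight E hν T
  set lam := Real.pi * (2*k*A+1)^2 with hlam
  have hl : 0 < lam := by positivity
  have hsq : √(Real.pi / lam) = (2*k*A+1)⁻¹ := by
    rw [hlam]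
    have : Real.pi / (Real.pi * (2*k*A+1)^2) = ((2*k*A+1)⁻¹)^2 := by field_simp
    rw [this, Real.sqrt_sq (by positivity)]
  have hM0 : 0 ≤ M := (norm_nonneg _).trans (hM1 0)
  refine ⟨(2*M+1) * Real.exp (lam*T), by positivity, fun h B hB hh => ?_⟩
  set P : Icc 0 T × E → ℝ := fun q => Real.exp (-(lam * q.1)) * ‖pp ν φ1 h q.1 q.2‖ with hP
  have hbdd : BddAbove (range P) := by
    refine ⟨M + √(2*T/ν) * (B * ∫ z : E, ‖k1 z‖), ?_⟩
    rintro _ ⟨q, rfl⟩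
    have e1 : Real.exp (-(lam * q.1)) ≤ 1 := by
      rw [Real.exp_le_one_iff]
      have := mul_nonneg hl.le q.1.2.1
      linarith
    calc P q ≤ 1 * ‖pp ν φ1 h q.1 q.2‖ := by simp only [hP]; gcongr
      _ ≤ _ := by rw [one_mul]; exact pp_bound hν hB hM1 q.1.2 _
  set m := ⨆ q, P q with hm
  have hPm : ∀ s ∈ Icc 0 T, ∀ x, ‖pp ν φ1 h s x‖ ≤ m * Real.exp (lam * s) := by
    intro s hs x
    have := le_ciSup hbdd (⟨s,hs⟩, x)
    simp only [hP] at this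
    rw [Real.exp_neg, inv_mul_le_iff₀ (Real.exp_pos _)] at this
    rw [mul_comm]; exact this
  haveI : Nonempty (Icc 0 T × E) := ⟨(⟨0, le_rfl, hT.le⟩, 0)⟩
  have hm0 : 0 ≤ m := Real.iSup_nonneg fun q => by simp only [hP]; positivity
  have hmle : m ≤ M + (m+1)/2 := by
    refine ciSup_le fun q => ?_
    obtain ⟨⟨t, ht⟩, x⟩ := q
    simp only [hP]
    rw [Real.exp_neg, inv_mul_le_iff₀ (Real.exp_pos _)]
    have hw := (hk h (A*m+A) lam t hl ht (fun s hs x => by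
      have hs' : s ∈ Icc 0 T := ⟨hs.1, hs.2.trans ht.2⟩
      have i1 := hh s hs' x
      have i2 := hPm s hs' x
      have i3 : 1 ≤ Real.exp (lam * s) := Real.one_le_exp (mul_nonneg hl.le hs.1)
      calc _ ≤ A * (m * Real.exp (lam * s)) + A * Real.exp (lam * s) := by
            refine i1.trans (add_le_add (by gcongr) ?_)
            nlinarith
        _ = _ := by ring) x).2
    have e1 : 1 ≤ Real.exp (lam * t) := Real.one_le_exp (mul_nonneg hl.le ht.1)
    have e2 : k * √(Real.pi / lam) * (A*m+A) ≤ (m+1)/2 := by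
      rw [hsq, ← div_eq_mul_inv, div_mul_eq_mul_div, div_le_iff₀ (by positivity)]
      nlinarith
    have e3 : ‖pp ν φ1 h t x‖ ≤ M + ‖VV ν h t x‖ := by
      have : pp ν φ1 h t x = cv (k0 (E →L[ℝ] E)) (cc ν t) φ1 x + VV ν h t x := rfl
      rw [this]
      exact (norm_add_le _ _).trans (add_le_add (cv_k0_norm_le hM1 _ x) le_rfl)
    calc _ ≤ M + (k * √(Real.pi / lam) * (A*m+A)) * Real.exp (lam * t) := by
          refine e3.trans (add_le_add le_rfl (hw.trans (le_of_eq (by ring))))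
      _ ≤ Real.exp (lam * t) * M + ((m+1)/2) * Real.exp (lam * t) := by
          refine add_le_add ?_ (by gcongr)
          nlinarith
      _ = _ := by ring
  intro s hs x
  refine (hPm s hs x).trans ?_
  have : lam * s ≤ lam * T := by gcongr; exact hs.2
  gcongr
  linarith

include hν hT hA hfc hgc hf0 hg0 hfx hgx hfv hgv h1 h2 h2c hM hM1 hM2 in
lemma bounded_case : ∃ h : ℝ → E → E, Continuous (fun p : ℝ × E => h p.1 p.2) ∧ (∃ B, ∀ s x, ‖h s x‖ ≤ B) ∧
    (∃ L', ∀ s x x', ‖h s x - h s x'‖ ≤ L' * √‖x - x'‖) ∧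
    ∀ s ∈ Icc 0 T, ∀ x, h s x = - pp ν φ1 h s x (g s x (yy ν φ h s x)) + f s x (yy ν φ h s x) := by
  obtain ⟨K, hK, hKb⟩ := grad_bound (A := A) hν hT hA hM1
  set G : ℝ → E → E × (E →L[ℝ] E) → E := fun t x z => - (rr K z.2) (g t x z.1) + f t x z.1 with hG
  have hGc : Continuous fun q : ℝ × E × (E × (E →L[ℝ] E)) => G q.1 q.2.1 q.2.2 := by
    have c1 := hfc.comp (f := fun q : ℝ × E × (E × (E →L[ℝ] E)) => (q.1, q.2.1, q.2.2.1)) (by fun_prop)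
    have c2 := hgc.comp (f := fun q : ℝ × E × (E × (E →L[ℝ] E)) => (q.1, q.2.1, q.2.2.1)) (by fun_prop)
    have c3 := (rr_cont (F := E →L[ℝ] E) hK).comp (f := fun q : ℝ × E × (E × (E →L[ℝ] E)) => q.2.2.2) (by fun_prop)
    exact (c3.clm_apply c2).neg.add c1
  have hGB : ∀ t x z, ‖G t x z‖ ≤ K * A + A := fun t x z => by
    simp only [hG]
    refine (norm_add_le _ _).trans (add_le_add ?_ (hf0 _ _ _))
    rw [norm_neg]
    refine (ContinuousLinearMap.le_opNorm _ _).trans ?_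
    gcongr
    · exact (rr_norm hK _).1
    · exact hg0 _ _ _
  have hGL : ∀ t x z z', ‖G t x z - G t x z'‖ ≤ (K*A + 3*A) * ‖z - z'‖ := fun t x z z' => by
    have z1 : ‖z.1 - z'.1‖ ≤ ‖z - z'‖ := norm_fst_le (z - z')
    have z2 : ‖z.2 - z'.2‖ ≤ ‖z - z'‖ := norm_snd_le (z - z')
    have e : G t x z - G t x z' = -((rr K z.2) (g t x z.1 - g t x z'.1)) - (rr K z.2 - rr K z'.2) (g t x z'.1)
        + (f t x z.1 - f t x z'.1) := by
      simp only [hG, map_sub, _root_.sub_apply]; abel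
    rw [e]
    calc _ ≤ ‖(rr K z.2) (g t x z.1 - g t x z'.1)‖ + ‖(rr K z.2 - rr K z'.2) (g t x z'.1)‖ + ‖f t x z.1 - f t x z'.1‖ := by
          refine (norm_add_le _ _).trans (add_le_add ((norm_sub_le _ _).trans ?_) le_rfl)
          rw [norm_neg]
      _ ≤ K * (A * ‖z - z'‖) + (2 * ‖z - z'‖) * A + A * ‖z - z'‖ := by
          gcongr ?_ + ?_ + ?_
          · refine (ContinuousLinearMap.le_opNorm _ _).trans ?_
            gcongr
            · exact (rr_norm hK _).1
            · exact (hgv _ _ _ _).trans (by gcongr)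
          · refine (ContinuousLinearMap.le_opNorm _ _).trans ?_
            gcongr
            · exact (rr_lip hK _ _).trans (by gcongr)
            · exact hg0 _ _ _
          · exact (hfv _ _ _ _).trans (by gcongr)
      _ = _ := by ring
  have hGx : ∀ t x x' z, ‖G t x z - G t x' z‖ ≤ (K*A + 3*A) * ‖x - x'‖ := fun t x x' z => by
    have e : G t x z - G t x' z = -((rr K z.2) (g t x z.1 - g t x' z.1)) + (f t x z.1 - f t x' z.1) := by
      simp only [hG, map_sub]; abel
    rw [e]
    calc _ ≤ ‖(rr K z.2) (g t x z.1 - g t x' z.1)‖ + ‖f t x z.1 - f t x' z.1‖ := by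
          refine (norm_add_le _ _).trans (add_le_add ?_ le_rfl)
          rw [norm_neg]
      _ ≤ K * (A * ‖x - x'‖) + A * ‖x - x'‖ := by
          gcongr ?_ + ?_
          · refine (ContinuousLinearMap.le_opNorm _ _).trans ?_
            gcongr
            · exact (rr_norm hK _).1
            · exact hgx _ _ _ _
          · exact hfx _ _ _ _
      _ ≤ _ := by
          have : 0 ≤ A * ‖x - x'‖ := by positivity
          linarith
  obtain ⟨h, hc, hb, hH, he⟩ := semilinear hν hT hGc hGB hGL h1 h2 h2c hM hM1 hM2 hGx
  refine ⟨h, hc, ⟨_, hb⟩, hH, fun s hs x => ?_⟩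
  have := hKb h _ hb (fun s hs x => by
    rw [he s hs x]
    simp only [hG]
    refine (norm_add_le _ _).trans (add_le_add ?_ (hf0 _ _ _))
    rw [norm_neg, mul_comm]
    refine (ContinuousLinearMap.le_opNorm _ _).trans ?_
    gcongr
    · exact (rr_norm hK _).2
    · exact hg0 _ _ _) s hs x
  conv_lhs => rw [he s hs x]
  simp only [hG]
  rw [rr_eq hK this]
end
end

-- part 9
noncomputable section
set_option maxSynthPendingDepth 3
variable {E : Type*} [NormedAddCommGroup E] [InnerProductSpace ℝ E] [FiniteDimensional ℝ E]
  [MeasurableSpace E] [BorelSpace E]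

def tr (T R : ℝ) (f : ℝ → E → E → E) (t : ℝ) (x v : E) : E := f (clamp T t) x (rr R v)

lemma tr_cont {T R : ℝ} (hT : 0 < T) (hR : 0 < R) {f : ℝ → E → E → E}
    (hf : ContinuousOn (fun p : ℝ × E × E => f p.1 p.2.1 p.2.2) (Icc (0:ℝ) T ×ˢ (univ : Set (E × E)))) :
    Continuous fun q : ℝ × E × E => tr T R f q.1 q.2.1 q.2.2 := by
  have c1 := clamp_cont T
  have c2 : Continuous (rr R : E → E) := rr_cont hR
  exact hf.comp_continuous (f := fun q : ℝ × E × E => (clamp T q.1, q.2.1, rr R q.2.2)) (by fun_prop)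
    fun q => ⟨clamp_mem hT _, mem_univ _⟩

lemma tr_lip {T R A : ℝ} (hT : 0 < T) (hR : 0 < R) (hA : 0 ≤ A) {f : ℝ → E → E → E}
    (dx : ∀ t ∈ Icc (0:ℝ) T, ∀ x v, DifferentiableAt ℝ (fun x' => f t x' v) x)
    (dv : ∀ t ∈ Icc (0:ℝ) T, ∀ x v, DifferentiableAt ℝ (fun v' => f t x v') v)
    (hb : ∀ t ∈ Icc (0:ℝ) T, ∀ x v, ‖v‖ ≤ R →
      ‖f t x v‖ + ‖fderiv ℝ (fun x' => f t x' v) x‖ + ‖fderiv ℝ (fun v' => f t x v') v‖ ≤ A) :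
    (∀ t x v, ‖tr T R f t x v‖ ≤ A) ∧ (∀ t x x' v, ‖tr T R f t x v - tr T R f t x' v‖ ≤ A * ‖x - x'‖) ∧
    (∀ t x v v', ‖tr T R f t x v - tr T R f t x v'‖ ≤ (2*A) * ‖v - v'‖) := by
  refine ⟨fun t x v => ?_, fun t x x' v => ?_, fun t x v v' => ?_⟩
  · have := hb _ (clamp_mem hT t) x (rr R v) (rr_norm hR v).1
    unfold tr
    linarith [norm_nonneg (fderiv ℝ (fun x' => f (clamp T t) x' (rr R v)) x), norm_nonneg (fderiv ℝ (fun v' => f (clamp T t) x v') (rr R v))]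
  · refine Convex.norm_image_sub_le_of_norm_fderiv_le (𝕜 := ℝ) (f := fun x => tr T R f t x v) (s := univ) (fun z _ => dx _ (clamp_mem hT t) z _) (fun z _ => ?_)
      convex_univ (mem_univ _) (mem_univ _)
    have := hb _ (clamp_mem hT t) z (rr R v) (rr_norm hR v).1
    unfold tr
    linarith [norm_nonneg (f (clamp T t) z (rr R v)), norm_nonneg (fderiv ℝ (fun v' => f (clamp T t) z v') (rr R v))]
  · have := Convex.norm_image_sub_le_of_norm_fderiv_le (𝕜 := ℝ) (f := fun v => f (clamp T t) x v)
      (s := Metric.closedBall (0:E) R) (C := A) (fun z _ => dv _ (clamp_mem hT t) x z) (fun z hz => by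
        have := hb _ (clamp_mem hT t) x z (by simpa using hz)
        linarith [norm_nonneg (f (clamp T t) x z), norm_nonneg (fderiv ℝ (fun x' => f (clamp T t) x' z) x)])
      (convex_closedBall _ _) (x := rr R v') (y := rr R v) (by simpa using (rr_norm hR v').1) (by simpa using (rr_norm hR v).1)
    unfold tr
    refine this.trans ?_
    calc _ ≤ A * (2 * ‖v - v'‖) := by gcongr; exact rr_lip hR _ _
      _ = _ := by ring

lemma tr_inner {T R C : ℝ} (hT : 0 < T) (hR : 1 ≤ R) (hC : 0 ≤ C) {f : ℝ → E → E → E}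
    (hf : ∀ t ∈ Icc (0:ℝ) T, ∀ x v, (inner ℝ (f t x v) v : ℝ) ≤ C * (1 + ‖v‖ ^ 2)) (t : ℝ) (x v : E) :
    inner ℝ (tr T R f t x v) v ≤ C * (1 + ‖v‖^2) := by
  have hR0 : 0 < R := by linarith
  unfold tr
  rcases le_or_gt ‖v‖ R with h | h
  · rw [rr_eq hR0 h]; exact hf _ (clamp_mem hT t) _ _
  · have i := hf _ (clamp_mem hT t) x (rr R v)
    have e : rr R v = (R / ‖v‖) • v := by unfold rr; rw [max_eq_right h.le]
    set w := f (clamp T t) x (rr R v)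
    have hr : 0 < ‖v‖ := by linarith
    have n : ‖rr R v‖ = R := by
      rw [e, norm_smul, Real.norm_of_nonneg (by positivity)]; field_simp
    rw [n, e, real_inner_smul_right, div_mul_eq_mul_div, div_le_iff₀ hr] at i
    have : R * inner ℝ w v ≤ R * (C * (1 + ‖v‖^2)) := by
      refine i.trans ?_
      have : 0 ≤ C * ((‖v‖ - R) * (R * ‖v‖ - 1)) := by
        refine mul_nonneg hC (mul_nonneg (by linarith) ?_)
        nlinarith
      nlinarith
    exact le_of_mul_le_mul_left this hR0

lemma core {ι : Type*} [Fintype ι] (b : OrthonormalBasis ι ℝ E) {ν T C : ℝ} (hν : 0 < ν) (hT : 0 < T) (hC : 0 ≤ C)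
    {f g : ℝ → E → E → E}
    (hfc : ContinuousOn (fun p : ℝ × E × E => f p.1 p.2.1 p.2.2) (Icc (0:ℝ) T ×ˢ (univ : Set (E × E))))
    (hgc : ContinuousOn (fun p : ℝ × E × E => g p.1 p.2.1 p.2.2) (Icc (0:ℝ) T ×ˢ (univ : Set (E × E))))
    (fdx : ∀ t ∈ Icc (0:ℝ) T, ∀ x v, DifferentiableAt ℝ (fun x' => f t x' v) x)
    (fdv : ∀ t ∈ Icc (0:ℝ) T, ∀ x v, DifferentiableAt ℝ (fun v' => f t x v') v)
    (gdx : ∀ t ∈ Icc (0:ℝ) T, ∀ x v, DifferentiableAt ℝ (fun x' => g t x' v) x)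
    (gdv : ∀ t ∈ Icc (0:ℝ) T, ∀ x v, DifferentiableAt ℝ (fun v' => g t x v') v)
    (hb : ∀ R, 0 ≤ R → ∃ A, 0 ≤ A ∧ ∀ t ∈ Icc (0:ℝ) T, ∀ x v, ‖v‖ ≤ R →
      ‖f t x v‖ + ‖fderiv ℝ (fun x' => f t x' v) x‖ + ‖fderiv ℝ (fun v' => f t x v') v‖ ≤ A ∧
      ‖g t x v‖ + ‖fderiv ℝ (fun x' => g t x' v) x‖ + ‖fderiv ℝ (fun v' => g t x v') v‖ ≤ A)
    (hf : ∀ t ∈ Icc (0:ℝ) T, ∀ x v, (inner ℝ (f t x v) v : ℝ) ≤ C * (1 + ‖v‖ ^ 2))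
    {φ : E → E} {φ1 : E → E →L[ℝ] E} {φ2 : E → E →L[ℝ] E →L[ℝ] E}
    (h1 : ∀ x, HasFDerivAt φ (φ1 x) x) (h2 : ∀ x, HasFDerivAt φ1 (φ2 x) x) (h2c : Continuous φ2)
    {M : ℝ} (hM : ∀ x, ‖φ x‖ ≤ M) (hM1 : ∀ x, ‖φ1 x‖ ≤ M) (hM2 : ∀ x, ‖φ2 x‖ ≤ M) :
    ∃ (y : ℝ → E → E) (p : ℝ → E → E →L[ℝ] E) (q : ℝ → E → E →L[ℝ] E →L[ℝ] E) (K : ℝ),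
      (Continuous fun z : ℝ × E => y z.1 z.2) ∧ (Continuous fun z : ℝ × E => p z.1 z.2) ∧
      (Continuous fun z : ℝ × E => q z.1 z.2) ∧ (∀ x, y 0 x = φ x) ∧
      ∀ t ∈ Icc 0 T, ∀ x, HasFDerivAt (y t) (p t x) x ∧ HasFDerivAt (p t) (q t x) x ∧
        ‖y t x‖ ≤ K ∧ ‖p t x‖ ≤ K ∧ ‖q t x‖ ≤ K ∧ ‖- p t x (g t x (y t x)) + f t x (y t x)‖ ≤ K ∧
        HasDerivWithinAt (fun s => y s x)
          (ν • (∑ j, q t x (b j) (b j)) + (- p t x (g t x (y t x)) + f t x (y t x))) (Icc 0 T) t := by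
  have hM0 : 0 ≤ M := (norm_nonneg _).trans (hM 0)
  set R := √(Real.exp (2*C*T) * (1 + M^2)) with hR
  have hexp : 1 ≤ Real.exp (2*C*T) := Real.one_le_exp (by positivity)
  have hR1 : 1 ≤ R := by
    rw [hR, Real.one_le_sqrt]
    nlinarith [sq_nonneg M]
  have hR0 : 0 < R := by linarith
  obtain ⟨A, hA, hAb⟩ := hb R hR0.le
  obtain ⟨f0, fx, fv⟩ := tr_lip hT hR0 hA fdx fdv fun t ht x v hv => (hAb t ht x v hv).1
  obtain ⟨g0, gx, gv⟩ := tr_lip hT hR0 hA gdx gdv fun t ht x v hv => (hAb t ht x v hv).2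
  obtain ⟨h, hc, ⟨B, hB⟩, ⟨L, hL⟩, he⟩ := bounded_case (A := 2*A) hν hT (by linarith) (tr_cont hT hR0 hfc) (tr_cont hT hR0 hgc)
    (fun t x v => (f0 t x v).trans (by linarith)) (fun t x v => (g0 t x v).trans (by linarith))
    (fun t x x' v => (fx t x x' v).trans (by gcongr; linarith)) (fun t x x' v => (gx t x x' v).trans (by gcongr; linarith))
    fv gv h1 h2 h2c hM hM1 hM2
  have Dt : ∀ t ∈ Icc 0 T, ∀ x, _ := fun t ht x => yy_time_deriv hν hc hB h1 h2 h2c hM hM1 hM2 hL b ht x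
  have Dy : ∀ t ∈ Icc 0 T, ∀ x, _ := fun t ht x => yy_deriv hν hc hB h1 h2 hM hM1 (And.left ht) x
  have Dp : ∀ t ∈ Icc 0 T, ∀ x, _ := fun t ht x => pp_deriv hν hc hB h2 h2c hM1 hM2 hL (And.left ht) x
  have hyR : ∀ t ∈ Icc 0 T, ∀ x, ‖yy ν φ h t x‖ ≤ R := by
    intro t ht x
    have := maxp b (A := A) hν hC hA (y := yy ν φ h) (w := fun t x => tr T R g t x (yy ν φ h t x))
      (ff := fun t x => tr T R f t x (yy ν φ h t x)) (yy_cont hc hB h1 hM) Dy Dp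
      (fun t ht x => by rw [← he t ht x]; exact Dt t ht x) (fun t ht x => g0 _ _ _)
      (fun t ht x => tr_inner hT hR1 hC hf t x _) (M := M) (fun x => by rw [yy_zero]; exact hM x)
      (fun t ht x => yy_bound hB hM ht x) t ht x
    rw [hR]
    refine Real.le_sqrt_of_sq_le ?_
    rw [Real.exp_neg, inv_mul_le_iff₀ (Real.exp_pos _)] at this
    have : Real.exp (2*C*t) * (1 + M^2) ≤ Real.exp (2*C*T) * (1 + M^2) := by
      have := ht.2
      gcongr
    linarith
  have he2 : ∀ t ∈ Icc 0 T, ∀ x, h t x = - pp ν φ1 h t x (g t x (yy ν φ h t x)) + f t x (yy ν φ h t x) := by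
    intro t ht x
    have := he t ht x
    unfold tr at this
    rwa [rr_eq hR0 (hyR t ht x), clamp_eq ht] at this
  obtain ⟨Q, hQ⟩ := qq_bound hν hc hB hM2 hL T
  set P := M + √(2*T/ν) * (B * ∫ z : E, ‖k1 z‖)
  refine ⟨yy ν φ h, pp ν φ1 h, qq ν φ2 h, max (max R P) (max Q B), yy_cont hc hB h1 hM, pp_cont hc hB h2 hM1,
    qq_cont hν hc hB h2c hM2 hL, fun x => yy_zero x, fun t ht x => ⟨Dy t ht x, Dp t ht x, ?_, ?_, ?_, ?_, ?_⟩⟩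
  · exact (hyR t ht x).trans (by simp)
  · exact (pp_bound hν hB hM1 ht x).trans (by simp [P])
  · exact (hQ t ht.2 x).trans (by simp)
  · rw [← he2 t ht x]; exact (hB t x).trans (by simp)
  · rw [← he2 t ht x]; exact Dt t ht x
end

/-- Theorem 2.1: existence of a bounded classical `C^{1,2}_b` solution to the
Burgers-type equation `∂_t y = ν Δy − (g(t,x,y), ∂_x) y + f(t,x,y)`, `y(0,·) = φ`. -/
theorem burgers_type_existence
    {d : ℕ} (hd : 1 ≤ d) (ν T β : ℝ) (hν : 0 < ν) (hT : 0 < T) (hβ : β ∈ Ioo (0:ℝ) 1)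
    (φ : Ed d → Ed d) (hφ : IsC2BetaB β φ)
    (f g : ℝ → Ed d → Ed d → Ed d)
    (hfreg : ∃ ft, ContPartials T f ft) (hgreg : ∃ gt, ContPartials T g gt)
    (C : ℝ) (hC : 0 ≤ C)
    (hfC : ∀ t ∈ Icc (0:ℝ) T, ∀ x v, (inner ℝ (f t x v) v : ℝ) ≤ C * (1 + ‖v‖ ^ 2))
    (Λ₁ Λ₂ : ℝ → ℝ)
    (hΛ₁pos : ∀ r ∈ Ici (0:ℝ), 0 < Λ₁ r) (hΛ₁mono : MonotoneOn Λ₁ (Ici (0:ℝ)))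
    (hΛ₂pos : ∀ r ∈ Ici (0:ℝ), 0 < Λ₂ r) (hΛ₂mono : MonotoneOn Λ₂ (Ici (0:ℝ)))
    (hg1 : ∀ t ∈ Icc (0:ℝ) T, ∀ x v,
      ‖g t x v‖ + ‖fderiv ℝ (fun x' => g t x' v) x‖ + ‖fderiv ℝ (fun v' => g t x v') v‖
        ≤ Λ₁ ‖v‖)
    (hg2 : ∀ t ∈ Icc (0:ℝ) T, ∀ t' ∈ Icc (0:ℝ) T, ∀ x v,
      ‖g t x v - g t' x v‖ ≤ Λ₁ ‖v‖ * |t - t'| ^ (β / 2))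
    (hf1 : ∀ t ∈ Icc (0:ℝ) T, ∀ x v,
      ‖f t x v‖ + ‖fderiv ℝ (fun x' => f t x' v) x‖ + ‖fderiv ℝ (fun v' => f t x v') v‖
        ≤ Λ₂ ‖v‖)
    (hf2 : ∀ t ∈ Icc (0:ℝ) T, ∀ t' ∈ Icc (0:ℝ) T, ∀ x v,
      ‖f t x v - f t' x v‖ ≤ Λ₂ ‖v‖ * |t - t'| ^ (β / 2)) :
    ∃ y yt : ℝ → Ed d → Ed d, IsC12b T y yt ∧ (∀ x, y 0 x = φ x) ∧
      ∀ t ∈ Icc (0:ℝ) T, ∀ x,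
        yt t x = ν • lapl (y t) x - fderiv ℝ (y t) x (g t x (y t x)) + f t x (y t x) := by
  obtain ⟨ft, hft⟩ := hfreg
  obtain ⟨gt, hgt⟩ := hgreg
  obtain ⟨M, hM⟩ := hφ.bdd
  have c1 : ContDiff ℝ 1 (fderiv ℝ φ) := hφ.contDiff.fderiv_right (by norm_num)
  have h1 : ∀ x, HasFDerivAt φ (fderiv ℝ φ x) x := fun x =>
    (hφ.contDiff.differentiable (by norm_num) x).hasFDerivAt
  have h2 : ∀ x, HasFDerivAt (fderiv ℝ φ) (fderiv ℝ (fderiv ℝ φ) x) x := fun x =>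
    (c1.differentiable (by norm_num) x).hasFDerivAt
  have h2c : Continuous (fderiv ℝ (fderiv ℝ φ)) := c1.continuous_fderiv (by norm_num)
  obtain ⟨y, p, q, K, yc, pc, qc, y0, H⟩ := core (EuclideanSpace.basisFun (Fin d) ℝ) hν hT hC hft.cont hgt.cont
    hft.diffX hft.diffY hgt.diffX hgt.diffY
    (fun R hR => ⟨max (Λ₁ R) (Λ₂ R), (hΛ₁pos R hR).le.trans (le_max_left _ _), fun t ht x v hv =>
      ⟨(hf1 t ht x v).trans ((hΛ₂mono (norm_nonneg v) hR hv).trans (le_max_right _ _)),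
        (hg1 t ht x v).trans ((hΛ₁mono (norm_nonneg v) hR hv).trans (le_max_left _ _))⟩⟩)
    hfC h1 h2 h2c (fun x => (hM x).1) (fun x => (hM x).2.1) (fun x => (hM x).2.2)
  have e1 : ∀ t ∈ Icc (0:ℝ) T, fderiv ℝ (y t) = p t := fun t ht => funext fun x => (H t ht x).1.fderiv
  have e2 : ∀ t ∈ Icc (0:ℝ) T, fderiv ℝ (p t) = q t := fun t ht => funext fun x => (H t ht x).2.1.fderiv
  have el : ∀ t ∈ Icc (0:ℝ) T, ∀ x, lapl (y t) x =
      ∑ j, q t x (EuclideanSpace.basisFun (Fin d) ℝ j) (EuclideanSpace.basisFun (Fin d) ℝ j) := by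
    intro t ht x
    unfold lapl
    refine Finset.sum_congr rfl fun j _ => ?_
    rw [e1 t ht, EuclideanSpace.basisFun_apply]
    have := (H t ht x).2.1.clm_apply (hasFDerivAt_const (EuclideanSpace.single j (1:ℝ)) x)
    rw [this.fderiv]
    simp
  refine ⟨y, fun t x => ν • (∑ j, q t x (EuclideanSpace.basisFun (Fin d) ℝ j) (EuclideanSpace.basisFun (Fin d) ℝ j)) +
    (- p t x (g t x (y t x)) + f t x (y t x)), ⟨fun x t ht => (H t ht x).2.2.2.2.2.2, ?_, ?_, yc.continuousOn, ?_⟩, y0, ?_⟩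
  · have m : MapsTo (fun z : ℝ × Ed d => (z.1, z.2, y z.1 z.2)) (Icc (0:ℝ) T ×ˢ (univ : Set (Ed d)))
        (Icc (0:ℝ) T ×ˢ (univ : Set (Ed d × Ed d))) := fun z hz => ⟨hz.1, mem_univ _⟩
    have mc : Continuous (fun z : ℝ × Ed d => (z.1, z.2, y z.1 z.2)) :=
      continuous_fst.prodMk (continuous_snd.prodMk yc)
    have cf := hft.cont.comp mc.continuousOn m
    have cg := hgt.cont.comp mc.continuousOn m
    have cs : Continuous fun z : ℝ × Ed d => ν • (∑ j, q z.1 z.2 (EuclideanSpace.basisFun (Fin d) ℝ j) (EuclideanSpace.basisFun (Fin d) ℝ j)) :=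
      (continuous_finset_sum _ fun j _ => (qc.clm_apply continuous_const).clm_apply continuous_const).const_smul ν
    exact cs.continuousOn.add ((pc.continuousOn.clm_apply cg).neg.add cf)
  · intro t ht
    have cq : Continuous (q t) := qc.comp (continuous_const.prodMk continuous_id)
    have cp1 : ContDiff ℝ 1 (p t) := contDiff_one_iff_hasFDerivAt.2 ⟨q t, cq, fun x => (H t ht x).2.1⟩
    exact (contDiff_succ_iff_hasFDerivAt (n := 1)).2 ⟨p t, cp1, fun x => (H t ht x).1⟩
  · refine ⟨ν * (∑ j : Fin d, K) + K + K, fun t ht x => ?_⟩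
    obtain ⟨_, _, b1, b2, b3, b4, _⟩ := H t ht x
    have hK : 0 ≤ K := (norm_nonneg _).trans b1
    have hS : 0 ≤ ν * (∑ j : Fin d, K) := mul_nonneg hν.le (Finset.sum_nonneg fun _ _ => hK)
    refine ⟨by linarith, ?_, by rw [e1 t ht]; linarith, by rw [e1 t ht, e2 t ht]; linarith⟩
    have : ‖ν • (∑ j, q t x (EuclideanSpace.basisFun (Fin d) ℝ j) (EuclideanSpace.basisFun (Fin d) ℝ j))‖ ≤ ν * (∑ j : Fin d, K) := by
      rw [norm_smul, Real.norm_of_nonneg hν.le]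
      gcongr
      refine norm_sum_le_of_le _ fun j _ => ?_
      refine ((q t x _).le_opNorm _).trans ?_
      have n1 : ‖EuclideanSpace.basisFun (Fin d) ℝ j‖ = 1 := by simp
      rw [n1, mul_one]
      refine ((q t x).le_opNorm _).trans ?_
      rw [n1, mul_one]
      exact b3
    exact (norm_add_le _ _).trans (by linarith)
  · intro t ht x
    simp only
    rw [el t ht, e1 t ht]
    abel

end
end

section
/- (Uniqueness part of Theorem 3.1.) Let d ≥ 1, ν > 0, T > 0. Let η ∈ C^{0,2}_b([0,T] × ℝ^d; ℝ^d) with η(0,·) = 0, and let φ : ℝ^d → ℝ^d be bounded and continuous. Suppose y₁, y₂ : [0,T] × ℝ^d → ℝ^d are such that for i = 1, 2 the function y_i − η is continuous and bounded on [0,T] × ℝ^d, twice continuously differentiable in x on (0,T] × ℝ^d with bounded first and second spatial derivatives there, and y_i satisfies the integral equation y_i(t,x) = φ(x) + ∫_0^t [ν Δy_i(s,x) − (y_i(s,x), ∂_x) y_i(s,x)] ds + η(t,x) for all (t,x) ∈ [0,T] × ℝ^d. Then y₁ = y₂ on [0,T] × ℝ^d. -/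
open MeasureTheory Set Filter
open scoped Topology

noncomputable section

/-- `η ∈ C^{0,2}_b([0,T] × ℝ^d; ℝ^d)`: continuous on `[0,T] × ℝ^d`, twice continuously
differentiable in `x`, and bounded together with its first and second spatial derivatives. -/
structure IsC02b {d : ℕ} (T : ℝ) (η : ℝ → Ed d → Ed d) : Prop where
  cont : ContinuousOn (fun p : ℝ × Ed d => η p.1 p.2) (Icc (0:ℝ) T ×ˢ (univ : Set (Ed d)))
  contDiffX : ∀ t ∈ Icc (0:ℝ) T, ContDiff ℝ 2 (η t)
  bdd : ∃ M : ℝ, ∀ t ∈ Icc (0:ℝ) T, ∀ x, ‖η t x‖ ≤ M ∧ ‖fderiv ℝ (η t) x‖ ≤ M ∧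
    ‖fderiv ℝ (fderiv ℝ (η t)) x‖ ≤ M

/-- Regularity class of the uniqueness part of Theorem 3.1: `w = y − η` is continuous and
bounded on `[0,T] × ℝ^d`, twice continuously differentiable in `x` on `(0,T] × ℝ^d` with
bounded first and second spatial derivatives there. -/
structure RegClass {d : ℕ} (T : ℝ) (w : ℝ → Ed d → Ed d) : Prop where
  cont : ContinuousOn (fun p : ℝ × Ed d => w p.1 p.2) (Icc (0:ℝ) T ×ˢ (univ : Set (Ed d)))
  bdd : ∃ M : ℝ, ∀ t ∈ Icc (0:ℝ) T, ∀ x, ‖w t x‖ ≤ M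
  contDiffX : ∀ t ∈ Ioc (0:ℝ) T, ContDiff ℝ 2 (w t)
  bddDeriv : ∃ M : ℝ, ∀ t ∈ Ioc (0:ℝ) T, ∀ x,
    ‖fderiv ℝ (w t) x‖ ≤ M ∧ ‖fderiv ℝ (fderiv ℝ (w t)) x‖ ≤ M


lemma bu_meas_fd {d : ℕ} (Y : ℝ → Ed d → Ed d)
    (hm : Measurable (fun p : ℝ × Ed d => Y p.1 p.2))
    (hd : ∀ s, Differentiable ℝ (Y s)) (v : Ed d) :
    Measurable (fun p : ℝ × Ed d => fderiv ℝ (Y p.1) p.2 v) := by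
  refine measurable_of_tendsto_metrizable (f := fun (n : ℕ) (p : ℝ × Ed d) =>
    ((n : ℝ) + 1) • (Y p.1 (p.2 + (1 / ((n : ℝ) + 1)) • v) - Y p.1 p.2)) ?_ ?_
  · intro n
    have h1 : Measurable (fun p : ℝ × Ed d => (p.1, p.2 + (1 / ((n : ℝ) + 1)) • v)) := by fun_prop
    exact ((hm.comp h1).sub hm).const_smul ((n : ℝ) + 1)
  · rw [tendsto_pi_nhds]
    intro p
    have h := (hd p.1 p.2).hasFDerivAt.hasLineDerivAt v
    have h2 := h.tendsto_slope_zero_right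
    have h3 : Tendsto (fun n : ℕ => 1 / ((n : ℝ) + 1)) atTop (𝓝[>] 0) := by
      rw [tendsto_nhdsWithin_iff]
      exact ⟨tendsto_one_div_add_atTop_nhds_zero_nat, Eventually.of_forall fun n => by
        show (0:ℝ) < _; positivity⟩
    have h4 := h2.comp h3
    refine h4.congr fun n => ?_
    simp

/-- weight -/
def buRho (d : ℕ) (x : Ed d) : ℝ := ((1 + ‖x‖ ^ 2) ^ (d + 1))⁻¹

lemma buRho_pos (d : ℕ) (x : Ed d) : 0 < buRho d x := by unfold buRho; positivity

lemma buRho_contDiff (d : ℕ) : ContDiff ℝ 1 (buRho d) := by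
  unfold buRho
  refine ContDiff.inv ?_ fun x => by positivity
  exact (contDiff_const.add (contDiff_norm_sq ℝ)).pow _

lemma buRho_integrable (d : ℕ) : Integrable (buRho d) := by
  have h := integrable_rpow_neg_one_add_norm_sq (E := Ed d) (μ := volume) (r := 2 * ((d:ℝ) + 1))
    (by simp; linarith [(Nat.cast_nonneg d : (0:ℝ) ≤ d)])
  refine h.congr (Eventually.of_forall fun x => ?_)
  unfold buRho
  have : (0:ℝ) < 1 + ‖x‖ ^ 2 := by positivity
  simp only
  rw [show -(2 * ((d:ℝ) + 1)) / 2 = -((d + 1 : ℕ) : ℝ) by push_cast; ring,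
    Real.rpow_neg this.le, Real.rpow_natCast]

lemma buRho_fderiv (d : ℕ) (x v : Ed d) :
    |fderiv ℝ (buRho d) x v| ≤ ((d:ℝ) + 1) * buRho d x * ‖v‖ := by
  have hp : (0:ℝ) < 1 + ‖x‖ ^ 2 := by positivity
  have h0 : HasFDerivAt (fun x : Ed d => 1 + ‖x‖ ^ 2) (2 • innerSL ℝ x) x :=
    (hasStrictFDerivAt_norm_sq x).hasFDerivAt.const_add 1
  have h1 : HasDerivAt (fun r : ℝ => (r ^ (d + 1))⁻¹)
      (-(((d + 1 : ℕ) : ℝ) * (1 + ‖x‖ ^ 2) ^ d) / ((1 + ‖x‖ ^ 2) ^ (d + 1)) ^ 2) (1 + ‖x‖ ^ 2) := by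
    have := (hasDerivAt_pow (d + 1) (1 + ‖x‖ ^ 2)).inv (by positivity)
    convert! this using 1
  have h2 := HasDerivAt.comp_hasFDerivAt (h₂ := fun r : ℝ => (r ^ (d + 1))⁻¹) x h1 h0
  have e0 : ((fun r : ℝ => (r ^ (d + 1))⁻¹) ∘ fun x : Ed d => 1 + ‖x‖ ^ 2) = buRho d := rfl
  rw [e0] at h2
  rw [h2.fderiv]
  have hi : |inner ℝ x v| ≤ ‖x‖ * ‖v‖ := abs_real_inner_le_norm x v
  have e : (-(((d + 1 : ℕ) : ℝ) * (1 + ‖x‖ ^ 2) ^ d) / ((1 + ‖x‖ ^ 2) ^ (d + 1)) ^ 2)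
      = -((d:ℝ) + 1) * buRho d x * (1 + ‖x‖ ^ 2)⁻¹ := by
    unfold buRho; push_cast; field_simp; ring
  rw [e]
  simp only [_root_.smul_apply, innerSL_apply_apply, smul_eq_mul, nsmul_eq_mul]
  have hr := buRho_pos d x
  rw [abs_mul, abs_mul, abs_mul, abs_neg, abs_of_pos hr, abs_of_pos (by positivity : (0:ℝ) < d + 1),
    abs_of_pos (inv_pos.2 hp), mul_assoc, mul_assoc, mul_assoc]
  gcongr
  rw [inv_mul_le_iff₀ hp, abs_mul]
  simp only [Nat.cast_ofNat, Nat.abs_ofNat]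
  nlinarith [norm_nonneg x, norm_nonneg v, sq_nonneg (‖x‖ - 1), mul_nonneg (norm_nonneg v) (sq_nonneg (‖x‖ - 1))]

lemma bu_normsq {E : Type*} [NormedAddCommGroup E] [InnerProductSpace ℝ E] [CompleteSpace E]
    (g : ℝ → E) (B t : ℝ) (hg : AEStronglyMeasurable g volume) (hB : ∀ s, ‖g s‖ ≤ B)
    : ‖∫ s in (0:ℝ)..t, g s‖ ^ 2
      = ∫ s in (0:ℝ)..t, 2 * inner ℝ (∫ r in (0:ℝ)..s, g r) (g s) := by
  have hB0 : 0 ≤ B := (norm_nonneg _).trans (hB 0)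
  have hii : ∀ a b, IntervalIntegrable g volume a b := fun a b =>
    (intervalIntegrable_const (c := B)).mono_fun hg.restrict
      (Eventually.of_forall fun s => (hB s).trans (le_abs_self B))
  have hlip : LipschitzWith B.toNNReal (fun s => ‖∫ r in (0:ℝ)..s, g r‖) := by
    refine LipschitzWith.of_dist_le_mul fun a b => ?_
    rw [Real.coe_toNNReal _ hB0, Real.dist_eq]
    refine (abs_norm_sub_norm_le _ _).trans ?_
    rw [intervalIntegral.integral_interval_sub_left (hii _ _) (hii _ _), Real.dist_eq]
    exact intervalIntegral.norm_integral_le_of_norm_le_const fun s _ => hB s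
  have hac := (hlip.lipschitzOnWith (s := uIcc 0 t)).absolutelyContinuousOnInterval
  have h := (hac.fun_mul hac).integral_deriv_eq_sub
  simp only [intervalIntegral.integral_same, norm_zero, ← pow_two] at h
  rw [zero_pow two_ne_zero, sub_zero] at h
  rw [← h]
  refine intervalIntegral.integral_congr_ae ?_
  filter_upwards [(hii 0 t).ae_hasDerivAt_integral] with s hs hst
  exact ((hs (uIoc_subset_uIcc hst) 0 left_mem_uIcc).norm_sq).deriv

lemma bu_gronwall (T C M : ℝ) (hC : 0 ≤ C) (e : ℝ → ℝ)
    (hM : ∀ t ∈ Ioc (0:ℝ) T, e t ≤ M)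
    (hint : ∀ t ∈ Ioc (0:ℝ) T, IntervalIntegrable e volume 0 t)
    (h : ∀ t ∈ Ioc (0:ℝ) T, e t ≤ C * ∫ s in (0:ℝ)..t, e s) :
    ∀ t ∈ Ioc (0:ℝ) T, e t ≤ 0 := by
  have key : ∀ n : ℕ, ∀ t ∈ Ioc (0:ℝ) T, e t ≤ M * ((C * t) ^ n / (n.factorial : ℝ)) := by
    intro n
    induction n with
    | zero => intro t ht; simpa using hM t ht
    | succ n ih =>
      intro t ht
      refine (h t ht).trans ?_
      have h1 : ∫ s in (0:ℝ)..t, e s ≤ ∫ s in (0:ℝ)..t, M * ((C * s) ^ n / (n.factorial : ℝ)) := by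
        refine intervalIntegral.integral_mono_on_of_le_Ioo ht.1.le (hint t ht)
          (Continuous.intervalIntegrable (by fun_prop) _ _) fun s hs => ?_
        exact ih s ⟨hs.1, hs.2.le.trans ht.2⟩
      refine (mul_le_mul_of_nonneg_left h1 hC).trans (le_of_eq ?_)
      rw [intervalIntegral.integral_const_mul, intervalIntegral.integral_div]
      simp_rw [mul_pow]
      rw [intervalIntegral.integral_const_mul, integral_pow, Nat.factorial_succ]
      have : (n.factorial : ℝ) ≠ 0 := by positivity
      have h2 : (n : ℝ) + 1 ≠ 0 := by positivity
      push_cast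
      field_simp
      ring
  intro t ht
  have hl := (FloorSemiring.tendsto_pow_div_factorial_atTop (C * t)).const_mul M
  rw [mul_zero] at hl
  exact ge_of_tendsto' hl fun n => key n t ht

lemma bu_int_fderiv {d : ℕ} (F : Ed d → ℝ) (v : Ed d) (hF : Differentiable ℝ F)
    (hi : Integrable F) (hi' : Integrable (fun x => fderiv ℝ F x v)) :
    ∫ x, fderiv ℝ F x v = 0 := by
  have := integral_mul_fderiv_eq_neg_fderiv_mul_of_integrable (μ := (volume : Measure (Ed d)))
    (f := fun _ : Ed d => (1:ℝ)) (g := F) (v := v)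
    (by simp) (by simpa using hi') (by simpa using hi)
    (fun x _ => differentiableAt_const _) (fun x _ => hF x)
  simpa using this

lemma bu_alg (ν K A ρ r zp nz np a zq : ℝ) (hν : 0 < ν) (hρ : 0 < ρ)
    (hA : 0 ≤ A) (hK : 0 ≤ K)
    (hz : 0 ≤ nz) (hp : 0 ≤ np) (hzp : |zp| ≤ nz * np) (hr : |r| ≤ K * ρ) (ha : |a| ≤ A) :
    ρ * (ν * zq - a * zp) ≤ ν * (r * zp + ρ * (np ^ 2 + zq))
      + ρ * ((ν * K ^ 2 / 2 + A ^ 2 / (2 * ν)) * nz ^ 2) := by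
  have h1 : |r * zp| ≤ K * ρ * (nz * np) := by rw [abs_mul]; gcongr
  have h2 : |a * zp| ≤ A * (nz * np) := by rw [abs_mul]; gcongr
  have h3 := (abs_le.1 h1).1
  have h4 := (abs_le.1 h2).1
  have h5 : A * (nz * np) ≤ ν / 2 * np ^ 2 + A ^ 2 / (2 * ν) * nz ^ 2 := by
    have : ν / 2 * np ^ 2 + A ^ 2 / (2 * ν) * nz ^ 2 - A * (nz * np)
      = (ν * np - A * nz) ^ 2 / (2 * ν) := by field_simp; ring
    have h6 : 0 ≤ (ν * np - A * nz) ^ 2 / (2 * ν) := by positivity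
    linarith
  have h7 : K * (nz * np) ≤ np ^ 2 / 2 + K ^ 2 / 2 * nz ^ 2 := by nlinarith [sq_nonneg (np - K * nz)]
  have h8 := mul_le_mul_of_nonneg_left h7 (mul_pos hν hρ).le
  have h9 := mul_le_mul_of_nonneg_left h3 hν.le
  have h10 := mul_le_mul_of_nonneg_left (h4.trans' (neg_le_neg h5)) hρ.le
  nlinarith

lemma bu_apply_sum {d : ℕ} (L : Ed d →L[ℝ] Ed d) (a : Ed d) :
    L a = ∑ j, a j • L (EuclideanSpace.single j (1:ℝ)) := by
  conv_lhs => rw [← (EuclideanSpace.basisFun (Fin d) ℝ).sum_repr a]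
  simp [map_sum]

lemma bu_energy {d : ℕ} (ν A B : ℝ) (hν : 0 < ν) (hA : 0 ≤ A) (z a : Ed d → Ed d)
    (L : Ed d → Ed d →L[ℝ] Ed d) (hz : ContDiff ℝ 2 z)
    (hb0 : ∀ x, ‖z x‖ ≤ B) (hb1 : ∀ x, ‖fderiv ℝ z x‖ ≤ B)
    (hb2 : ∀ x, ‖fderiv ℝ (fderiv ℝ z) x‖ ≤ B)
    (ha : ∀ x, ‖a x‖ ≤ A) (hL : ∀ x, ‖L x‖ ≤ A)
    (hi : Integrable (fun x => buRho d x *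
      inner ℝ (z x) (ν • lapl z x - fderiv ℝ z x (a x) - L x (z x)))) :
    ∫ x, buRho d x * inner ℝ (z x) (ν • lapl z x - fderiv ℝ z x (a x) - L x (z x)) ≤
      (d * (ν * ((d:ℝ) + 1) ^ 2 / 2 + A ^ 2 / (2 * ν)) + A) * ∫ x, buRho d x * ‖z x‖ ^ 2 := by
  have hB : 0 ≤ B := (norm_nonneg _).trans (hb0 0)
  have hne : ∀ j : Fin d, ‖(EuclideanSpace.single j (1:ℝ) : Ed d)‖ = 1 := fun j => by simp
  set p : Fin d → Ed d → Ed d := fun j x => fderiv ℝ z x (EuclideanSpace.single j (1:ℝ)) with hp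
  have hdz : ContDiff ℝ 1 (fderiv ℝ z) := hz.fderiv_right (by norm_num)
  have hpc : ∀ j, ContDiff ℝ 1 (p j) := fun j => hdz.clm_apply contDiff_const
  set q : Fin d → Ed d → Ed d :=
    fun j x => fderiv ℝ (p j) x (EuclideanSpace.single j (1:ℝ)) with hq
  have hlap : ∀ x, lapl z x = ∑ j, q j x := fun x => rfl
  have hpb : ∀ j x, ‖p j x‖ ≤ B := fun j x => by
    have := (fderiv ℝ z x).le_opNorm (EuclideanSpace.single j (1:ℝ))
    rw [hne, mul_one] at this
    exact this.trans (hb1 x)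
  have hqb : ∀ j x, ‖q j x‖ ≤ B := fun j x => by
    have h1 : HasFDerivAt (p j) _ x :=
      ((hdz.differentiable (by norm_num) x).hasFDerivAt).clm_apply
        (hasFDerivAt_const (EuclideanSpace.single j (1:ℝ)) x)
    have h2 : q j x = fderiv ℝ (fderiv ℝ z) x (EuclideanSpace.single j (1:ℝ))
        (EuclideanSpace.single j (1:ℝ)) := by
      simp only [hq]; rw [h1.fderiv]; simp
    rw [h2]
    have h3 := (fderiv ℝ (fderiv ℝ z) x).le_opNorm (EuclideanSpace.single j (1:ℝ))
    have h4 := (fderiv ℝ (fderiv ℝ z) x (EuclideanSpace.single j (1:ℝ))).le_opNorm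
      (EuclideanSpace.single j (1:ℝ))
    rw [hne, mul_one] at h3 h4
    exact h4.trans (h3.trans (hb2 x))
  set F : Fin d → Ed d → ℝ := fun j x => buRho d x * inner ℝ (z x) (p j x) with hF
  have hz1 : ContDiff ℝ 1 z := hz.of_le (by norm_num)
  have hFc : ∀ j, ContDiff ℝ 1 (F j) := fun j => (buRho_contDiff d).mul (hz1.inner ℝ (hpc j))
  have hFd : ∀ j x, fderiv ℝ (F j) x (EuclideanSpace.single j (1:ℝ)) =
      fderiv ℝ (buRho d) x (EuclideanSpace.single j (1:ℝ)) * inner ℝ (z x) (p j x)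
      + buRho d x * (‖p j x‖ ^ 2 + inner ℝ (z x) (q j x)) := by
    intro j x
    have h1 := ((buRho_contDiff d).differentiable (by norm_num) x).hasFDerivAt
    have h2 := (hz1.differentiable (by norm_num) x).hasFDerivAt
    have h3 := ((hpc j).differentiable (by norm_num) x).hasFDerivAt
    have h4 : HasFDerivAt (F j) _ x := h1.mul (h2.inner ℝ h3)
    rw [h4.fderiv]
    simp only [_root_.add_apply, _root_.smul_apply,
      ContinuousLinearMap.comp_apply, ContinuousLinearMap.prod_apply, fderivInnerCLM_apply,
      smul_eq_mul]
    rw [← real_inner_self_eq_norm_sq]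
    simp only [hp, hq]
    ring
  have hin : ∀ j x, |inner ℝ (z x) (p j x)| ≤ ‖z x‖ * ‖p j x‖ := fun j x =>
    abs_real_inner_le_norm _ _
  have hrd : ∀ (j : Fin d) x, |fderiv ℝ (buRho d) x (EuclideanSpace.single j (1:ℝ))|
      ≤ ((d:ℝ) + 1) * buRho d x := fun j x => by
    have := buRho_fderiv d x (EuclideanSpace.single j (1:ℝ))
    rwa [hne, mul_one] at this
  have hFi : ∀ j, Integrable (F j) := fun j => by
    refine ((buRho_integrable d).mul_const (B * B)).mono'
      (hFc j).continuous.aestronglyMeasurable (Eventually.of_forall fun x => ?_)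
    rw [Real.norm_eq_abs, abs_mul, abs_of_pos (buRho_pos d x)]
    have := buRho_pos d x
    gcongr
    exact (hin j x).trans (mul_le_mul (hb0 x) (hpb j x) (norm_nonneg _) hB)
  have hFi' : ∀ j, Integrable (fun x => fderiv ℝ (F j) x (EuclideanSpace.single j (1:ℝ))) :=
    fun j => by
    refine ((buRho_integrable d).mul_const (((d:ℝ) + 1) * (B * B) + (B ^ 2 + B * B))).mono'
      (((hFc j).continuous_fderiv (by norm_num)).clm_apply continuous_const).aestronglyMeasurable
      (Eventually.of_forall fun x => ?_)
    have hr := buRho_pos d x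
    rw [Real.norm_eq_abs, hFd]
    refine (abs_add_le _ _).trans ?_
    rw [abs_mul, abs_mul, abs_of_pos hr]
    have e1 : |inner ℝ (z x) (p j x)| ≤ B * B :=
      (hin j x).trans (mul_le_mul (hb0 x) (hpb j x) (norm_nonneg _) hB)
    have e2 : |‖p j x‖ ^ 2 + inner ℝ (z x) (q j x)| ≤ B ^ 2 + B * B := by
      refine (abs_add_le _ _).trans (add_le_add ?_ ?_)
      · rw [abs_of_nonneg (by positivity)]
        have := hpb j x
        gcongr
      · exact (abs_real_inner_le_norm _ _).trans
          (mul_le_mul (hb0 x) (hqb j x) (norm_nonneg _) hB)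
    have e3 := mul_le_mul (hrd j x) e1 (abs_nonneg _) (by positivity)
    have e4 := mul_le_mul_of_nonneg_left e2 hr.le
    linarith
  have hzi : Integrable (fun x => buRho d x * ‖z x‖ ^ 2) := by
    refine ((buRho_integrable d).mul_const (B ^ 2)).mono'
      ((buRho_contDiff d).continuous.mul (hz.continuous.norm.pow 2)).aestronglyMeasurable
      (Eventually.of_forall fun x => ?_)
    have hr := buRho_pos d x
    rw [Real.norm_eq_abs, abs_of_nonneg (by positivity)]
    have := hb0 x
    gcongr
  have hpt : ∀ x, buRho d x * inner ℝ (z x) (ν • lapl z x - fderiv ℝ z x (a x) - L x (z x)) ≤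
      ν * ∑ j, fderiv ℝ (F j) x (EuclideanSpace.single j (1:ℝ)) +
      (d * (ν * ((d:ℝ) + 1) ^ 2 / 2 + A ^ 2 / (2 * ν)) + A) * (buRho d x * ‖z x‖ ^ 2) := by
    intro x
    have hr := buRho_pos d x
    have e1 : inner ℝ (z x) (ν • lapl z x - fderiv ℝ z x (a x) - L x (z x)) =
        ∑ j, (ν * inner ℝ (z x) (q j x) - a x j * inner ℝ (z x) (p j x))
          - inner ℝ (z x) (L x (z x)) := by
      rw [hlap, bu_apply_sum (fderiv ℝ z x) (a x), inner_sub_right, inner_sub_right,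
        inner_smul_right, inner_sum, inner_sum, Finset.sum_sub_distrib, Finset.mul_sum]
      simp only [inner_smul_right, hp]
    have e2 : -inner ℝ (z x) (L x (z x)) ≤ A * ‖z x‖ ^ 2 := by
      have h1 : ‖L x (z x)‖ ≤ A * ‖z x‖ := (L x).le_of_opNorm_le (hL x) _
      have h2 := (abs_le.1 (abs_real_inner_le_norm (z x) (L x (z x)))).1
      have h3 := mul_le_mul_of_nonneg_left h1 (norm_nonneg (z x))
      nlinarith
    have e3 : ∑ j, buRho d x * (ν * inner ℝ (z x) (q j x) - a x j * inner ℝ (z x) (p j x)) ≤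
        ∑ j, (ν * fderiv ℝ (F j) x (EuclideanSpace.single j (1:ℝ)) +
          buRho d x * ((ν * ((d:ℝ) + 1) ^ 2 / 2 + A ^ 2 / (2 * ν)) * ‖z x‖ ^ 2)) := by
      refine Finset.sum_le_sum fun j _ => ?_
      rw [hFd]
      refine bu_alg ν (d + 1) A _ _ _ _ _ _ _ hν hr hA (by positivity) (norm_nonneg _)
        (norm_nonneg _) (hin j x) (hrd j x) ?_
      have := PiLp.norm_apply_le (a x) j
      exact (this.trans (ha x))
    rw [e1, mul_sub]
    rw [Finset.sum_add_distrib, ← Finset.mul_sum, ← Finset.mul_sum, Finset.sum_const, Finset.card_univ,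
      Fintype.card_fin, nsmul_eq_mul] at e3
    have e4 := mul_le_mul_of_nonneg_left e2 hr.le
    nlinarith
  have hSi : Integrable (fun x => ν * ∑ j, fderiv ℝ (F j) x (EuclideanSpace.single j (1:ℝ))) :=
    (integrable_finsetSum _ fun j _ => hFi' j).const_mul ν
  refine (integral_mono hi (hSi.add (hzi.const_mul _)) hpt).trans (le_of_eq ?_)
  simp only [Pi.add_apply]
  rw [integral_add hSi (hzi.const_mul _), integral_const_mul, integral_const_mul,
    integral_finsetSum _ fun j _ => hFi' j]
  rw [Finset.sum_eq_zero fun j _ => bu_int_fderiv (F j) _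
    ((hFc j).differentiable (by norm_num)) (hFi j) (hFi' j)]
  ring

/-- right-hand side -/
def buG {d : ℕ} (ν : ℝ) (u : Ed d → Ed d) (x : Ed d) : Ed d :=
  ν • lapl u x - fderiv ℝ u x (u x)

lemma bu_second {d : ℕ} (u : Ed d → Ed d) (hu : ContDiff ℝ 2 u) (x v : Ed d) :
    HasFDerivAt (fun z => fderiv ℝ u z v)
      ((ContinuousLinearMap.apply ℝ (Ed d) v).comp (fderiv ℝ (fderiv ℝ u) x)) x := by
  have hdz : ContDiff ℝ 1 (fderiv ℝ u) := hu.fderiv_right (by norm_num)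
  exact (ContinuousLinearMap.apply ℝ (Ed d) v).hasFDerivAt.comp x
    (hdz.differentiable (by norm_num) x).hasFDerivAt

lemma bu_lapl_eq {d : ℕ} (u : Ed d → Ed d) (hu : ContDiff ℝ 2 u) (x : Ed d) :
    lapl u x = ∑ j : Fin d, fderiv ℝ (fderiv ℝ u) x (EuclideanSpace.single j (1:ℝ))
      (EuclideanSpace.single j (1:ℝ)) := by
  unfold lapl
  refine Finset.sum_congr rfl fun j _ => ?_
  rw [(bu_second u hu x _).fderiv]
  simp

lemma bu_lapl_bound {d : ℕ} (u : Ed d → Ed d) (hu : ContDiff ℝ 2 u) (A : ℝ) (x : Ed d)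
    (hA : ‖fderiv ℝ (fderiv ℝ u) x‖ ≤ A) : ‖lapl u x‖ ≤ d * A := by
  rw [bu_lapl_eq u hu x]
  refine (norm_sum_le_of_le (f := _) _ (n := fun _ => A) fun j _ => ?_).trans (by simp)
  have h3 := (fderiv ℝ (fderiv ℝ u) x).le_opNorm (EuclideanSpace.single j (1:ℝ))
  have h4 := (fderiv ℝ (fderiv ℝ u) x (EuclideanSpace.single j (1:ℝ))).le_opNorm
    (EuclideanSpace.single j (1:ℝ))
  rw [show ‖(EuclideanSpace.single j (1:ℝ) : Ed d)‖ = 1 by simp, mul_one] at h3 h4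
  exact h4.trans (h3.trans hA)

lemma bu_fd_sub {d : ℕ} (u v : Ed d → Ed d) (hu : ContDiff ℝ 2 u) (hv : ContDiff ℝ 2 v) :
    fderiv ℝ (fun x => u x - v x) = fun x => fderiv ℝ u x - fderiv ℝ v x := by
  funext x
  exact fderiv_fun_sub (hu.differentiable (by norm_num) x) (hv.differentiable (by norm_num) x)

lemma bu_fd2_sub {d : ℕ} (u v : Ed d → Ed d) (hu : ContDiff ℝ 2 u) (hv : ContDiff ℝ 2 v)
    (x : Ed d) :
    fderiv ℝ (fderiv ℝ (fun x => u x - v x)) x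
      = fderiv ℝ (fderiv ℝ u) x - fderiv ℝ (fderiv ℝ v) x := by
  rw [bu_fd_sub u v hu hv]
  have h1 : ContDiff ℝ 1 (fderiv ℝ u) := hu.fderiv_right (by norm_num)
  have h2 : ContDiff ℝ 1 (fderiv ℝ v) := hv.fderiv_right (by norm_num)
  exact fderiv_fun_sub (h1.differentiable (by norm_num) x) (h2.differentiable (by norm_num) x)

lemma buG_sub {d : ℕ} (ν : ℝ) (u v : Ed d → Ed d) (hu : ContDiff ℝ 2 u) (hv : ContDiff ℝ 2 v)
    (x : Ed d) : buG ν u x - buG ν v x = ν • lapl (fun x => u x - v x) x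
      - fderiv ℝ (fun x => u x - v x) x (u x) - fderiv ℝ v x (u x - v x) := by
  rw [bu_lapl_eq _ (hu.sub hv), bu_fd2_sub u v hu hv, bu_fd_sub u v hu hv]
  unfold buG
  rw [bu_lapl_eq u hu, bu_lapl_eq v hv]
  simp only [_root_.sub_apply, Finset.sum_sub_distrib, smul_sub, map_sub]
  abel

lemma buG_bound {d : ℕ} (ν A : ℝ) (hν : 0 < ν) (hA : 0 ≤ A) (u : Ed d → Ed d)
    (hu : ContDiff ℝ 2 u) (x : Ed d)
    (h0 : ‖u x‖ ≤ A) (h1 : ‖fderiv ℝ u x‖ ≤ A) (h2 : ‖fderiv ℝ (fderiv ℝ u) x‖ ≤ A) :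
    ‖buG ν u x‖ ≤ ν * (d * A) + A * A := by
  unfold buG
  refine (norm_sub_le _ _).trans (add_le_add ?_ ?_)
  · rw [norm_smul, Real.norm_of_nonneg hν.le]
    have := bu_lapl_bound u hu A x h2
    gcongr
  · exact (ContinuousLinearMap.le_opNorm _ _).trans (mul_le_mul h1 h0 (norm_nonneg _) hA)

lemma buG_meas {d : ℕ} (ν : ℝ) (Y : ℝ → Ed d → Ed d)
    (hm : Measurable (fun p : ℝ × Ed d => Y p.1 p.2)) (hc : ∀ s, ContDiff ℝ 2 (Y s)) :
    Measurable (fun p : ℝ × Ed d => buG ν (Y p.1) p.2) := by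
  have h1 : ∀ v, Measurable (fun p : ℝ × Ed d => fderiv ℝ (Y p.1) p.2 v) :=
    bu_meas_fd Y hm fun s => (hc s).differentiable (by norm_num)
  have h2 : ∀ v w, Measurable
      (fun p : ℝ × Ed d => fderiv ℝ (fun z => fderiv ℝ (Y p.1) z v) p.2 w) := fun v w =>
    bu_meas_fd (fun s z => fderiv ℝ (Y s) z v) (h1 v)
      (fun s x => (bu_second (Y s) (hc s) x v).differentiableAt) w
  unfold buG lapl
  refine Measurable.sub (Measurable.const_smul (Finset.measurable_fun_sum _ fun j _ => h2 _ _) ν) ?_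
  have h3 : (fun p : ℝ × Ed d => fderiv ℝ (Y p.1) p.2 (Y p.1 p.2)) =
    fun p => ∑ j, (Y p.1 p.2) j • fderiv ℝ (Y p.1) p.2 (EuclideanSpace.single j (1:ℝ)) := by
    funext p
    exact bu_apply_sum _ _
  rw [h3]
  refine Finset.measurable_fun_sum _ fun j _ => ?_
  have h4 : Measurable (fun p : ℝ × Ed d => (Y p.1 p.2) j) := by fun_prop
  exact h4.smul (h1 _)

lemma bu_core {d : ℕ} (ν T A : ℝ) (hν : 0 < ν) (hA : 0 ≤ A) (Y₁ Y₂ : ℝ → Ed d → Ed d)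
    (hm₁ : Measurable (fun p : ℝ × Ed d => Y₁ p.1 p.2))
    (hm₂ : Measurable (fun p : ℝ × Ed d => Y₂ p.1 p.2))
    (hc₁ : ∀ s, ContDiff ℝ 2 (Y₁ s)) (hc₂ : ∀ s, ContDiff ℝ 2 (Y₂ s))
    (hb₁ : ∀ s x, ‖Y₁ s x‖ ≤ A ∧ ‖fderiv ℝ (Y₁ s) x‖ ≤ A ∧ ‖fderiv ℝ (fderiv ℝ (Y₁ s)) x‖ ≤ A)
    (hb₂ : ∀ s x, ‖Y₂ s x‖ ≤ A ∧ ‖fderiv ℝ (Y₂ s) x‖ ≤ A ∧ ‖fderiv ℝ (fderiv ℝ (Y₂ s)) x‖ ≤ A)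
    (heq : ∀ t ∈ Ioc (0:ℝ) T, ∀ x, Y₁ t x - Y₂ t x
      = ∫ s in (0:ℝ)..t, (buG ν (Y₁ s) x - buG ν (Y₂ s) x)) :
    ∀ t ∈ Ioc (0:ℝ) T, ∀ x, Y₁ t x = Y₂ t x := by
  set z : ℝ → Ed d → Ed d := fun s x => Y₁ s x - Y₂ s x with hz
  set G : ℝ → Ed d → Ed d := fun s x => buG ν (Y₁ s) x - buG ν (Y₂ s) x with hG
  have hzm : Measurable (fun p : ℝ × Ed d => z p.1 p.2) := hm₁.sub hm₂
  have hGm : Measurable (fun p : ℝ × Ed d => G p.1 p.2) :=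
    (buG_meas ν Y₁ hm₁ hc₁).sub (buG_meas ν Y₂ hm₂ hc₂)
  set B : ℝ := (ν * (d * A) + A * A) + (ν * (d * A) + A * A) with hB
  have hB0 : 0 ≤ B := by positivity
  have hGb : ∀ s x, ‖G s x‖ ≤ B := fun s x => (norm_sub_le _ _).trans (add_le_add
    (buG_bound ν A hν hA _ (hc₁ s) x (hb₁ s x).1 (hb₁ s x).2.1 (hb₁ s x).2.2)
    (buG_bound ν A hν hA _ (hc₂ s) x (hb₂ s x).1 (hb₂ s x).2.1 (hb₂ s x).2.2))
  have hzc : ∀ s, ContDiff ℝ 2 (z s) := fun s => (hc₁ s).sub (hc₂ s)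
  have hz0 : ∀ s x, ‖z s x‖ ≤ A + A := fun s x =>
    (norm_sub_le _ _).trans (add_le_add (hb₁ s x).1 (hb₂ s x).1)
  have hz1 : ∀ s x, ‖fderiv ℝ (z s) x‖ ≤ A + A := fun s x => by
    have : fderiv ℝ (z s) x = _ := congrFun (bu_fd_sub (Y₁ s) (Y₂ s) (hc₁ s) (hc₂ s)) x
    rw [this]
    exact (norm_sub_le _ _).trans (add_le_add (hb₁ s x).2.1 (hb₂ s x).2.1)
  have hz2 : ∀ s x, ‖fderiv ℝ (fderiv ℝ (z s)) x‖ ≤ A + A := fun s x => by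
    have : fderiv ℝ (fderiv ℝ (z s)) x = _ := bu_fd2_sub (Y₁ s) (Y₂ s) (hc₁ s) (hc₂ s) x
    rw [this]
    refine (norm_sub_le (fderiv ℝ (fderiv ℝ (Y₁ s)) x) (fderiv ℝ (fderiv ℝ (Y₂ s)) x)).trans ?_
    exact add_le_add (hb₁ s x).2.2 (hb₂ s x).2.2
  have hρm : Measurable (buRho d) := (buRho_contDiff d).continuous.measurable
  set H : ℝ → Ed d → ℝ := fun s x => buRho d x * inner ℝ (z s x) (G s x) with hH
  have hHm : Measurable (fun p : ℝ × Ed d => H p.1 p.2) :=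
    (hρm.comp measurable_snd).mul (hzm.inner hGm)
  have hHb : ∀ s x, ‖H s x‖ ≤ buRho d x * ((A + A) * B) := fun s x => by
    have hr := buRho_pos d x
    rw [hH, Real.norm_eq_abs, abs_mul, abs_of_pos hr]
    gcongr
    exact (abs_real_inner_le_norm _ _).trans
      (mul_le_mul (hz0 s x) (hGb s x) (norm_nonneg _) (by positivity))
  set N : ℝ → Ed d → ℝ := fun s x => buRho d x * ‖z s x‖ ^ 2 with hN
  have hNm : Measurable (fun p : ℝ × Ed d => N p.1 p.2) :=
    (hρm.comp measurable_snd).mul (hzm.norm.pow_const 2)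
  have hNb : ∀ s x, ‖N s x‖ ≤ buRho d x * (A + A) ^ 2 := fun s x => by
    have hr := buRho_pos d x
    have h1 := hz0 s x
    have h2 : ‖z s x‖ ^ 2 ≤ (A + A) ^ 2 := pow_le_pow_left₀ (norm_nonneg _) h1 2
    show |buRho d x * ‖z s x‖ ^ 2| ≤ _
    rw [abs_of_nonneg (by positivity)]
    exact mul_le_mul_of_nonneg_left h2 hr.le
  have hprod : ∀ (t : ℝ) (K : ℝ → Ed d → ℝ) (c : ℝ),
      Measurable (fun p : ℝ × Ed d => K p.1 p.2) → (∀ s x, ‖K s x‖ ≤ buRho d x * c) →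
      Integrable (Function.uncurry K) ((volume.restrict (Ioc 0 t)).prod volume) := by
    intro t K c hKm hKb
    have h1 : Integrable (fun p : ℝ × Ed d => buRho d p.2 * c)
        ((volume.restrict (Ioc 0 t)).prod volume) :=
      ((buRho_integrable d).mul_const c).comp_snd _
    exact h1.mono' hKm.aestronglyMeasurable (Eventually.of_forall fun p => hKb p.1 p.2)
  have hsec : ∀ (s : ℝ) (K : ℝ → Ed d → ℝ) (c : ℝ),
      Measurable (fun p : ℝ × Ed d => K p.1 p.2) → (∀ s x, ‖K s x‖ ≤ buRho d x * c) →
      Integrable (K s) := by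
    intro s K c hKm hKb
    exact ((buRho_integrable d).mul_const c).mono'
      (hKm.comp measurable_prodMk_left).aestronglyMeasurable (Eventually.of_forall (hKb s))
  set C : ℝ := d * (ν * ((d:ℝ) + 1) ^ 2 / 2 + A ^ 2 / (2 * ν)) + A with hC
  have hC0 : 0 ≤ C := by positivity
  set e : ℝ → ℝ := fun t => ∫ x, N t x with he
  have hen : ∀ s, ∫ x, H s x ≤ C * e s := by
    intro s
    have hGs : ∀ x, G s x = _ := fun x => buG_sub ν (Y₁ s) (Y₂ s) (hc₁ s) (hc₂ s) x
    have h1 := hsec s H _ hHm hHb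
    have h2 := bu_energy ν A (A + A) hν hA (z s) (Y₁ s) (fun x => fderiv ℝ (Y₂ s) x) (hzc s)
      (hz0 s) (hz1 s) (hz2 s) (fun x => (hb₁ s x).1) (fun x => (hb₂ s x).2.1)
      (by
        refine h1.congr (Eventually.of_forall fun x => ?_)
        simp only [hH]
        rw [hGs x])
    refine le_trans (le_of_eq ?_) h2
    refine integral_congr_ae (Eventually.of_forall fun x => ?_)
    simp only [hH]
    rw [hGs x]
  have hei : ∀ t, IntegrableOn e (Ioc 0 t) := fun t =>
    (hprod t N _ hNm hNb).integral_prod_left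
  have hNt : ∀ t ∈ Ioc (0:ℝ) T, ∀ x, N t x = ∫ s in Ioc 0 t, 2 * H s x := by
    intro t ht x
    have h1 := bu_normsq (fun s => G s x) B t
      (hGm.comp measurable_prodMk_right).aestronglyMeasurable (fun s => hGb s x)
    rw [← heq t ht x, intervalIntegral.integral_of_le ht.1.le] at h1
    simp only [hN]
    rw [show z t x = Y₁ t x - Y₂ t x from rfl, h1, ← integral_const_mul]
    refine setIntegral_congr_fun measurableSet_Ioc fun s hs => ?_
    simp only [hH]
    rw [← heq s ⟨hs.1, hs.2.trans ht.2⟩ x]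
    ring
  have hmain : ∀ t ∈ Ioc (0:ℝ) T, e t ≤ (2 * C) * ∫ s in (0:ℝ)..t, e s := by
    intro t ht
    have h1 : e t = ∫ x, ∫ s in Ioc 0 t, 2 * H s x :=
      integral_congr_ae (Eventually.of_forall fun x => hNt t ht x)
    have hp : Integrable (Function.uncurry fun s x => 2 * H s x)
        ((volume.restrict (Ioc 0 t)).prod (volume : Measure (Ed d))) :=
      (hprod t H _ hHm hHb).const_mul 2
    rw [h1, ← integral_integral_swap hp, intervalIntegral.integral_of_le ht.1.le,
      ← integral_const_mul]
    refine integral_mono hp.integral_prod_left ((hei t).const_mul _) fun s => ?_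
    simp only
    rw [integral_const_mul]
    have := hen s
    linarith
  have hfin := bu_gronwall T (2 * C) (∫ x, buRho d x * (A + A) ^ 2) (by positivity) e
    (fun t _ => integral_mono (hsec t N _ hNm hNb) ((buRho_integrable d).mul_const _)
      fun x => (le_abs_self _).trans (hNb t x))
    (fun t ht => (intervalIntegrable_iff_integrableOn_Ioc_of_le ht.1.le).2 (hei t)) hmain
  intro t ht x
  have hN0 : ∀ x, 0 ≤ N t x := fun x => mul_nonneg (buRho_pos d x).le (by positivity)
  have h0 : ∫ x, N t x = 0 := le_antisymm (hfin t ht) (integral_nonneg hN0)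
  have h1 := (integral_eq_zero_iff_of_nonneg hN0 (hsec t N _ hNm hNb)).1 h0
  have hNc : Continuous (N t) :=
    (buRho_contDiff d).continuous.mul ((hzc t).continuous.norm.pow 2)
  have h2 : N t = 0 := (hNc.ae_eq_iff_eq volume continuous_zero).1 h1
  have h3 : buRho d x * ‖z t x‖ ^ 2 = 0 := congrFun h2 x
  have h4 : ‖z t x‖ ^ 2 = 0 := (mul_eq_zero.1 h3).resolve_left (buRho_pos d x).ne'
  have h5 : z t x = 0 := by simpa using h4
  exact sub_eq_zero.1 h5

/-- cutoff in time -/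
def buCut {d : ℕ} (T : ℝ) (y : ℝ → Ed d → Ed d) (s : ℝ) : Ed d → Ed d :=
  open Classical in if s ∈ Ioc (0:ℝ) T then y s else fun _ => 0

lemma buCut_in {d : ℕ} {T : ℝ} (y : ℝ → Ed d → Ed d) {s : ℝ} (hs : s ∈ Ioc (0:ℝ) T) :
    buCut T y s = y s := by simp only [buCut, if_pos hs]

lemma buCut_out {d : ℕ} {T : ℝ} (y : ℝ → Ed d → Ed d) {s : ℝ} (hs : s ∉ Ioc (0:ℝ) T) :
    buCut T y s = fun _ => 0 := by simp only [buCut, if_neg hs]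

lemma bu_prep {d : ℕ} (T : ℝ) (hT : 0 < T) (η y : ℝ → Ed d → Ed d) (hη : IsC02b T η)
    (hreg : RegClass T (fun t x => y t x - η t x)) :
    Measurable (fun p : ℝ × Ed d => buCut T y p.1 p.2) ∧ (∀ s, ContDiff ℝ 2 (buCut T y s)) ∧
    ∃ A, 0 ≤ A ∧ ∀ s x, ‖buCut T y s x‖ ≤ A ∧ ‖fderiv ℝ (buCut T y s) x‖ ≤ A ∧
      ‖fderiv ℝ (fderiv ℝ (buCut T y s)) x‖ ≤ A := by
  have hyc : ∀ s ∈ Ioc (0:ℝ) T, ContDiff ℝ 2 (y s) := fun s hs => by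
    have := (hreg.contDiffX s hs).add (hη.contDiffX s ⟨hs.1.le, hs.2⟩)
    simpa using this
  refine ⟨?_, ?_, ?_⟩
  · have hc : ContinuousOn (fun p : ℝ × Ed d => y p.1 p.2) (Ioc (0:ℝ) T ×ˢ univ) := by
      have := (hreg.cont.add hη.cont).mono (prod_mono Ioc_subset_Icc_self Subset.rfl)
      refine this.congr fun p _ => ?_
      simp
    have hms : MeasurableSet (Ioc (0:ℝ) T ×ˢ (univ : Set (Ed d))) :=
      measurableSet_Ioc.prod MeasurableSet.univ
    have := (ContinuousOn.measurable_piecewise (g := fun _ : ℝ × Ed d => (0 : Ed d)) hc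
      continuousOn_const hms)
    convert! this using 1
    funext p
    by_cases hp : p.1 ∈ Ioc (0:ℝ) T
    · rw [buCut_in y hp, Set.piecewise_eq_of_mem _ _ _ (by exact ⟨hp, trivial⟩)]
    · rw [buCut_out y hp, Set.piecewise_eq_of_notMem _ _ _ (fun h => hp h.1)]
  · intro s
    by_cases hs : s ∈ Ioc (0:ℝ) T
    · rw [buCut_in y hs]; exact hyc s hs
    · rw [buCut_out y hs]; exact contDiff_const
  · obtain ⟨M₀, h0⟩ := hη.bdd
    obtain ⟨M₁, h1⟩ := hreg.bdd
    obtain ⟨M₂, h2⟩ := hreg.bddDeriv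
    have hTm : T ∈ Ioc (0:ℝ) T := ⟨hT, le_rfl⟩
    have hTc : T ∈ Icc (0:ℝ) T := ⟨hT.le, le_rfl⟩
    have p0 : 0 ≤ M₀ := (norm_nonneg _).trans (h0 T hTc 0).1
    have p1 : 0 ≤ M₁ := (norm_nonneg _).trans (h1 T hTc 0)
    have p2 : 0 ≤ M₂ := (norm_nonneg _).trans (h2 T hTm 0).1
    refine ⟨M₀ + M₁ + M₂, by positivity, fun s x => ?_⟩
    by_cases hs : s ∈ Ioc (0:ℝ) T
    · have hs' : s ∈ Icc (0:ℝ) T := ⟨hs.1.le, hs.2⟩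
      rw [buCut_in y hs]
      have a0 := h0 s hs' x
      have a1 := h1 s hs' x
      have a2 := h2 s hs x
      have e1 : fderiv ℝ (fun x => y s x - η s x) x = _ :=
        congrFun (bu_fd_sub _ _ (hyc s hs) (hη.contDiffX s hs')) x
      have e2 := bu_fd2_sub _ _ (hyc s hs) (hη.contDiffX s hs') x
      rw [e2, e1] at a2
      have b0 := norm_le_norm_add_norm_sub' (y s x) (η s x)
      have b1 := norm_le_norm_add_norm_sub' (fderiv ℝ (y s) x) (fderiv ℝ (η s) x)
      have b2 := norm_le_norm_add_norm_sub' (fderiv ℝ (fderiv ℝ (y s)) x)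
        (fderiv ℝ (fderiv ℝ (η s)) x)
      refine ⟨?_, ?_, ?_⟩ <;> linarith [a0.1, a0.2.1, a0.2.2, a2.1, a2.2]
    · rw [buCut_out y hs]
      have hf : fderiv ℝ (fun _ : Ed d => (0 : Ed d)) = fun _ => 0 := by
        funext x; simp
      have hf2 : fderiv ℝ (fun _ : Ed d => (0 : Ed d →L[ℝ] Ed d)) = fun _ => 0 := by
        funext x; simp
      rw [hf, hf2]
      have hs0 : 0 ≤ M₀ + M₁ + M₂ := by positivity
      refine ⟨?_, ?_, ?_⟩ <;> (beta_reduce; first | (rw [norm_zero]; exact hs0) | (rw [ContinuousLinearMap.opNorm_zero]; exact hs0))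

/-- Uniqueness part of Theorem 3.1: two solutions of the stochastic Burgers integral
equation `y(t,x) = φ(x) + ∫_0^t [ν Δy − (y,∂_x)y](s,x) ds + η(t,x)` in the natural
regularity class coincide on `[0,T] × ℝ^d`. -/
theorem stochastic_burgers_uniqueness
    {d : ℕ} (hd : 1 ≤ d) (ν T : ℝ) (hν : 0 < ν) (hT : 0 < T)
    (η : ℝ → Ed d → Ed d) (hη : IsC02b T η) (hη0 : ∀ x, η 0 x = 0)
    (φ : Ed d → Ed d) (hφc : Continuous φ) (hφb : ∃ M : ℝ, ∀ x, ‖φ x‖ ≤ M)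
    (y₁ y₂ : ℝ → Ed d → Ed d)
    (hreg₁ : RegClass T (fun t x => y₁ t x - η t x))
    (hreg₂ : RegClass T (fun t x => y₂ t x - η t x))
    (heq₁ : ∀ t ∈ Icc (0:ℝ) T, ∀ x,
      y₁ t x = φ x +
        (∫ s in (0:ℝ)..t, (ν • lapl (y₁ s) x - fderiv ℝ (y₁ s) x (y₁ s x))) + η t x)
    (heq₂ : ∀ t ∈ Icc (0:ℝ) T, ∀ x,
      y₂ t x = φ x +
        (∫ s in (0:ℝ)..t, (ν • lapl (y₂ s) x - fderiv ℝ (y₂ s) x (y₂ s x))) + η t x) :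
    ∀ t ∈ Icc (0:ℝ) T, ∀ x, y₁ t x = y₂ t x := by
  obtain ⟨hm₁, hc₁, A₁, hA₁, hb₁⟩ := bu_prep T hT η y₁ hη hreg₁
  obtain ⟨hm₂, hc₂, A₂, hA₂, hb₂⟩ := bu_prep T hT η y₂ hη hreg₂
  have hii : ∀ (Y : ℝ → Ed d → Ed d) (A : ℝ) (_ : 0 ≤ A)
      (_ : Measurable (fun p : ℝ × Ed d => Y p.1 p.2)) (_ : ∀ s, ContDiff ℝ 2 (Y s))
      (_ : ∀ s x, ‖Y s x‖ ≤ A ∧ ‖fderiv ℝ (Y s) x‖ ≤ A ∧ ‖fderiv ℝ (fderiv ℝ (Y s)) x‖ ≤ A)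
      (t : ℝ) (x : Ed d), IntervalIntegrable (fun s => buG ν (Y s) x) volume 0 t := by
    intro Y A hA hm hc hb t x
    refine (intervalIntegrable_const (c := ν * (d * A) + A * A)).mono_fun
      ((buG_meas ν Y hm hc).comp measurable_prodMk_right).aestronglyMeasurable
      (Eventually.of_forall fun s => ?_)
    exact (buG_bound ν A hν hA _ (hc s) x (hb s x).1 (hb s x).2.1 (hb s x).2.2).trans
      (le_abs_self _)
  have hcut : ∀ (y : ℝ → Ed d → Ed d), ∀ t ∈ Ioc (0:ℝ) T, ∀ x,
      ∫ s in (0:ℝ)..t, (ν • lapl (y s) x - fderiv ℝ (y s) x (y s x))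
        = ∫ s in (0:ℝ)..t, buG ν (buCut T y s) x := by
    intro y t ht x
    rw [intervalIntegral.integral_of_le ht.1.le, intervalIntegral.integral_of_le ht.1.le]
    refine setIntegral_congr_fun measurableSet_Ioc fun s hs => ?_
    rw [buCut_in y ⟨hs.1, hs.2.trans ht.2⟩]
    rfl
  have key := bu_core ν T (A₁ + A₂) hν (by positivity) (buCut T y₁) (buCut T y₂) hm₁ hm₂ hc₁ hc₂
    (fun s x => ⟨by linarith [(hb₁ s x).1], by linarith [(hb₁ s x).2.1],
      by linarith [(hb₁ s x).2.2]⟩)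
    (fun s x => ⟨by linarith [(hb₂ s x).1], by linarith [(hb₂ s x).2.1],
      by linarith [(hb₂ s x).2.2]⟩)
    (by
      intro t ht x
      have ht' : t ∈ Icc (0:ℝ) T := ⟨ht.1.le, ht.2⟩
      rw [intervalIntegral.integral_sub (hii _ _ hA₁ hm₁ hc₁ hb₁ t x)
        (hii _ _ hA₂ hm₂ hc₂ hb₂ t x), ← hcut y₁ t ht x, ← hcut y₂ t ht x,
        buCut_in y₁ ht, buCut_in y₂ ht]
      have e1 := heq₁ t ht' x
      have e2 := heq₂ t ht' x
      generalize (∫ s in (0:ℝ)..t, (ν • lapl (y₁ s) x - fderiv ℝ (y₁ s) x (y₁ s x))) = I₁ at *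
      generalize (∫ s in (0:ℝ)..t, (ν • lapl (y₂ s) x - fderiv ℝ (y₂ s) x (y₂ s x))) = I₂ at *
      rw [e1, e2]
      abel)
  intro t ht x
  rcases ht.1.eq_or_lt with h | h
  · subst h
    rw [heq₁ 0 ht x, heq₂ 0 ht x]
    simp
  · have := key t ⟨h, ht.2⟩ x
    rwa [buCut_in y₁ ⟨h, ht.2⟩, buCut_in y₂ ⟨h, ht.2⟩] at this

end
end
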